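/- arXiv:2504.00925 — 4 statements merged into one kernel-verified Lean document; each statement's English description precedes it below -/
import Mathlib

section
/- Let α = (α₁, α₂, α₃) ∈ ℝ³ with α₁ = 1 and with α₂, α₃ irrational real numbers that are algebraic over ℚ. Let r ≥ 2 be an integer and let Ψ̄ : ℤ³ × ℝ → ℝ be a cocycle over the translation action T(n, x) = x + n·α such that for each n ∈ ℤ³ the map x ↦ Ψ̄(n, x) is r-times continuously differentiable and 1-periodic, i.e. Ψ̄(n, x + 1) = Ψ̄(n, x) for all x. Then: (i) the map c : ℤ³ → ℝ given by c(n) = ∫₀¹ Ψ̄(n, x) dx is an additive group homomorphism; and (ii) there exists a continuous 1-periodic function w̄ : ℝ → ℝ, which is (r−2)-times continuously differentiable, such that Ψ̄(n, x) = w̄(x + n·α) − w̄(x) + c(n) for all n ∈ ℤ³ and all x ∈ ℝ. -/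
open MvPolynomial
open scoped Pointwise

namespace MvPolynomial

variable {σ R A : Type*} [CommRing R] [CommRing A]

/-- The Taylor expansion homomorphism `P(X) ↦ P(X + Y)`, the outer variables being `Y`. -/
noncomputable def taylorHom : MvPolynomial σ R →ₐ[R] MvPolynomial σ (MvPolynomial σ R) :=
  aeval fun i => X i + C (X i)

/-- The Hasse derivative of multi-index `μ`: the coefficient of `Y ^ μ` in `P(X + Y)`. -/
noncomputable def hasse (μ : σ →₀ ℕ) (P : MvPolynomial σ R) : MvPolynomial σ R :=
  coeff μ (taylorHom P)

/-- The translation `P(X) ↦ P(X + b)`. -/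
noncomputable def shift (b : σ → R) : MvPolynomial σ R →ₐ[R] MvPolynomial σ R :=
  aeval fun i => X i + C (b i)

@[simp] lemma taylorHom_X (i : σ) :
    taylorHom (X i : MvPolynomial σ R) = X i + C (X i) := by
  simp [taylorHom]

@[simp] lemma taylorHom_C (c : R) : taylorHom (C c : MvPolynomial σ R) = C (C c) := by
  simp [taylorHom, algebraMap_eq, algebraMap_apply]

@[simp] lemma shift_X (b : σ → R) (i : σ) : shift b (X i) = X i + C (b i) := by
  simp [shift]

@[simp] lemma shift_C (b : σ → R) (c : R) : shift b (C c) = C c := by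
  simp [shift, algebraMap_eq]

@[simp] lemma hasse_zero_right (μ : σ →₀ ℕ) : hasse μ (0 : MvPolynomial σ R) = 0 := by
  simp [hasse]

lemma hasse_smul (μ : σ →₀ ℕ) (c : R) (P : MvPolynomial σ R) :
    hasse μ (c • P) = c • hasse μ P := by
  rw [hasse, map_smul, hasse]
  have : c • taylorHom P = (C c : MvPolynomial σ R) • taylorHom P := by
    rw [algebra_compatible_smul (MvPolynomial σ R) c (taylorHom P), algebraMap_eq]
  rw [this, coeff_smul, smul_eq_mul, C_mul']

lemma hasse_sum {ι : Type*} (μ : σ →₀ ℕ) (s : Finset ι) (P : ι → MvPolynomial σ R) :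
    hasse μ (∑ i ∈ s, P i) = ∑ i ∈ s, hasse μ (P i) := by
  simp [hasse, coeff_sum]

lemma hasse_zero_left (P : MvPolynomial σ R) : hasse 0 P = P := by
  have h : (constantCoeff.comp (taylorHom (σ := σ) (R := R)).toRingHom) = RingHom.id _ := by
    apply ringHom_ext <;> simp
  exact congrArg (fun f => f P) h

lemma hasse_map (f : R →+* A) (μ : σ →₀ ℕ) (P : MvPolynomial σ R) :
    hasse μ (map f P) = map f (hasse μ P) := by
  have h : (taylorHom (σ := σ) (R := A)).toRingHom.comp (map f) =
      (map (map f)).comp (taylorHom (σ := σ) (R := R)).toRingHom := by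
    apply ringHom_ext <;> simp
  have := congrArg (coeff μ) (congrArg (fun g => g P) h)
  simpa [hasse, coeff_map] using this

lemma hasse_shift (b : σ → R) (μ : σ →₀ ℕ) (P : MvPolynomial σ R) :
    hasse μ (shift b P) = shift b (hasse μ P) := by
  have h : (taylorHom (σ := σ) (R := R)).toRingHom.comp (shift b).toRingHom =
      (map (shift b).toRingHom).comp (taylorHom (σ := σ) (R := R)).toRingHom := by
    apply ringHom_ext
    · simp
    · intro i
      simp
      ring
  have := congrArg (coeff μ) (congrArg (fun g => g P) h)
  simpa [hasse, coeff_map] using this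

lemma constantCoeff_hasse_shift (b : σ → R) (μ : σ →₀ ℕ) (P : MvPolynomial σ R) :
    eval b (hasse μ P) = coeff μ (shift b P) := by
  have h : (map (eval b)).comp (taylorHom (σ := σ) (R := R)).toRingHom =
      (shift b).toRingHom := by
    apply ringHom_ext <;> simp
  have := congrArg (coeff μ) (congrArg (fun g => g P) h)
  simpa [hasse, coeff_map] using this

lemma eval_shift (b x : σ → R) (P : MvPolynomial σ R) :
    eval x (shift b P) = eval (fun i => x i + b i) P := by
  have h : (eval x).comp (shift b).toRingHom = eval (fun i => x i + b i) := by
    apply ringHom_ext <;> simp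
  exact congrArg (fun f => f P) h

lemma shift_injective (b : σ → R) : Function.Injective (shift b) := by
  have h : (shift (fun i => - b i)).toRingHom.comp (shift b).toRingHom = RingHom.id _ := by
    apply ringHom_ext <;> simp
  intro P Q hPQ
  have hP := congrArg (fun f => f P) h
  have hQ := congrArg (fun f => f Q) h
  simp only [RingHom.comp_apply, RingHom.id_apply] at hP hQ
  rw [← hP, ← hQ]
  exact congrArg _ hPQ

lemma taylorHom_mul_X (P : MvPolynomial σ R) (i : σ) :
    taylorHom (P * X i) = taylorHom P * X i + C (X i) * taylorHom P := by
  simp; ring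

lemma coeff_hasse_ne_zero {P : MvPolynomial σ R} {κ μ : σ →₀ ℕ}
    (h : coeff κ (hasse μ P) ≠ 0) : coeff (κ + μ) P ≠ 0 := by
  classical
  have key : ∀ ν : σ →₀ ℕ, ∀ κ μ : σ →₀ ℕ,
      coeff κ (coeff μ (taylorHom (monomial ν (1 : R)))) ≠ 0 → κ + μ = ν := by
    have hmul : ∀ (ν ν' : σ →₀ ℕ) (Q Q' : MvPolynomial σ (MvPolynomial σ R)),
        (∀ κ μ, coeff κ (coeff μ Q) ≠ 0 → κ + μ = ν) →
        (∀ κ μ, coeff κ (coeff μ Q') ≠ 0 → κ + μ = ν') →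
        ∀ κ μ, coeff κ (coeff μ (Q * Q')) ≠ 0 → κ + μ = ν + ν' := by
      intro ν ν' Q Q' h1 h2 κ μ h
      rw [coeff_mul, coeff_sum] at h
      obtain ⟨x, hx, hx'⟩ := Finset.exists_ne_zero_of_sum_ne_zero h
      rw [coeff_mul] at hx'
      obtain ⟨y, hy, hy'⟩ := Finset.exists_ne_zero_of_sum_ne_zero hx'
      have e1 := h1 _ _ (left_ne_zero_of_mul hy')
      have e2 := h2 _ _ (right_ne_zero_of_mul hy')
      rw [Finset.HasAntidiagonal.mem_antidiagonal] at hx hy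
      rw [← hx, ← hy, ← e1, ← e2]
      abel
    intro ν
    induction ν using Finsupp.induction_linear with
    | zero =>
      intro κ μ h
      have : (monomial 0 (1 : R) : MvPolynomial σ R) = C 1 := rfl
      rw [this, taylorHom_C, coeff_C] at h
      split_ifs at h with h0
      · rw [coeff_C] at h
        split_ifs at h with h1
        · rw [← h0, ← h1]; simp
        · simp at h
      · simp at h
    | add f g hf hg =>
      have : (monomial (f + g) (1 : R)) = monomial f 1 * monomial g 1 := by
        rw [monomial_mul, one_mul]
      rw [this, map_mul]
      exact hmul _ _ _ _ hf hg
    | single a n =>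
      induction n with
      | zero =>
        intro κ μ h
        rw [Finsupp.single_zero] at h ⊢
        have : (monomial 0 (1 : R) : MvPolynomial σ R) = C 1 := rfl
        rw [this, taylorHom_C, coeff_C] at h
        split_ifs at h with h0
        · rw [coeff_C] at h
          split_ifs at h with h1
          · rw [← h0, ← h1]; simp
          · simp at h
        · simp at h
      | succ n ih =>
        have : (monomial (Finsupp.single a (n + 1)) (1 : R)) =
            monomial (Finsupp.single a n) 1 * X a := by
          rw [X, monomial_mul, one_mul, Finsupp.single_add]
        rw [this, map_mul, Finsupp.single_add]
        refine hmul _ _ _ _ ih ?_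
        intro κ μ h
        rw [taylorHom_X, coeff_add, coeff_add, coeff_X, coeff_C] at h
        by_cases h0 : Finsupp.single a 1 = μ
        · have h1 : (0 : σ →₀ ℕ) ≠ μ := by
            rw [← h0]; intro hh
            have := DFunLike.congr_fun hh a
            simp at this
          rw [if_pos h0, if_neg h1, coeff_zero, add_zero, coeff_one] at h
          split_ifs at h with h2
          · rw [← h0, ← h2, zero_add]
          · simp at h
        · rw [if_neg h0, coeff_zero, zero_add] at h
          split_ifs at h with h1
          · rw [coeff_X] at h
            split_ifs at h with h2
            · rw [← h1, ← h2, add_zero]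
            · simp at h
          · simp at h
  have hP : hasse μ P = ∑ ν ∈ P.support, C (coeff ν P) * hasse μ (monomial ν 1) := by
    conv_lhs => rw [P.as_sum]
    rw [hasse_sum]
    refine Finset.sum_congr rfl fun ν _ => ?_
    rw [hasse, ← mul_one (coeff ν P), ← C_mul_monomial, map_mul, taylorHom_C, coeff_C_mul, mul_one,
      hasse]
  rw [hP, coeff_sum] at h
  obtain ⟨ν, hν, hν'⟩ := Finset.exists_ne_zero_of_sum_ne_zero h
  rw [coeff_C_mul] at hν'
  have := key ν κ μ (right_ne_zero_of_mul hν')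
  rw [this]
  exact left_ne_zero_of_mul hν'

lemma coeff_taylorHom_pderiv (i : σ) (μ : σ →₀ ℕ) (P : MvPolynomial σ R) :
    hasse μ (pderiv i P) = pderiv i (hasse μ P) := by
  classical
  simp only [hasse]
  induction P using MvPolynomial.induction_on generalizing μ with
  | C a =>
    simp only [pderiv_C, map_zero, coeff_zero, taylorHom_C, coeff_C]
    split_ifs <;> simp
  | add p q hp hq => simp [hp, hq]
  | mul_X p j hp =>
    rw [pderiv_mul, map_add, taylorHom_mul_X, taylorHom_mul_X, coeff_add, coeff_add, coeff_add,
      coeff_C_mul, coeff_C_mul, coeff_mul_X', coeff_mul_X', hp, map_add, pderiv_mul]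
    by_cases hij : j = i
    · subst hij
      simp only [pderiv_X_self, mul_one]
      split_ifs <;> simp [hp] <;> ring
    · rw [pderiv_X_of_ne hij]
      split_ifs <;> simp [hp]

lemma pderiv_taylorHom (i : σ) (P : MvPolynomial σ R) :
    pderiv i (taylorHom P) = taylorHom (pderiv i P) := by
  classical
  induction P using MvPolynomial.induction_on with
  | C a => simp
  | add p q hp hq => simp [hp, hq]
  | mul_X p j hp =>
    rw [pderiv_mul, map_mul, pderiv_mul, hp, map_add, map_mul, map_mul, taylorHom_X]
    by_cases hij : j = i
    · subst hij; simp
    · simp [pderiv_X_of_ne hij]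

lemma pderiv_hasse (i : σ) (μ : σ →₀ ℕ) (P : MvPolynomial σ R) :
    pderiv i (hasse μ P) = ((μ i : MvPolynomial σ R) + 1) * hasse (μ + Finsupp.single i 1) P := by
  rw [← coeff_taylorHom_pderiv, hasse, ← pderiv_taylorHom, coeff_pderiv, hasse, mul_comm]

/-- The sum of the sizes of the coefficients of a polynomial, as a ring seminorm. -/
noncomputable def l1 (N : RingSeminorm R) : RingSeminorm (MvPolynomial σ R) where
  toFun P := ∑ ν ∈ P.support, N (coeff ν P)
  map_zero' := by simp
  add_le' P Q := by
    classical
    have e : ∀ (P : MvPolynomial σ R) (s : Finset (σ →₀ ℕ)), P.support ⊆ s →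
        ∑ ν ∈ P.support, N (coeff ν P) = ∑ ν ∈ s, N (coeff ν P) := by
      intro P s hs
      refine Finset.sum_subset hs fun ν _ hν => ?_
      rw [notMem_support_iff.1 hν, map_zero]
    rw [e P (P.support ∪ Q.support) Finset.subset_union_left,
      e Q (P.support ∪ Q.support) Finset.subset_union_right,
      e (P + Q) (P.support ∪ Q.support) support_add, ← Finset.sum_add_distrib]
    refine Finset.sum_le_sum fun ν _ => ?_
    rw [coeff_add]
    exact map_add_le_add N _ _
  neg' P := by
    rw [support_neg]
    refine Finset.sum_congr rfl fun ν _ => ?_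
    rw [coeff_neg, map_neg_eq_map]
  mul_le' P Q := by
    classical
    have h : (P * Q).support ⊆ P.support + Q.support := support_mul P Q
    rw [Finset.sum_mul_sum, ← Finset.sum_product']
    calc ∑ ν ∈ (P * Q).support, N (coeff ν (P * Q))
        ≤ ∑ ν ∈ (P.support + Q.support), N (coeff ν (P * Q)) :=
          Finset.sum_le_sum_of_subset_of_nonneg h fun _ _ _ => apply_nonneg N _
      _ ≤ ∑ ν ∈ (P.support + Q.support), ∑ x ∈ (P.support ×ˢ Q.support) with x.1 + x.2 = ν,
            N (coeff x.1 P) * N (coeff x.2 Q) := by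
          refine Finset.sum_le_sum fun ν _ => ?_
          have : coeff ν (P * Q) = ∑ x ∈ (P.support ×ˢ Q.support) with x.1 + x.2 = ν,
              coeff x.1 P * coeff x.2 Q := by
            rw [coeff_mul]
            symm
            refine Finset.sum_subset ?_ ?_
            · intro x hx
              simp only [Finset.mem_filter] at hx
              exact Finset.HasAntidiagonal.mem_antidiagonal.2 hx.2
            · intro x hx hx'
              by_contra h0
              apply hx'
              simp only [Finset.mem_filter, Finset.mem_product, mem_support_iff]
              exact ⟨⟨left_ne_zero_of_mul h0, right_ne_zero_of_mul h0⟩, Finset.HasAntidiagonal.mem_antidiagonal.1 hx⟩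
          rw [this]
          refine (Finset.le_sum_of_subadditive N (map_zero N).le (map_add_le_add N) _ _).trans ?_
          exact Finset.sum_le_sum fun x _ => map_mul_le_mul N _ _
      _ = _ := by
          refine Finset.sum_fiberwise_of_maps_to (fun x hx => ?_) _
          rw [Finset.mem_product] at hx
          exact Finset.add_mem_add hx.1 hx.2

lemma l1_apply (N : RingSeminorm R) (P : MvPolynomial σ R) :
    l1 N P = ∑ ν ∈ P.support, N (coeff ν P) := rfl

lemma le_l1 (N : RingSeminorm R) (P : MvPolynomial σ R) (ν : σ →₀ ℕ) : N (coeff ν P) ≤ l1 N P := by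
  by_cases h : ν ∈ P.support
  · exact Finset.single_le_sum (f := fun ν => N (coeff ν P)) (fun _ _ => apply_nonneg N _) h
  · rw [notMem_support_iff.1 h, map_zero]
    exact apply_nonneg (l1 N) P

lemma l1_monomial (N : RingSeminorm R) (ν : σ →₀ ℕ) (c : R) :
    l1 N (monomial ν c) = N c := by
  classical
  rw [l1_apply, support_monomial]
  split_ifs with h
  · simp [h]
  · simp

lemma seminorm_mul_prod_pow_le {ι : Type*} (S : RingSeminorm A) (g : ι → A) (K : ℝ) (hK : 0 ≤ K)
    (hg : ∀ i, S (g i) ≤ K) (s : Finset ι) (ν : ι → ℕ) (a : A) :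
    S (a * ∏ i ∈ s, g i ^ ν i) ≤ S a * K ^ ∑ i ∈ s, ν i := by
  classical
  induction s using Finset.induction_on with
  | empty => simp
  | insert i s hi ih =>
    have hpow : ∀ (n : ℕ) (a : A), S (a * g i ^ n) ≤ S a * K ^ n := by
      intro n
      induction n with
      | zero => simp
      | succ n ih =>
        intro a
        rw [pow_succ, ← mul_assoc, pow_succ, ← mul_assoc]
        exact (map_mul_le_mul S _ _).trans
          (mul_le_mul (ih a) (hg i) (apply_nonneg S _)
            (mul_nonneg (apply_nonneg S _) (pow_nonneg hK n)))
    rw [Finset.prod_insert hi, Finset.sum_insert hi, mul_comm (g i ^ ν i), ← mul_assoc]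
    refine (hpow _ _).trans ?_
    rw [add_comm, pow_add, ← mul_assoc]
    exact mul_le_mul_of_nonneg_right ih (pow_nonneg hK _)

lemma seminorm_eval₂_le (S : RingSeminorm A) (N : RingSeminorm R) (f : R →+* A) (g : σ → A) (K : ℝ)
    (hf : ∀ c, S (f c) ≤ N c) (hK : 1 ≤ K) (hg : ∀ i, S (g i) ≤ K) (P : MvPolynomial σ R) (n : ℕ)
    (hn : ∀ ν ∈ P.support, ν.degree ≤ n) :
    S (eval₂ f g P) ≤ K ^ n * l1 N P := by
  rw [eval₂_eq, l1_apply, Finset.mul_sum]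
  refine (Finset.le_sum_of_subadditive S (map_zero S).le (map_add_le_add S) _ _).trans ?_
  refine Finset.sum_le_sum fun ν hν => ?_
  refine (seminorm_mul_prod_pow_le S g K (by linarith) hg _ _ _).trans ?_
  rw [mul_comm]
  have h1 : K ^ (∑ i ∈ ν.support, ν i) ≤ K ^ n := by
    apply pow_le_pow_right₀ hK
    simpa [Finsupp.degree_apply] using hn ν hν
  exact mul_le_mul h1 (hf _) (apply_nonneg S _) (by positivity)

lemma l1_hasse_le (N : RingSeminorm R) (h1 : N 1 ≤ 1) (μ : σ →₀ ℕ) (P : MvPolynomial σ R) (n : ℕ)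
    (hn : ∀ ν ∈ P.support, ν.degree ≤ n) :
    l1 N (hasse μ P) ≤ 2 ^ n * l1 N P := by
  refine (le_l1 (l1 N) (taylorHom P) μ).trans ?_
  rw [taylorHom, aeval_def]
  refine seminorm_eval₂_le (l1 (l1 N)) N _ _ 2 ?_ one_le_two ?_ P n hn
  · intro c
    have : algebraMap R (MvPolynomial σ (MvPolynomial σ R)) c = monomial 0 (monomial 0 c) := rfl
    rw [this, l1_monomial, l1_monomial]
  · intro i
    refine (map_add_le_add (l1 (l1 N)) _ _).trans ?_
    have e1 : l1 (l1 N) (X i : MvPolynomial σ (MvPolynomial σ R)) = N 1 := by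
      rw [X, l1_monomial]
      exact l1_monomial N 0 1
    have e2 : l1 (l1 N) (C (X i) : MvPolynomial σ (MvPolynomial σ R)) = N 1 := by
      rw [C_apply, l1_monomial, X, l1_monomial]
    rw [e1, e2]
    linarith

lemma l1_shift_le (N : RingSeminorm R) (h1 : N 1 ≤ 1) (b : σ → R) (K : ℝ) (hK : 0 ≤ K)
    (hb : ∀ i, N (b i) ≤ K) (P : MvPolynomial σ R) (n : ℕ)
    (hn : ∀ ν ∈ P.support, ν.degree ≤ n) :
    l1 N (shift b P) ≤ (1 + K) ^ n * l1 N P := by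
  rw [shift, aeval_def]
  refine seminorm_eval₂_le (l1 N) N _ _ _ ?_ (by linarith) ?_ P n hn
  · intro c
    rw [algebraMap_eq, C_apply, l1_monomial]
  · intro i
    refine (map_add_le_add (l1 N) _ _).trans ?_
    rw [X, C_apply, l1_monomial, l1_monomial]
    exact add_le_add h1 (hb i)

end MvPolynomial

namespace MvPolynomial

variable {σ K ι : Type*} [Field K]

/-- If all Hasse derivatives of the `φ j` satisfy one common linear relation with polynomial
coefficients, the relation is trivial. -/
lemma eq_zero_of_forall_sum_mul_hasse [Fintype ι] {φ : ι → MvPolynomial σ K}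
    (hφ : LinearIndependent K φ) (c : ι → MvPolynomial σ K)
    (h : ∀ μ, ∑ j, c j * hasse μ (φ j) = 0) : c = 0 := by
  have h1 : ∑ j, C (c j) * taylorHom (φ j) = 0 := by
    ext1 μ
    rw [coeff_sum, coeff_zero, ← h μ]
    exact Finset.sum_congr rfl fun j _ => by rw [coeff_C_mul, hasse]
  let ψ : MvPolynomial σ (MvPolynomial σ K) →ₐ[MvPolynomial σ K]
      MvPolynomial σ (MvPolynomial σ K) := aeval fun i => X i - C (X i)
  have hψ : ψ.toRingHom.comp (taylorHom (σ := σ) (R := K)).toRingHom = map C := by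
    apply ringHom_ext <;> intro i <;> simp [ψ, algebraMap_eq]
  have hψ' : ∀ P : MvPolynomial σ K, ψ (taylorHom P) = map C P := fun P =>
    congrArg (fun g => g P) hψ
  have h2 : ∑ j, C (c j) * map C (φ j) = 0 := by
    have := congrArg ψ h1
    rw [map_sum, map_zero] at this
    rw [← this]
    refine Finset.sum_congr rfl fun j _ => ?_
    rw [map_mul, hψ']
    congr 1
    simp [ψ, algebraMap_eq]
  have h3 : ∀ κ, ∑ j, coeff κ (c j) • φ j = 0 := by
    intro κ
    ext1 ν
    have := congrArg (coeff κ) (congrArg (coeff ν) h2)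
    rw [coeff_sum, coeff_sum, coeff_zero, coeff_zero] at this
    rw [coeff_sum, coeff_zero, ← this]
    refine Finset.sum_congr rfl fun j _ => ?_
    rw [coeff_C_mul, coeff_map, mul_comm, coeff_C_mul, coeff_smul, smul_eq_mul, mul_comm]
  funext j
  ext1 κ
  exact Fintype.linearIndependent_iff.1 hφ _ (h3 κ) j

/-- The span over the polynomial ring of the vectors of Hasse derivatives of order at most `a`. -/
noncomputable def hasseSpan (φ : ι → MvPolynomial σ K) (a : ℕ) :
    Submodule (MvPolynomial σ K) (ι → MvPolynomial σ K) :=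
  Submodule.span _ {v | ∃ μ : σ →₀ ℕ, μ.degree ≤ a ∧ v = fun j => hasse μ (φ j)}

/-- The span over the fraction field of the vectors of Hasse derivatives of order at most `a`. -/
noncomputable def hasseFracSpan (φ : ι → MvPolynomial σ K) (a : ℕ) :
    Submodule (FractionRing (MvPolynomial σ K)) (ι → FractionRing (MvPolynomial σ K)) :=
  Submodule.span _ {v | ∃ μ : σ →₀ ℕ, μ.degree ≤ a ∧ v = fun j => algebraMap _ _ (hasse μ (φ j))}

lemma hasseSpan_mono (φ : ι → MvPolynomial σ K) {a b : ℕ} (h : a ≤ b) :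
    hasseSpan φ a ≤ hasseSpan φ b :=
  Submodule.span_mono fun _ ⟨μ, hμ, e⟩ => ⟨μ, hμ.trans h, e⟩

lemma hasseFracSpan_mono (φ : ι → MvPolynomial σ K) {a b : ℕ} (h : a ≤ b) :
    hasseFracSpan φ a ≤ hasseFracSpan φ b :=
  Submodule.span_mono fun _ ⟨μ, hμ, e⟩ => ⟨μ, hμ.trans h, e⟩

lemma pderiv_mem_hasseSpan (φ : ι → MvPolynomial σ K) (a : ℕ) (i : σ) {v : ι → MvPolynomial σ K}
    (hv : v ∈ hasseSpan φ a) : (fun j => pderiv i (v j)) ∈ hasseSpan φ (a + 1) := by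
  induction hv using Submodule.span_induction with
  | mem x hx =>
    obtain ⟨μ, hμ, rfl⟩ := hx
    have : (fun j => pderiv i (hasse μ (φ j))) =
        ((μ i : MvPolynomial σ K) + 1) • fun j => hasse (μ + Finsupp.single i 1) (φ j) := by
      funext j
      simp [pderiv_hasse]
    rw [this]
    refine Submodule.smul_mem _ _ (Submodule.subset_span ⟨_, ?_, rfl⟩)
    rw [map_add, Finsupp.degree_single]
    omega
  | zero =>
    simp only [Pi.zero_apply, map_zero]
    exact Submodule.zero_mem (hasseSpan φ (a + 1))
  | add x y _ _ hx hy => simpa [Pi.add_def] using Submodule.add_mem _ hx hy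
  | smul r x hx' hx =>
    have : (fun j => pderiv i ((r • x) j)) = pderiv i r • x + r • fun j => pderiv i (x j) := by
      funext j
      simp [mul_comm, add_comm]
    rw [this]
    exact Submodule.add_mem _ (Submodule.smul_mem _ _ (hasseSpan_mono φ (Nat.le_succ a) hx'))
      (Submodule.smul_mem _ _ hx)

lemma exists_smul_mem_hasseSpan (φ : ι → MvPolynomial σ K) (a : ℕ)
    {v : ι → FractionRing (MvPolynomial σ K)} (hv : v ∈ hasseFracSpan φ a) :
    ∃ c : MvPolynomial σ K, c ≠ 0 ∧ ∃ y ∈ hasseSpan φ a,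
      ∀ j, algebraMap _ _ c * v j = algebraMap _ _ (y j) := by
  induction hv using Submodule.span_induction with
  | mem x hx =>
    obtain ⟨μ, hμ, rfl⟩ := hx
    exact ⟨1, one_ne_zero, _, Submodule.subset_span ⟨μ, hμ, rfl⟩, fun j => by simp⟩
  | zero => exact ⟨1, one_ne_zero, 0, Submodule.zero_mem _, fun j => by simp⟩
  | add x y _ _ hx hy =>
    obtain ⟨c, hc, u, hu, hcu⟩ := hx
    obtain ⟨d, hd, w, hw, hdw⟩ := hy
    refine ⟨c * d, mul_ne_zero hc hd, d • u + c • w,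
      Submodule.add_mem _ (Submodule.smul_mem _ _ hu) (Submodule.smul_mem _ _ hw), fun j => ?_⟩
    simp only [Pi.add_apply, Pi.smul_apply, smul_eq_mul, map_add, map_mul, ← hcu, ← hdw]
    ring
  | smul r x _ hx =>
    obtain ⟨c, hc, u, hu, hcu⟩ := hx
    obtain ⟨⟨p, q⟩, hq⟩ := IsLocalization.surj (nonZeroDivisors (MvPolynomial σ K)) r
    refine ⟨q * c, mul_ne_zero (nonZeroDivisors.ne_zero q.2) hc, p • u,
      Submodule.smul_mem _ _ hu, fun j => ?_⟩
    simp only [Pi.smul_apply, smul_eq_mul, map_mul, ← hcu]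
    rw [← hq]
    ring

/-- If two consecutive spans agree, then all later ones do. -/
lemma hasseFracSpan_succ_le [CharZero K] (φ : ι → MvPolynomial σ K) (a : ℕ)
    (h : hasseFracSpan φ (a + 1) ≤ hasseFracSpan φ a) :
    hasseFracSpan φ (a + 2) ≤ hasseFracSpan φ (a + 1) := by
  refine Submodule.span_le.2 ?_
  rintro _ ⟨μ, hμ, rfl⟩
  by_cases hμ' : μ.degree ≤ a + 1
  · exact Submodule.subset_span ⟨μ, hμ', rfl⟩
  have hne : μ ≠ 0 := by
    rintro rfl
    simp at hμ'
  obtain ⟨i, hi⟩ := Finsupp.ne_iff.1 hne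
  obtain ⟨κ, rfl⟩ : ∃ κ, μ = κ + Finsupp.single i 1 := by
    refine ⟨μ - Finsupp.single i 1, (tsub_add_cancel_of_le ?_).symm⟩
    rw [Finsupp.single_le_iff]
    exact Nat.one_le_iff_ne_zero.2 hi
  rw [map_add, Finsupp.degree_single] at hμ
  obtain ⟨c, hc, y, hy, hcy⟩ := exists_smul_mem_hasseSpan φ a
    (h (Submodule.subset_span ⟨κ, (by omega : κ.degree ≤ a + 1), rfl⟩))
  have hcy' : ∀ j, c * hasse κ (φ j) = y j := fun j =>
    IsFractionRing.injective (MvPolynomial σ K) (FractionRing (MvPolynomial σ K))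
      (by rw [map_mul, hcy])
  have hy' := pderiv_mem_hasseSpan φ a i hy
  have hsmall : (fun j => pderiv i c * hasse κ (φ j)) ∈ hasseSpan φ (a + 1) :=
    Submodule.smul_mem _ (pderiv i c)
      (Submodule.subset_span ⟨κ, (by omega : κ.degree ≤ a + 1), rfl⟩)
  have hsub := Submodule.sub_mem _ hy' hsmall
  have hcast : ∀ z ∈ hasseSpan φ (a + 1),
      (fun j => algebraMap (MvPolynomial σ K) (FractionRing (MvPolynomial σ K)) (z j)) ∈
        hasseFracSpan φ (a + 1) := by
    intro z hz
    induction hz using Submodule.span_induction with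
    | mem x hx =>
      obtain ⟨μ, hμ, rfl⟩ := hx
      exact Submodule.subset_span ⟨μ, hμ, rfl⟩
    | zero =>
      simp only [Pi.zero_apply, map_zero]
      exact Submodule.zero_mem (hasseFracSpan φ (a + 1))
    | add x y _ _ hx hy => simpa [Pi.add_def] using Submodule.add_mem _ hx hy
    | smul r x _ hx =>
      have := Submodule.smul_mem _ (algebraMap _ (FractionRing (MvPolynomial σ K)) r) hx
      simpa only [Pi.smul_apply, smul_eq_mul, map_mul, Pi.smul_def] using this
  have hfin := hcast _ hsub
  set d : MvPolynomial σ K := c * ((κ i : MvPolynomial σ K) + 1) with hd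
  have hd0 : algebraMap (MvPolynomial σ K) (FractionRing (MvPolynomial σ K)) d ≠ 0 := by
    rw [Ne, IsFractionRing.to_map_eq_zero_iff, hd]
    refine mul_ne_zero hc ?_
    exact_mod_cast Nat.succ_ne_zero (κ i)
  have := Submodule.smul_mem _ (algebraMap (MvPolynomial σ K) (FractionRing (MvPolynomial σ K)) d)⁻¹
    hfin
  refine (congrArg (· ∈ hasseFracSpan φ (a + 1)) ?_).mpr this
  funext j
  rw [Pi.smul_apply, smul_eq_mul, eq_inv_mul_iff_mul_eq₀ hd0, ← map_mul]
  congr 1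
  rw [Pi.sub_apply, ← hcy', pderiv_mul, pderiv_hasse, hd]
  ring

lemma eq_top_of_hasseFracSpan_le [Fintype ι] {φ : ι → MvPolynomial σ K} (hφ : LinearIndependent K φ)
    (M : Submodule (FractionRing (MvPolynomial σ K)) (ι → FractionRing (MvPolynomial σ K)))
    (hM : ∀ a, hasseFracSpan φ a ≤ M) : M = ⊤ := by
  classical
  by_contra hne
  obtain ⟨f, hf0, hf⟩ := Submodule.exists_le_ker_of_lt_top M (lt_top_iff_ne_top.2 hne)
  obtain ⟨b, hb⟩ := IsLocalization.exist_integer_multiples_of_finite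
    (nonZeroDivisors (MvPolynomial σ K)) (fun j => f (Pi.single j 1))
  choose c hc using hb
  have hb0 : algebraMap (MvPolynomial σ K) (FractionRing (MvPolynomial σ K)) b ≠ 0 := by
    rw [Ne, IsFractionRing.to_map_eq_zero_iff]
    exact nonZeroDivisors.ne_zero b.2
  have hsum : ∀ v, f v = ∑ j, v j * f (Pi.single j 1) := by
    intro v
    conv_lhs => rw [pi_eq_sum_univ' v]
    simp [map_sum]
  have hc0 : c = 0 := by
    refine eq_zero_of_forall_sum_mul_hasse hφ c fun μ => ?_
    apply IsFractionRing.injective (MvPolynomial σ K) (FractionRing (MvPolynomial σ K))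
    have := hf (hM μ.degree (Submodule.subset_span ⟨μ, le_rfl, rfl⟩))
    rw [LinearMap.mem_ker, hsum] at this
    rw [map_zero, map_sum, ← mul_zero (algebraMap _ _ (b : MvPolynomial σ K)), ← this,
      Finset.mul_sum]
    refine Finset.sum_congr rfl fun j _ => ?_
    rw [map_mul, hc, Algebra.smul_def]
    ring
  apply hf0
  ext j
  have := hc j
  rw [hc0, Pi.zero_apply, map_zero, Algebra.smul_def] at this
  simpa using (mul_eq_zero.1 this.symm).resolve_left hb0

lemma hasseFracSpan_eq_top [CharZero K] [Fintype ι] {φ : ι → MvPolynomial σ K}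
    (hφ : LinearIndependent K φ) {a : ℕ}
    (ha : Fintype.card ι ≤ a + 1) : hasseFracSpan φ a = ⊤ := by
  have stab : ∀ a, hasseFracSpan φ (a + 1) ≤ hasseFracSpan φ a → hasseFracSpan φ a = ⊤ := by
    intro a h
    have h1 : ∀ n, hasseFracSpan φ (a + n + 1) ≤ hasseFracSpan φ (a + n) := by
      intro n
      induction n with
      | zero => exact h
      | succ n ih => exact hasseFracSpan_succ_le φ _ ih
    have h2 : ∀ n, hasseFracSpan φ (a + n) ≤ hasseFracSpan φ a := by
      intro n
      induction n with
      | zero => exact le_rfl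
      | succ n ih => exact (h1 n).trans ih
    exact eq_top_of_hasseFracSpan_le hφ _ fun b =>
      (hasseFracSpan_mono φ (Nat.le_add_left b a)).trans (h2 b)
  have key : ∀ a, hasseFracSpan φ a = ⊤ ∨
      a + 1 ≤ Module.finrank (FractionRing (MvPolynomial σ K)) (hasseFracSpan φ a) := by
    intro a
    induction a with
    | zero =>
      by_cases h : hasseFracSpan φ 0 = ⊤
      · exact Or.inl h
      right
      rw [zero_add, Nat.one_le_iff_ne_zero, Ne, Submodule.finrank_eq_zero]
      intro h0
      have hv : (fun j => algebraMap (MvPolynomial σ K) (FractionRing (MvPolynomial σ K)) (φ j)) ∈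
          hasseFracSpan φ 0 :=
        Submodule.subset_span ⟨0, by simp, by simp [hasse_zero_left]⟩
      rw [h0, Submodule.mem_bot] at hv
      rcases isEmpty_or_nonempty ι with hι | ⟨⟨j⟩⟩
      · exact h (Subsingleton.elim _ _)
      · have := congrFun hv j
        simp only [Pi.zero_apply, IsFractionRing.to_map_eq_zero_iff] at this
        exact hφ.ne_zero j this
    | succ a ih =>
      by_cases h : hasseFracSpan φ (a + 1) ≤ hasseFracSpan φ a
      · left
        have := stab a h
        exact top_le_iff.1 (this ▸ hasseFracSpan_mono φ (Nat.le_succ a))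
      · rcases ih with ih | ih
        · exact absurd (ih ▸ le_top) h
        right
        have hlt : hasseFracSpan φ a < hasseFracSpan φ (a + 1) :=
          lt_of_le_not_ge (hasseFracSpan_mono φ (Nat.le_succ a)) h
        have := Submodule.finrank_lt_finrank_of_lt hlt
        omega
  rcases key a with h | h
  · exact h
  · apply Submodule.eq_top_of_finrank_eq
    rw [Module.finrank_fintype_fun_eq_card]
    have := Submodule.finrank_le (hasseFracSpan φ a)
    rw [Module.finrank_fintype_fun_eq_card] at this
    omega

/-- Nonvanishing of some generalised Wronskian of linearly independent polynomials. -/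
theorem exists_det_hasse_ne_zero [CharZero K] [Fintype ι] [DecidableEq ι]
    {φ : ι → MvPolynomial σ K}
    (hφ : LinearIndependent K φ) :
    ∃ μ : ι → (σ →₀ ℕ), (∀ i, (μ i).degree + 1 ≤ Fintype.card ι) ∧
      (Matrix.of fun i j => hasse (μ i) (φ j)).det ≠ 0 := by
  classical
  rcases isEmpty_or_nonempty ι with hι | hι
  · exact ⟨fun i => isEmptyElim i, fun i => isEmptyElim i, by simp⟩
  have hcard : 0 < Fintype.card ι := Fintype.card_pos
  have htop := hasseFracSpan_eq_top hφ (a := Fintype.card ι - 1) (by omega)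
  obtain ⟨b, hb, hspan, hli⟩ := exists_linearIndependent (FractionRing (MvPolynomial σ K))
    {v : ι → FractionRing (MvPolynomial σ K) | ∃ μ : σ →₀ ℕ, μ.degree ≤ Fintype.card ι - 1 ∧
      v = fun j => algebraMap _ _ (hasse μ (φ j))}
  let B := Module.Basis.mk hli (by
    rw [Subtype.range_coe, hspan]
    exact htop.ge)
  let e : ι ≃ b := (Pi.basisFun (FractionRing (MvPolynomial σ K)) ι).indexEquiv B
  have hmem : ∀ i, ∃ μ : σ →₀ ℕ, μ.degree ≤ Fintype.card ι - 1 ∧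
      ((e i : b) : ι → FractionRing (MvPolynomial σ K)) =
        fun j => algebraMap _ _ (hasse μ (φ j)) := fun i => hb (e i).2
  choose μ hμ hμ' using hmem
  refine ⟨μ, fun i => by have := hμ i; omega, fun h0 => ?_⟩
  have hli' : LinearIndependent (FractionRing (MvPolynomial σ K))
      (fun i => ((e i : b) : ι → FractionRing (MvPolynomial σ K))) := hli.comp e e.injective
  have hdet : (Matrix.of fun i j => algebraMap (MvPolynomial σ K)
      (FractionRing (MvPolynomial σ K)) (hasse (μ i) (φ j))).det = 0 := by
    have := congrArg (algebraMap (MvPolynomial σ K) (FractionRing (MvPolynomial σ K))) h0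
    rw [RingHom.map_det, map_zero] at this
    exact this
  have hunit := Matrix.linearIndependent_rows_iff_isUnit (A := Matrix.of fun i j =>
    algebraMap (MvPolynomial σ K) (FractionRing (MvPolynomial σ K)) (hasse (μ i) (φ j)))
  have h1 := hunit.1 (by
    have hrow : (Matrix.of fun i j => algebraMap (MvPolynomial σ K)
        (FractionRing (MvPolynomial σ K)) (hasse (μ i) (φ j))).row =
        fun i => ((e i : b) : ι → FractionRing (MvPolynomial σ K)) := by
      funext i
      rw [hμ']
      rfl
    rw [hrow]
    exact hli')
  rw [Matrix.isUnit_iff_isUnit_det, hdet] at h1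
  exact not_isUnit_zero h1

end MvPolynomial

namespace MvPolynomial

variable {σ R A : Type*} [CommRing R] [CommRing A]

lemma coeff_mul_of_separated {m : σ} {P Q : MvPolynomial σ R}
    (hP : ∀ ν ∈ P.support, ν m = 0) (hQ : ∀ ν ∈ Q.support, ∀ h, h ≠ m → ν h = 0)
    {κ : σ →₀ ℕ} (hκ : κ m = 0) (a : ℕ) :
    coeff (κ + Finsupp.single m a) (P * Q) = coeff κ P * coeff (Finsupp.single m a) Q := by
  classical
  rw [coeff_mul]
  refine Finset.sum_eq_single_of_mem (κ, Finsupp.single m a)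
    (Finset.HasAntidiagonal.mem_antidiagonal.2 rfl) ?_
  rintro ⟨x, y⟩ hxy hne
  rw [Finset.HasAntidiagonal.mem_antidiagonal] at hxy
  by_contra h0
  have hx := hP x (mem_support_iff.2 (left_ne_zero_of_mul h0))
  have hy := hQ y (mem_support_iff.2 (right_ne_zero_of_mul h0))
  apply hne
  simp only at hxy
  have hpt : ∀ h, x h = κ h ∧ y h = Finsupp.single m a h := by
    intro h
    have e := DFunLike.congr_fun hxy h
    simp only [Finsupp.add_apply] at e
    by_cases hm : h = m
    · subst hm
      rw [hx, hκ] at e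
      exact ⟨by rw [hx, hκ], by simpa using e⟩
    · rw [Finsupp.single_eq_of_ne hm, hy h hm] at e
      rw [Finsupp.single_eq_of_ne hm, hy h hm]
      exact ⟨by simpa using e, rfl⟩
  exact Prod.ext (Finsupp.ext fun h => (hpt h).1) (Finsupp.ext fun h => (hpt h).2)

lemma exists_add_mem_support_of_hasse_ne_zero {P : MvPolynomial σ R} {μ : σ →₀ ℕ}
    (h : hasse μ P ≠ 0) : ∃ κ, κ + μ ∈ P.support := by
  obtain ⟨κ, hκ⟩ := ne_zero_iff.1 h
  exact ⟨κ, mem_support_iff.2 (coeff_hasse_ne_zero hκ)⟩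

lemma exists_add_mem_support_of_coeff_shift_ne_zero {P : MvPolynomial σ R} {b : σ → R}
    {μ : σ →₀ ℕ} (h : coeff μ (shift b P) ≠ 0) : ∃ κ, κ + μ ∈ P.support := by
  refine exists_add_mem_support_of_hasse_ne_zero fun h0 => h ?_
  rw [← constantCoeff_hasse_shift, h0, map_zero]

lemma hasse_mul_of_separated {m : σ} {P Q : MvPolynomial σ R}
    (hP : ∀ ν ∈ P.support, ν m = 0) (hQ : ∀ ν ∈ Q.support, ∀ h, h ≠ m → ν h = 0)
    {κ : σ →₀ ℕ} (hκ : κ m = 0) (a : ℕ) :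
    hasse (κ + Finsupp.single m a) (P * Q) = hasse κ P * hasse (Finsupp.single m a) Q := by
  rw [hasse, map_mul]
  refine coeff_mul_of_separated ?_ ?_ hκ a
  · intro ν hν
    obtain ⟨μ, hμ⟩ := exists_add_mem_support_of_hasse_ne_zero (mem_support_iff.1 hν)
    have := hP _ hμ
    simp only [Finsupp.add_apply] at this
    omega
  · intro ν hν h hh
    obtain ⟨μ, hμ⟩ := exists_add_mem_support_of_hasse_ne_zero (mem_support_iff.1 hν)
    have := hQ _ hμ h hh
    simp only [Finsupp.add_apply] at this
    omega

/-- All monomials of `P` have `w`-weight at least `θ`. -/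
def WeightGE (w : (σ →₀ ℕ) →+ ℝ) (θ : ℝ) (P : MvPolynomial σ R) : Prop :=
  ∀ ν ∈ P.support, θ ≤ w ν

lemma WeightGE.mul {w : (σ →₀ ℕ) →+ ℝ} {θ θ' : ℝ} {P Q : MvPolynomial σ R}
    (hP : WeightGE w θ P) (hQ : WeightGE w θ' Q) : WeightGE w (θ + θ') (P * Q) := by
  classical
  intro ν hν
  obtain ⟨x, hx, y, hy, rfl⟩ := Finset.mem_add.1 (support_mul P Q hν)
  rw [map_add]
  exact add_le_add (hP x hx) (hQ y hy)

lemma WeightGE.prod {w : (σ →₀ ℕ) →+ ℝ} {ι : Type*} (s : Finset ι) (θ : ι → ℝ)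
    (P : ι → MvPolynomial σ R) (h : ∀ i ∈ s, WeightGE w (θ i) (P i)) :
    WeightGE w (∑ i ∈ s, θ i) (∏ i ∈ s, P i) := by
  classical
  induction s using Finset.induction_on with
  | empty =>
    intro ν hν
    rw [Finset.prod_empty, mem_support_iff, coeff_one] at hν
    split_ifs at hν with h0
    · simp [← h0]
    · simp at hν
  | insert i s hi ih =>
    rw [Finset.sum_insert hi, Finset.prod_insert hi]
    exact (h i (Finset.mem_insert_self i s)).mul
      (ih fun j hj => h j (Finset.mem_insert_of_mem hj))

lemma WeightGE.det {w : (σ →₀ ℕ) →+ ℝ} {ι : Type*} [Fintype ι] [DecidableEq ι] (θ : ι → ℝ)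
    (M : Matrix ι ι (MvPolynomial σ R)) (h : ∀ i j, WeightGE w (θ j) (M i j)) :
    WeightGE w (∑ j, θ j) M.det := by
  classical
  intro ν hν
  rw [Matrix.det_apply, mem_support_iff, coeff_sum] at hν
  obtain ⟨τ, _, hτ⟩ := Finset.exists_ne_zero_of_sum_ne_zero hν
  have h1 : coeff ν (∏ i, M (τ i) i) ≠ 0 := by
    intro h0
    apply hτ
    rw [Units.smul_def, coeff_smul, h0, smul_zero]
  exact WeightGE.prod Finset.univ θ _ (fun i _ => h (τ i) i) ν (mem_support_iff.2 h1)

lemma seminorm_prod_le {ι : Type*} (S : RingSeminorm A) (h1 : S 1 ≤ 1) (s : Finset ι)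
    (g : ι → A) (B : ℝ) (hg : ∀ i ∈ s, S (g i) ≤ B) :
    S (∏ i ∈ s, g i) ≤ B ^ s.card := by
  classical
  induction s using Finset.induction_on with
  | empty => simpa using h1
  | insert i s hi ih =>
    rw [Finset.prod_insert hi, Finset.card_insert_of_notMem hi, pow_succ']
    have hi' := hg i (Finset.mem_insert_self i s)
    exact (map_mul_le_mul S _ _).trans (mul_le_mul hi'
      (ih fun j hj => hg j (Finset.mem_insert_of_mem hj)) (apply_nonneg S _)
      ((apply_nonneg S _).trans hi'))

lemma seminorm_det_le {ι : Type*} [Fintype ι] [DecidableEq ι] (S : RingSeminorm A) (h1 : S 1 ≤ 1)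
    (M : Matrix ι ι A) (B : ℝ) (hM : ∀ i j, S (M i j) ≤ B) :
    S M.det ≤ (Fintype.card ι).factorial * B ^ Fintype.card ι := by
  rw [Matrix.det_apply]
  refine (Finset.le_sum_of_subadditive S (map_zero S).le (map_add_le_add S) _ _).trans ?_
  have : ∀ τ : Equiv.Perm ι, S (Equiv.Perm.sign τ • ∏ i, M (τ i) i) ≤ B ^ Fintype.card ι := by
    intro τ
    have h2 : S (Equiv.Perm.sign τ • ∏ i, M (τ i) i) = S (∏ i, M (τ i) i) := by
      rcases Int.units_eq_one_or (Equiv.Perm.sign τ) with h | h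
      · rw [h, one_smul]
      · rw [h, Units.neg_smul, one_smul, map_neg_eq_map]
    rw [h2]
    exact seminorm_prod_le S h1 _ _ B fun i _ => hM _ _
  refine (Finset.sum_le_sum fun τ _ => this τ).trans ?_
  rw [Finset.sum_const, Finset.card_univ, Fintype.card_perm, nsmul_eq_mul]

lemma l1_one_le (N : RingSeminorm R) (h1 : N 1 ≤ 1) : l1 N (1 : MvPolynomial σ R) ≤ 1 := by
  have : (1 : MvPolynomial σ R) = monomial 0 1 := rfl
  rw [this, l1_monomial]
  exact h1

/-- The coefficient of `X m ^ j` in `P`, as a polynomial in the other variables. -/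
noncomputable def slice (m : σ) (j : ℕ) (P : MvPolynomial σ R) : MvPolynomial σ R :=
  ∑ ν ∈ P.support with ν m = j, monomial (ν.erase m) (coeff ν P)

lemma sum_slice_mul_X_pow (m : σ) (P : MvPolynomial σ R) (s : ℕ) (hs : ∀ ν ∈ P.support, ν m ≤ s) :
    ∑ j : Fin (s + 1), slice m j P * X m ^ (j : ℕ) = P := by
  classical
  rw [Fin.sum_univ_eq_sum_range (fun j => slice m j P * X m ^ j)]
  conv_rhs => rw [P.as_sum]
  rw [← Finset.sum_fiberwise_of_maps_to (t := Finset.range (s + 1)) (g := fun ν => ν m)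
    (fun ν hν => Finset.mem_range.2 (Nat.lt_succ_of_le (hs ν hν)))]
  refine Finset.sum_congr rfl fun j _ => ?_
  rw [slice, Finset.sum_mul]
  refine Finset.sum_congr rfl fun ν hν => ?_
  rw [X_pow_eq_monomial, monomial_mul, mul_one, ← (Finset.mem_filter.1 hν).2,
    Finsupp.erase_add_single]

lemma exists_of_mem_support_slice {m : σ} {j : ℕ} {P : MvPolynomial σ R} {κ : σ →₀ ℕ}
    (h : κ ∈ (slice m j P).support) : ∃ ν ∈ P.support, κ = ν.erase m := by
  classical
  rw [mem_support_iff, slice, coeff_sum] at h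
  obtain ⟨ν, hν, hν'⟩ := Finset.exists_ne_zero_of_sum_ne_zero h
  rw [coeff_monomial] at hν'
  split_ifs at hν' with h0
  · exact ⟨ν, (Finset.mem_filter.1 hν).1, h0.symm⟩
  · simp at hν'

lemma l1_slice_le (N : RingSeminorm R) (m : σ) (j : ℕ) (P : MvPolynomial σ R) :
    l1 N (slice m j P) ≤ l1 N P := by
  rw [slice]
  refine (Finset.le_sum_of_subadditive (l1 N) (map_zero _).le (map_add_le_add _) _ _).trans ?_
  simp only [l1_monomial]
  rw [l1_apply]
  exact Finset.sum_le_sum_of_subset_of_nonneg (Finset.filter_subset _ _)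
    fun _ _ _ => apply_nonneg N _

end MvPolynomial

lemma Polynomial.exists_coeff_taylor_ne_zero_den_pow_le (v : Polynomial ℤ) (hv : v ≠ 0) (β : ℚ) :
    ∃ a, (Polynomial.taylor β (v.map (Int.castRingHom ℚ))).coeff a ≠ 0 ∧
      (β.den : ℤ) ^ a ≤ |v.leadingCoeff| := by
  open Polynomial in
  set f := v.map (Int.castRingHom ℚ) with hf
  have hf0 : f ≠ 0 := (Polynomial.map_ne_zero_iff (RingHom.injective_int _)).2 hv
  obtain ⟨g, hg, hgβ⟩ := exists_eq_pow_rootMultiplicity_mul_and_not_dvd f hf0 β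
  refine ⟨f.rootMultiplicity β, ?_, ?_⟩
  · have h1 : taylor β f = taylor β g * X ^ f.rootMultiplicity β := by
      have h3 := congrArg (taylor β) hg
      rw [taylor_mul, taylor_pow] at h3
      have : taylor β (X - C β) = X := by simp
      rw [h3, this, mul_comm]
    have h2 := coeff_mul_X_pow (taylor β g) (f.rootMultiplicity β) 0
    rw [zero_add] at h2
    rw [h1, h2, taylor_coeff_zero]
    intro h0
    exact hgβ (dvd_iff_isRoot.2 h0)
  · set a := f.rootMultiplicity β
    set l : Polynomial ℤ := C (β.den : ℤ) * X - C β.num with hl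
    have hden : (β.den : ℚ) ≠ 0 := by exact_mod_cast β.den_ne_zero
    have hlc : l.coeff 1 = β.den := by
      rw [hl, coeff_sub, coeff_C_mul, coeff_X_one, coeff_C_of_ne_zero one_ne_zero]
      simp
    have hl0 : l.coeff 0 = - β.num := by simp [hl]
    have hlprim : l.IsPrimitive := by
      intro r hr
      rw [C_dvd_iff_dvd_coeff] at hr
      have h1 := hr 1
      have h0 := hr 0
      rw [hlc] at h1
      rw [hl0, dvd_neg] at h0
      have hco : IsCoprime β.num (β.den : ℤ) := Rat.isCoprime_num_den β
      exact hco.isUnit_of_dvd' h0 h1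
    have hlmap : l.map (Int.castRingHom ℚ) = C (β.den : ℚ) * (X - C β) := by
      have : (C (β.num : ℚ) : Polynomial ℚ) = C (β.den : ℚ) * C β := by
        rw [← C_mul, mul_comm, Rat.mul_den_eq_num]
      rw [hl]
      simp only [Polynomial.map_sub, Polynomial.map_mul, map_X, eq_intCast]
      rw [mul_sub, ← this]
      simp
    have hdvd : l ^ a ∣ v.primPart := by
      have hpp : ∀ n : ℕ, (l ^ n).IsPrimitive := by
        intro n
        induction n with
        | zero => simp
        | succ n ih => rw [pow_succ]; exact ih.mul hlprim
      rw [IsPrimitive.Int.dvd_iff_map_cast_dvd_map_cast _ _ (hpp a)]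
      have hc : (v.content : ℚ) ≠ 0 := by
        exact_mod_cast (mt content_eq_zero_iff.1 hv)
      have hfv : f = C (v.content : ℚ) * v.primPart.map (Int.castRingHom ℚ) := by
        conv_lhs => rw [hf, v.eq_C_content_mul_primPart]
        simp
      have h1 : (X - C β) ^ a ∣ v.primPart.map (Int.castRingHom ℚ) := by
        have : (X - C β) ^ a ∣ C (v.content : ℚ) * v.primPart.map (Int.castRingHom ℚ) :=
          hfv ▸ hg ▸ Dvd.intro g rfl
        exact (IsUnit.dvd_mul_left (isUnit_C.2 (isUnit_iff_ne_zero.2 hc))).1 this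
      rw [Polynomial.map_pow, hlmap, mul_pow]
      refine (IsUnit.mul_left_dvd ?_).2 h1
      exact (isUnit_C.2 (isUnit_iff_ne_zero.2 hden)).pow a
    have hlead : (β.den : ℤ) ^ a ∣ v.leadingCoeff := by
      have hll : l.leadingCoeff = β.den := by
        have : l = C (β.den : ℤ) * X + C (- β.num) := by rw [hl, C_neg, sub_eq_add_neg]
        rw [this]
        exact leadingCoeff_linear (by exact_mod_cast β.den_ne_zero)
      obtain ⟨u, hu⟩ := hdvd
      rw [v.eq_C_content_mul_primPart, hu, leadingCoeff_mul, leadingCoeff_mul, leadingCoeff_pow,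
        hll]
      exact ⟨(C v.content).leadingCoeff * u.leadingCoeff, by ring⟩
    rw [← dvd_abs] at hlead
    exact Int.le_of_dvd (abs_pos.2 (leadingCoeff_ne_zero.2 hv)) hlead

lemma mul_sq_div_eight_le_sum_max {k s : ℕ} (hk : k ≤ s + 1) (hs : 0 < s) {e : ℝ}
    (he : 0 < e) (he1 : e ≤ 1) :
    (k : ℝ) * (e ^ 2 / 8) ≤ ∑ j ∈ Finset.range k, max 0 (e - (j : ℝ) / s) := by
  have hs' : (0 : ℝ) < s := by exact_mod_cast hs
  have hs1 : (1 : ℝ) ≤ s := by exact_mod_cast hs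
  set t := ⌊e * s / 2⌋₊ + 1 with ht
  have ht1 : e * s / 2 < t := by exact_mod_cast Nat.lt_floor_add_one (e * s / 2)
  have hterm : ∀ j ∈ Finset.range (min k t), e / 2 ≤ max 0 (e - (j : ℝ) / s) := by
    intro j hj
    rw [Finset.mem_range, lt_min_iff] at hj
    have h1 : j ≤ ⌊e * s / 2⌋₊ := by omega
    have h2 : (j : ℝ) ≤ e * s / 2 :=
      (Nat.cast_le.2 h1).trans (Nat.floor_le (by positivity))
    have h3 : (j : ℝ) / s ≤ e / 2 := by
      rw [div_le_iff₀ hs']; linarith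
    exact le_max_of_le_right (by linarith)
  have hsub : Finset.range (min k t) ⊆ Finset.range k :=
    Finset.range_mono (min_le_left _ _)
  refine le_trans ?_ (Finset.sum_le_sum_of_subset_of_nonneg hsub fun _ _ _ => le_max_left _ _)
  refine le_trans ?_ (Finset.card_nsmul_le_sum _ _ _ hterm)
  rw [Finset.card_range, nsmul_eq_mul]
  have hk0 : (0 : ℝ) ≤ k := Nat.cast_nonneg k
  have hkr : (k : ℝ) ≤ s + 1 := by exact_mod_cast hk
  have hmin : (k : ℝ) * (e / 4) ≤ (min k t : ℕ) := by
    rcases min_choice k t with h | h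
    · rw [h]; nlinarith
    · rw [h]; nlinarith
  nlinarith

namespace MvPolynomial

lemma exists_separated_decomposition {σ : Type*} (m : σ) (s : ℕ) (P : MvPolynomial σ ℤ) (hP : P ≠ 0)
    (hs : ∀ ν ∈ P.support, ν m ≤ s) :
    ∃ (k : ℕ) (a : Fin k → ℕ) (ψ : Fin k → MvPolynomial σ ℚ), 0 < k ∧ k ≤ s + 1 ∧
      LinearIndependent ℚ (fun i => map (Int.castRingHom ℚ) (slice m (a i) P)) ∧
      LinearIndependent ℚ ψ ∧ (∀ i, ∀ ν ∈ (ψ i).support, ∀ h, h ≠ m → ν h = 0) ∧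
      map (Int.castRingHom ℚ) P =
        ∑ i, map (Int.castRingHom ℚ) (slice m (a i) P) * ψ i := by
  classical
  set f : Fin (s + 1) → MvPolynomial σ ℚ :=
    fun j => map (Int.castRingHom ℚ) (slice m (j : ℕ) P) with hf
  obtain ⟨κ, a, ha, hspan, hli⟩ := exists_linearIndependent' ℚ f
  have : Finite κ := Finite.of_injective a ha
  have := Fintype.ofFinite κ
  have hdec := congrArg (map (Int.castRingHom ℚ)) (sum_slice_mul_X_pow m P s hs)
  rw [map_sum] at hdec
  let e := (Fintype.equivFin κ).symm
  have hcard : Fintype.card κ ≤ s + 1 := by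
    simpa using Fintype.card_le_of_injective a ha
  have hli' : LinearIndependent ℚ (fun i => f (a (e i))) := hli.comp e e.injective
  have hmem : ∀ j, ∃ c : Fin (Fintype.card κ) → ℚ, ∑ i, c i • f (a (e i)) = f j := by
    intro j
    have h1 : f j ∈ Submodule.span ℚ (Set.range (fun i => f (a (e i)))) := by
      have h2 : Set.range (fun i => f (a (e i))) = Set.range (f ∘ a) := by
        rw [← e.surjective.range_comp (f ∘ a)]
        rfl
      rw [h2, hspan]
      exact Submodule.subset_span ⟨j, rfl⟩
    exact (Submodule.mem_span_range_iff_exists_fun ℚ).1 h1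
  choose c hc using hmem
  have hcδ : ∀ i i', c (a (e i')) i = if i = i' then 1 else 0 := by
    intro i i'
    have h1 : ∑ l, (c (a (e i')) l - if l = i' then 1 else 0) • f (a (e l)) = 0 := by
      simp only [sub_smul, Finset.sum_sub_distrib, hc, ite_smul, one_smul, zero_smul]
      simp
    exact sub_eq_zero.1 (Fintype.linearIndependent_iff.1 hli' _ h1 i)
  set ψ : Fin (Fintype.card κ) → MvPolynomial σ ℚ :=
    fun i => ∑ j : Fin (s + 1), monomial (Finsupp.single m (j : ℕ)) (c j i) with hψ
  have hψc : ∀ i (j : Fin (s + 1)), coeff (Finsupp.single m (j : ℕ)) (ψ i) = c j i := by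
    intro i j
    rw [hψ, coeff_sum]
    simp only [coeff_monomial]
    rw [Finset.sum_eq_single j]
    · simp
    · intro j' _ hj'
      rw [if_neg]
      intro h0
      exact hj' (Fin.ext (Finsupp.single_injective m h0))
    · simp
  refine ⟨Fintype.card κ, fun i => (a (e i) : ℕ), ψ, ?_, hcard, hli', ?_, ?_, ?_⟩
  · rw [Nat.pos_iff_ne_zero]
    intro h0
    have : ∀ j, f j = 0 := by
      intro j
      rw [← hc j]
      have : IsEmpty (Fin (Fintype.card κ)) := by rw [h0]; infer_instance
      simp
    apply hP
    apply map_injective (Int.castRingHom ℚ) (RingHom.injective_int _)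
    rw [← hdec, map_zero]
    refine Finset.sum_eq_zero fun j _ => ?_
    rw [map_mul]
    have h1 : map (Int.castRingHom ℚ) (slice m (j : ℕ) P) = 0 := this j
    rw [h1, zero_mul]
  · rw [Fintype.linearIndependent_iff]
    intro g hg i
    have := congrArg (coeff (Finsupp.single m (a (e i) : ℕ))) hg
    rw [coeff_sum, coeff_zero] at this
    simp only [coeff_smul, hψc, hcδ] at this
    simpa using this
  · intro i ν hν h hh
    rw [hψ, mem_support_iff, coeff_sum] at hν
    obtain ⟨j, _, hj⟩ := Finset.exists_ne_zero_of_sum_ne_zero hν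
    rw [coeff_monomial] at hj
    split_ifs at hj with h0
    · rw [← h0, Finsupp.single_eq_of_ne hh]
    · simp at hj
  · rw [← hdec]
    have h1 : ∀ j : Fin (s + 1), map (Int.castRingHom ℚ) (slice m (j : ℕ) P * X m ^ (j : ℕ)) =
        ∑ i, c j i • f (a (e i)) * monomial (Finsupp.single m (j : ℕ)) 1 := by
      intro j
      rw [map_mul, ← Finset.sum_mul, hc, map_pow, map_X, X_pow_eq_monomial]
    simp only [h1]
    rw [Finset.sum_comm]
    refine Finset.sum_congr rfl fun i _ => ?_
    rw [hψ, Finset.mul_sum]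
    refine Finset.sum_congr rfl fun j _ => ?_
    rw [smul_mul_assoc, ← mul_smul_comm, smul_monomial, smul_eq_mul, mul_one]

end MvPolynomial

namespace MvPolynomial

section OneVariable

variable {σ R : Type*} [CommRing R]

lemma coeff_single_aeval_X (m : σ) (p : Polynomial R) (a : ℕ) :
    coeff (Finsupp.single m a) (Polynomial.aeval (X m : MvPolynomial σ R) p) = p.coeff a := by
  classical
  rw [Polynomial.aeval_eq_sum_range, coeff_sum]
  simp only [coeff_smul, X_pow_eq_monomial, coeff_monomial]
  by_cases ha : a ≤ p.natDegree
  · rw [Finset.sum_eq_single_of_mem a (Finset.mem_range.2 (by omega))]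
    · simp
    · intro b _ hb
      rw [if_neg, smul_zero]
      intro h
      exact hb (Finsupp.single_injective m h)
  · rw [Polynomial.coeff_eq_zero_of_natDegree_lt (by omega)]
    refine Finset.sum_eq_zero fun b hb => ?_
    rw [if_neg, smul_zero]
    intro h
    have := Finsupp.single_injective m h
    rw [Finset.mem_range] at hb
    omega

lemma exists_aeval_X_eq {m : σ} {V : MvPolynomial σ R}
    (hV : ∀ ν ∈ V.support, ∀ h, h ≠ m → ν h = 0) :
    ∃ p : Polynomial R, Polynomial.aeval (X m : MvPolynomial σ R) p = V := by
  refine ⟨∑ ν ∈ V.support, Polynomial.monomial (ν m) (coeff ν V), ?_⟩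
  rw [map_sum]
  conv_rhs => rw [V.as_sum]
  refine Finset.sum_congr rfl fun ν hν => ?_
  have h1 : ν = Finsupp.single m (ν m) := by
    ext h
    by_cases hh : h = m
    · rw [hh, Finsupp.single_eq_same]
    · rw [hV ν hν h hh, Finsupp.single_eq_of_ne hh]
  rw [Polynomial.aeval_monomial, X_pow_eq_monomial, algebraMap_eq, C_mul_monomial, mul_one, ← h1]

lemma shift_aeval_X (b : σ → R) (m : σ) (p : Polynomial R) :
    shift b (Polynomial.aeval (X m : MvPolynomial σ R) p) =
      Polynomial.aeval (X m : MvPolynomial σ R) (Polynomial.taylor (b m) p) := by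
  rw [← Polynomial.aeval_algHom_apply, shift_X, Polynomial.taylor_apply, Polynomial.aeval_comp]
  simp

lemma exists_coeff_single_ne_zero_den_pow_le {m : σ} {U W : MvPolynomial σ ℤ}
    {V : MvPolynomial σ ℚ} (hU : U ≠ 0) (hV0 : V ≠ 0) (hUm : ∀ ν ∈ U.support, ν m = 0)
    (hV : ∀ ν ∈ V.support, ∀ h, h ≠ m → ν h = 0)
    (hW : map (Int.castRingHom ℚ) W = map (Int.castRingHom ℚ) U * V) (β : σ → ℚ) :
    ∃ a, coeff (Finsupp.single m a) (shift β V) ≠ 0 ∧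
      ((β m).den : ℝ) ^ a ≤ l1 (normRingSeminorm ℤ) W := by
  obtain ⟨p, rfl⟩ := exists_aeval_X_eq hV
  have hp : p ≠ 0 := by
    rintro rfl
    exact hV0 (map_zero _)
  obtain ⟨κ, hκ⟩ := ne_zero_iff.1 hU
  have hκm := hUm κ (mem_support_iff.2 hκ)
  have hUm' : ∀ ν ∈ (map (Int.castRingHom ℚ) U).support, ν m = 0 := fun ν hν =>
    hUm ν (support_map_subset _ _ hν)
  set v : Polynomial ℤ := ∑ j ∈ Finset.range (p.natDegree + 1),
    Polynomial.monomial j (coeff (κ + Finsupp.single m j) W) with hv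
  have hcv : ∀ j, v.coeff j ≠ 0 → v.coeff j = coeff (κ + Finsupp.single m j) W := by
    intro j
    rw [hv, Polynomial.finsetSum_coeff]
    simp only [Polynomial.coeff_monomial]
    rw [Finset.sum_ite_eq' ]
    split_ifs <;> simp
  have hcp : ∀ j, ((coeff (κ + Finsupp.single m j) W : ℤ) : ℚ) = ((coeff κ U : ℤ) : ℚ) * p.coeff j := by
    intro j
    have h1 := congrArg (coeff (κ + Finsupp.single m j)) hW
    rw [coeff_mul_of_separated hUm' hV hκm, coeff_single_aeval_X, coeff_map, coeff_map] at h1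
    exact h1
  have hvp : v.map (Int.castRingHom ℚ) = Polynomial.C ((coeff κ U : ℤ) : ℚ) * p := by
    ext j
    rw [Polynomial.coeff_map, Polynomial.coeff_C_mul, ← hcp, hv, Polynomial.finsetSum_coeff]
    simp only [Polynomial.coeff_monomial]
    rw [Finset.sum_ite_eq']
    split_ifs with h
    · simp
    · rw [hcp, Polynomial.coeff_eq_zero_of_natDegree_lt]
      · simp
      · simpa using h
  have hu : ((coeff κ U : ℤ) : ℚ) ≠ 0 := by exact_mod_cast hκ
  have hv0 : v ≠ 0 := by
    intro h0
    rw [h0, Polynomial.map_zero] at hvp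
    exact mul_ne_zero (Polynomial.C_ne_zero.2 hu) hp hvp.symm
  obtain ⟨a, ha, hle⟩ := Polynomial.exists_coeff_taylor_ne_zero_den_pow_le v hv0 (β m)
  refine ⟨a, ?_, ?_⟩
  · rw [shift_aeval_X, coeff_single_aeval_X]
    rw [hvp, Polynomial.taylor_mul, Polynomial.taylor_C, Polynomial.coeff_C_mul] at ha
    exact right_ne_zero_of_mul ha
  · have h1 : ((β m).den : ℝ) ^ a ≤ |(v.leadingCoeff : ℝ)| := by exact_mod_cast hle
    refine h1.trans ?_
    rw [Polynomial.leadingCoeff, hcv _ (by exact Polynomial.leadingCoeff_ne_zero.2 hv0)]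
    exact le_l1 (normRingSeminorm ℤ) W _

end OneVariable

lemma exists_det_eq_mul {σ : Type*} (m : σ) (s : ℕ) (P : MvPolynomial σ ℤ) (hP : P ≠ 0)
    (hs : ∀ ν ∈ P.support, ν m ≤ s) :
    ∃ (k : ℕ) (a t : Fin k → ℕ) (μ : Fin k → σ →₀ ℕ) (V : MvPolynomial σ ℚ),
      0 < k ∧ k ≤ s + 1 ∧ (∀ i, t i < k) ∧ Function.Injective t ∧
      (∀ i, (μ i).degree + 1 ≤ k) ∧ (∀ i, μ i m = 0) ∧ V ≠ 0 ∧ (∀ ν ∈ V.support, ∀ h, h ≠ m → ν h = 0) ∧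
      (Matrix.of fun i j => hasse (μ i) (slice m (a j) P)).det ≠ 0 ∧
      map (Int.castRingHom ℚ)
          (Matrix.of fun i l => hasse (μ i + Finsupp.single m (t l)) P).det =
        map (Int.castRingHom ℚ) (Matrix.of fun i j => hasse (μ i) (slice m (a j) P)).det * V := by
  classical
  obtain ⟨k, a, ψ, hk0, hk, hφ, hψ, hψm, hdec⟩ := exists_separated_decomposition m s P hP hs
  obtain ⟨μ, hμ, hdetμ⟩ := exists_det_hasse_ne_zero hφ
  obtain ⟨τ, hτ, hdetτ⟩ := exists_det_hasse_ne_zero hψ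
  rw [Fintype.card_fin] at hμ hτ
  have hslice : ∀ j, ∀ ν ∈ (map (Int.castRingHom ℚ) (slice m (a j) P)).support, ν m = 0 := by
    intro j ν hν
    obtain ⟨ν', _, rfl⟩ := exists_of_mem_support_slice (support_map_subset _ _ hν)
    exact Finsupp.erase_same
  have hμm : ∀ i, μ i m = 0 := by
    intro i
    by_contra hne
    refine hdetμ (Matrix.det_eq_zero_of_row_eq_zero i fun j => ?_)
    by_contra h
    obtain ⟨κ, hκ⟩ := exists_add_mem_support_of_hasse_ne_zero h
    have := hslice j _ hκ
    rw [Finsupp.add_apply] at this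
    omega
  have hτm : ∀ i, τ i = Finsupp.single m (τ i m) := by
    intro i
    ext h
    by_cases hh : h = m
    · rw [hh, Finsupp.single_eq_same]
    rw [Finsupp.single_eq_of_ne hh]
    by_contra hne
    refine hdetτ (Matrix.det_eq_zero_of_row_eq_zero i fun j => ?_)
    by_contra h0
    obtain ⟨κ, hκ⟩ := exists_add_mem_support_of_hasse_ne_zero h0
    have := hψm j _ hκ h hh
    rw [Finsupp.add_apply] at this
    omega
  refine ⟨k, a, fun i => τ i m, μ, (Matrix.of fun i j => hasse (τ i) (ψ j)).det, hk0, hk, ?_, ?_,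
    hμ, hμm, hdetτ, ?_, ?_, ?_⟩
  · intro i
    have h1 := hτ i
    have h2 : τ i m ≤ (τ i).degree := Finsupp.le_degree m (τ i)
    exact (Nat.lt_of_le_of_lt h2 h1)
  · intro i i' hii'
    by_contra hne
    refine hdetτ (Matrix.det_zero_of_row_eq hne ?_)
    funext j
    have : τ i = τ i' := by
      rw [hτm i, hτm i']
      exact congrArg _ hii'
    simp [this]
  · intro ν hν h hh
    have hw : WeightGE (-(Nat.castAddMonoidHom ℝ).comp (Finsupp.applyAddHom h)) (∑ _j : Fin k, (0 : ℝ))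
        (Matrix.of fun i j => hasse (τ i) (ψ j)).det := by
      refine WeightGE.det _ _ fun i j κ hκ => ?_
      have := hψm j _ (mem_support_iff.2 (coeff_hasse_ne_zero (mem_support_iff.1 hκ))) h hh
      rw [Finsupp.add_apply] at this
      have h0 : κ h = 0 := by omega
      simp [h0]
    have := hw ν hν
    simp at this
    exact this
  · intro h0
    apply hdetμ
    have := congrArg (map (Int.castRingHom ℚ)) h0
    rw [map_zero, RingHom.map_det] at this
    rw [← this]
    congr 1
    ext1 i j
    simp [hasse_map]
  · rw [RingHom.map_det, RingHom.map_det, ← Matrix.det_transpose (Matrix.of fun i j => hasse (τ i) (ψ j)),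
      ← Matrix.det_mul]
    congr 1
    ext1 i l
    rw [Matrix.mul_apply]
    simp only [RingHom.mapMatrix_apply, Matrix.map_apply, Matrix.of_apply, Matrix.transpose_apply]
    rw [← hasse_map, hdec, hasse_sum]
    refine Finset.sum_congr rfl fun j _ => ?_
    rw [hasse_mul_of_separated (hslice j) (hψm j) (hμm i), ← hτm l, hasse_map]

end MvPolynomial

namespace MvPolynomial

/-- The polynomial involves only the first `m` variables, with partial degrees at most `r`. -/
def InBox {R : Type*} [CommRing R] (r : ℕ → ℕ) (m : ℕ) (P : MvPolynomial ℕ R) : Prop :=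
  ∀ ν ∈ P.support, (∀ h < m, ν h ≤ r h) ∧ ∀ h, m ≤ h → ν h = 0

/-- The weight `∑ ν h / r h` measuring the index of a polynomial. -/
noncomputable def indexWeight (r : ℕ → ℕ) (m : ℕ) : (ℕ →₀ ℕ) →+ ℝ where
  toFun ν := ∑ h ∈ Finset.range m, (ν h : ℝ) / r h
  map_zero' := by simp
  map_add' x y := by simp [add_div, Finset.sum_add_distrib]

lemma indexWeight_apply (r : ℕ → ℕ) (m : ℕ) (ν : ℕ →₀ ℕ) :
    indexWeight r m ν = ∑ h ∈ Finset.range m, (ν h : ℝ) / r h := rfl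

lemma indexWeight_nonneg (r : ℕ → ℕ) (m : ℕ) (ν : ℕ →₀ ℕ) : 0 ≤ indexWeight r m ν := by
  rw [indexWeight_apply]
  exact Finset.sum_nonneg fun _ _ => by positivity

variable {R : Type*} [CommRing R] {r : ℕ → ℕ} {m : ℕ}

lemma InBox.hasse {P : MvPolynomial ℕ R} (h : InBox r m P) (μ : ℕ →₀ ℕ) :
    InBox r m (hasse μ P) := by
  intro ν hν
  have h1 := h _ (mem_support_iff.2 (coeff_hasse_ne_zero (mem_support_iff.1 hν)))
  simp only [Finsupp.add_apply] at h1
  exact ⟨fun i hi => by have := h1.1 i hi; omega, fun i hi => by have := h1.2 i hi; omega⟩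

lemma InBox.map {S : Type*} [CommRing S] {P : MvPolynomial ℕ R} (h : InBox r m P) (f : R →+* S) :
    InBox r m (map f P) := fun ν hν => h ν (support_map_subset _ _ hν)

lemma InBox.shift {P : MvPolynomial ℕ R} (h : InBox r m P) (b : ℕ → R) :
    InBox r m (shift b P) := by
  intro ν hν
  obtain ⟨κ, hκ⟩ := exists_add_mem_support_of_coeff_shift_ne_zero (mem_support_iff.1 hν)
  have h1 := h _ hκ
  simp only [Finsupp.add_apply] at h1
  exact ⟨fun i hi => by have := h1.1 i hi; omega, fun i hi => by have := h1.2 i hi; omega⟩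

lemma InBox.slice {P : MvPolynomial ℕ R} (h : InBox r (m + 1) P) (j : ℕ) :
    InBox r m (slice m j P) := by
  intro ν hν
  obtain ⟨κ, hκ, rfl⟩ := exists_of_mem_support_slice hν
  have h1 := h κ hκ
  refine ⟨fun i hi => ?_, fun i hi => ?_⟩
  · rw [Finsupp.erase_ne hi.ne]
    exact h1.1 i (by omega)
  · rcases eq_or_ne i m with rfl | hne
    · exact Finsupp.erase_same
    · rw [Finsupp.erase_ne hne]
      exact h1.2 i (by omega)

lemma InBox.det {ι : Type*} [Fintype ι] [DecidableEq ι] {M : Matrix ι ι (MvPolynomial ℕ R)}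
    (h : ∀ i j, InBox r m (M i j)) : InBox (fun h => Fintype.card ι * r h) m M.det := by
  have key : ∀ i (n : ℕ), (∀ a b, ∀ ν ∈ (M a b).support, ν i ≤ n) →
      ∀ ν ∈ M.det.support, ν i ≤ Fintype.card ι * n := by
    intro i n hn ν hν
    have hw : WeightGE (-(Nat.castAddMonoidHom ℝ).comp (Finsupp.applyAddHom i))
        (∑ _j : ι, (-n : ℝ)) M.det := by
      refine WeightGE.det _ _ fun a b κ hκ => ?_
      simpa using hn a b κ hκ
    have := hw ν hν
    simp only [Finset.sum_const, Finset.card_univ, nsmul_eq_mul, mul_neg, AddMonoidHom.neg_apply,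
      AddMonoidHom.comp_apply, Finsupp.applyAddHom_apply, Nat.coe_castAddMonoidHom,
      neg_le_neg_iff] at this
    exact_mod_cast this
  intro ν hν
  refine ⟨fun i hi => key i (r i) (fun a b κ hκ => (h a b κ hκ).1 i hi) ν hν, fun i hi => ?_⟩
  have := key i 0 (fun a b κ hκ => ((h a b κ hκ).2 i hi).le) ν hν
  omega

lemma InBox.degree_le {P : MvPolynomial ℕ R} (h : InBox r m P) :
    ∀ ν ∈ P.support, ν.degree ≤ ∑ i ∈ Finset.range m, r i := by
  intro ν hν
  have h1 := h ν hν
  have hsub : ν.support ⊆ Finset.range m := by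
    intro i hi
    by_contra hn
    rw [Finset.mem_range, not_lt] at hn
    exact (Finsupp.mem_support_iff.1 hi) (h1.2 i hn)
  rw [Finsupp.degree_apply]
  refine (Finset.sum_le_sum_of_subset hsub).trans (Finset.sum_le_sum fun i hi => ?_)
  exact h1.1 i (Finset.mem_range.1 hi)

lemma l1_det_hasse_le {k n : ℕ} {s L : ℝ} (μ : Fin k → Fin k → ℕ →₀ ℕ)
    (P : Fin k → Fin k → MvPolynomial ℕ ℤ) (hn : ∀ i j, ∀ ν ∈ (P i j).support, ν.degree ≤ n)
    (hk : (k : ℝ) ≤ s + 1) (hP : ∀ i j, l1 (normRingSeminorm ℤ) (P i j) ≤ Real.exp L) :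
    l1 (normRingSeminorm ℤ) (Matrix.of fun i j => hasse (μ i j) (P i j)).det ≤
      Real.exp (k * (s + n + L)) := by
  have h1 : normRingSeminorm ℤ 1 ≤ 1 := by
    change ‖(1 : ℤ)‖ ≤ 1
    simp
  have hexp1 : ∀ x : ℝ, x + 1 ≤ Real.exp x := Real.add_one_le_exp
  have h2 : (2 : ℝ) ^ n ≤ Real.exp n := by
    have : (2 : ℝ) ≤ Real.exp 1 := by have := hexp1 1; linarith
    calc (2 : ℝ) ^ n ≤ Real.exp 1 ^ n := by gcongr
      _ = Real.exp n := by rw [← Real.exp_nat_mul, mul_one]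
  refine (seminorm_det_le _ (l1_one_le _ h1) _ (Real.exp (n + L)) ?_).trans ?_
  · intro i j
    rw [Matrix.of_apply]
    refine (l1_hasse_le _ h1 _ _ n (hn i j)).trans ?_
    rw [Real.exp_add]
    have := hP i j
    gcongr
  · rw [Fintype.card_fin, ← Real.exp_nat_mul]
    have h3 : ((k.factorial : ℕ) : ℝ) ≤ Real.exp (k * s) := by
      have h4 : ((k.factorial : ℕ) : ℝ) ≤ (k : ℝ) ^ k := by exact_mod_cast Nat.factorial_le_pow k
      refine h4.trans ?_
      rw [Real.exp_nat_mul]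
      have := hexp1 s
      gcongr
      linarith
    calc ((k.factorial : ℕ) : ℝ) * Real.exp (k * (n + L))
        ≤ Real.exp (k * s) * Real.exp (k * (n + L)) := by gcongr
      _ = Real.exp (k * (s + n + L)) := by rw [← Real.exp_add]; ring_nf

end MvPolynomial

namespace MvPolynomial

lemma weightGE_shift_hasse {r : ℕ → ℕ} {m : ℕ} {β : ℕ → ℚ} {P : MvPolynomial ℕ ℤ} {ε : ℝ}
    (hP : WeightGE (indexWeight r m) ε (shift β (map (Int.castRingHom ℚ) P))) (μ : ℕ →₀ ℕ) :
    WeightGE (indexWeight r m) (max 0 (ε - indexWeight r m μ))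
      (shift β (map (Int.castRingHom ℚ) (hasse μ P))) := by
  intro ν hν
  refine max_le (indexWeight_nonneg r m ν) ?_
  rw [← hasse_map, ← hasse_shift] at hν
  have := hP _ (mem_support_iff.2 (coeff_hasse_ne_zero (mem_support_iff.1 hν)))
  rw [map_add] at this
  linarith

/-- The conclusion of Roth's lemma in `m` variables with parameters `ε` and `ω`. -/
def RothIndexBound (m : ℕ) (ε ω : ℝ) : Prop :=
  ∀ (r : ℕ → ℕ) (β : ℕ → ℚ) (Λ : ℝ) (P : MvPolynomial ℕ ℤ), 0 < Λ → (∀ h < m, 0 < r h) →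
    (∀ h h', h < h' → h' < m → (r h' : ℝ) ≤ ω * r h) →
    (∀ h < m, Λ ≤ r h * Real.log (β h).den) → (∀ h < m, (r h : ℝ) ≤ ω * Λ) →
    P ≠ 0 → InBox r m P → l1 (normRingSeminorm ℤ) P ≤ Real.exp (ω * Λ) →
    ∃ ν, coeff ν (shift β (map (Int.castRingHom ℚ) P)) ≠ 0 ∧ indexWeight r m ν ≤ ε

lemma RothIndexBound.mono {m : ℕ} {ε ε' ω : ℝ} (h : RothIndexBound m ε ω) (hε : ε ≤ ε') :
    RothIndexBound m ε' ω := by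
  intro r β Λ P h1 h2 h3 h4 h5 h6 h7 h8
  obtain ⟨ν, hν, hle⟩ := h r β Λ P h1 h2 h3 h4 h5 h6 h7 h8
  exact ⟨ν, hν, hle.trans hε⟩

lemma RothIndexBound.zero {ε : ℝ} (hε : 0 < ε) : RothIndexBound 0 ε 1 := by
  intro r β Λ P _ _ _ _ _ hP _ _
  have h1 : shift β (map (Int.castRingHom ℚ) P) ≠ 0 := by
    intro h0
    rw [← map_zero (shift β)] at h0
    have h2 := shift_injective β h0
    rw [← map_zero (map (Int.castRingHom ℚ))] at h2
    exact hP (map_injective _ (RingHom.injective_int _) h2)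
  obtain ⟨ν, hν⟩ := ne_zero_iff.1 h1
  exact ⟨ν, hν, by simp [indexWeight_apply, hε.le]⟩

lemma indexWeight_le_of_degree_le {r : ℕ → ℕ} {m s : ℕ} {ω : ℝ} (hs : 0 < s) (hω : 0 ≤ ω)
    (hr : ∀ h < m, 0 < r h) (hrs : ∀ h < m, (s : ℝ) ≤ ω * r h) {μ : ℕ →₀ ℕ} (hμ : μ.degree ≤ s) :
    indexWeight r m μ ≤ ω := by
  have hs' : (0 : ℝ) < s := by exact_mod_cast hs
  have h1 : ∑ h ∈ Finset.range m, μ h ≤ μ.degree := by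
    rw [Finsupp.degree_apply, ← Finset.sum_filter_ne_zero]
    refine Finset.sum_le_sum_of_subset fun i hi => ?_
    exact Finsupp.mem_support_iff.2 (Finset.mem_filter.1 hi).2
  rw [indexWeight_apply]
  calc ∑ h ∈ Finset.range m, (μ h : ℝ) / r h ≤ ∑ h ∈ Finset.range m, (μ h : ℝ) * (ω / s) := by
        refine Finset.sum_le_sum fun h hh => ?_
        have h2 := hrs h (Finset.mem_range.1 hh)
        have h3 : (0 : ℝ) < r h := by exact_mod_cast hr h (Finset.mem_range.1 hh)
        rw [div_eq_mul_inv]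
        refine mul_le_mul_of_nonneg_left ?_ (Nat.cast_nonneg _)
        rw [inv_eq_one_div, div_le_div_iff₀ h3 hs']
        linarith
    _ = (∑ h ∈ Finset.range m, μ h : ℕ) * (ω / s) := by push_cast; rw [Finset.sum_mul]
    _ ≤ s * (ω / s) := by
        refine mul_le_mul_of_nonneg_right ?_ (by positivity)
        exact_mod_cast h1.trans hμ
    _ = ω := by field_simp

lemma RothIndexBound.succ {m : ℕ} {ε ω' ω : ℝ} (hε : 0 < ε) (hε1 : ε ≤ 1)
    (ih : RothIndexBound m (ε ^ 2 / 128) ω') (hω : 0 < ω) (hω1 : ω ≤ ε / 2)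
    (hω2 : (m + 3) * ω ≤ ω') (hω3 : (m + 3) * ω ≤ ε ^ 2 / 128) : RothIndexBound (m + 1) ε ω := by
  classical
  intro r β Λ P hΛ hr hrr hΛr hrΛ hP hbox hl1
  by_contra! hcon
  have hm : m < m + 1 := Nat.lt_succ_self m
  set s := r m with hs
  have hs0 : 0 < s := hr m hm
  have hs0' : (0 : ℝ) < s := by exact_mod_cast hs0
  have hm0 : (0 : ℝ) ≤ m := Nat.cast_nonneg m
  have hωω' : ω ≤ ω' := by nlinarith
  obtain ⟨k, a, t, μ, V, hk0, hk, htk, htinj, hμ, hμm, hV0, hV, hU0, hWU⟩ :=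
    exists_det_eq_mul m s P hP fun ν hν => (hbox ν hν).1 m hm
  set U := (Matrix.of fun i j => hasse (μ i) (slice m (a j) P)).det with hU
  set W := (Matrix.of fun i l => hasse (μ i + Finsupp.single m (t l)) P).det with hW
  have hk0' : (0 : ℝ) < k := by exact_mod_cast hk0
  have hks : (k : ℝ) ≤ s + 1 := by exact_mod_cast hk
  set n := ∑ i ∈ Finset.range (m + 1), r i with hn
  have hnΛ : (n : ℝ) ≤ (m + 1) * (ω * Λ) := by
    rw [hn, Nat.cast_sum]
    refine (Finset.sum_le_card_nsmul _ _ (ω * Λ) fun i hi => hrΛ i (Finset.mem_range.1 hi)).trans ?_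
    rw [Finset.card_range, nsmul_eq_mul]
    push_cast
    exact le_rfl
  have hsize : (k : ℝ) * (s + n + ω * Λ) ≤ k * ((m + 3) * ω * Λ) := by
    have := hrΛ m hm
    refine mul_le_mul_of_nonneg_left ?_ hk0'.le
    linarith
  have hUbox : InBox (fun h => k * r h) m U := by
    have := InBox.det (M := Matrix.of fun i j => hasse (μ i) (slice m (a j) P))
      fun i j => (hbox.slice (a j)).hasse (μ i)
    rwa [Fintype.card_fin] at this
  have hUl1 : l1 (normRingSeminorm ℤ) U ≤ Real.exp (k * ((m + 3) * ω * Λ)) := by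
    refine (l1_det_hasse_le (n := n) (fun i _ => μ i) (fun _ j => slice m (a j) P) ?_ hks
      (fun _ j => (l1_slice_le _ _ _ _).trans hl1)).trans (Real.exp_le_exp.2 hsize)
    intro _ j ν hν
    refine ((hbox.slice (a j)).degree_le ν hν).trans ?_
    rw [hn, Finset.sum_range_succ]
    exact Nat.le_add_right _ _
  have hWl1 : l1 (normRingSeminorm ℤ) W ≤ Real.exp (k * ((m + 3) * ω * Λ)) :=
    (l1_det_hasse_le (n := n) (fun i l => μ i + Finsupp.single m (t l)) (fun _ _ => P)
      (fun _ _ => hbox.degree_le) hks (fun _ _ => hl1)).trans (Real.exp_le_exp.2 hsize)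
  obtain ⟨ν, hν, hνw⟩ := ih (fun h => k * r h) β (k * Λ) U (by positivity)
    (fun h hh => Nat.mul_pos hk0 (hr h (by omega)))
    (fun h h' hh hh' => by
      have h1 := hrr h h' hh (by omega)
      have h2 : ω * r h ≤ ω' * r h := by gcongr
      push_cast
      nlinarith)
    (fun h hh => by
      have h1 := hΛr h (by omega)
      push_cast
      nlinarith)
    (fun h hh => by
      have h1 := hrΛ h (by omega)
      have h2 : ω * Λ ≤ ω' * Λ := by gcongr
      push_cast
      nlinarith)
    hU0 hUbox (hUl1.trans (Real.exp_le_exp.2 (by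
      have h2 : (m + 3) * ω * Λ ≤ ω' * Λ := by gcongr
      nlinarith)))
  have hUm : ∀ ν ∈ U.support, ν m = 0 := fun ν hν => (hUbox ν hν).2 m le_rfl
  obtain ⟨b, hb, hbl⟩ := exists_coeff_single_ne_zero_den_pow_le hU0 hV0 hUm hV hWU β
  have hνm : ν m = 0 :=
    ((hUbox.map (Int.castRingHom ℚ)).shift β ν (mem_support_iff.2 hν)).2 m le_rfl
  have hshiftV : ∀ κ ∈ (shift β V).support, ∀ h, h ≠ m → κ h = 0 := by
    intro κ hκ h hh
    obtain ⟨κ', hκ'⟩ := exists_add_mem_support_of_coeff_shift_ne_zero (mem_support_iff.1 hκ)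
    have := hV _ hκ' h hh
    rw [Finsupp.add_apply] at this
    omega
  have hcoeff : ν + Finsupp.single m b ∈ (shift β (map (Int.castRingHom ℚ) W)).support := by
    rw [mem_support_iff, hWU, map_mul, coeff_mul_of_separated
      (fun κ hκ => ((hUbox.map (Int.castRingHom ℚ)).shift β κ hκ).2 m le_rfl) hshiftV hνm]
    exact mul_ne_zero hν hb
  have hbs : (b : ℝ) / s ≤ k * ((m + 3) * ω) := by
    have h1 := hΛr m hm
    have h2 : (0 : ℝ) < (β m).den := by exact_mod_cast (β m).pos
    have h3 : b * Real.log (β m).den ≤ k * ((m + 3) * ω * Λ) := by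
      rw [← Real.log_pow, ← Real.log_exp (k * ((m + 3) * ω * Λ))]
      exact Real.log_le_log (by positivity) (hbl.trans hWl1)
    rw [div_le_iff₀ hs0']
    have h4 : (b : ℝ) * Λ ≤ (k * ((m + 3) * ω) * s) * Λ := by
      calc (b : ℝ) * Λ ≤ b * (s * Real.log (β m).den) := by gcongr
        _ = s * (b * Real.log (β m).den) := by ring
        _ ≤ s * (k * ((m + 3) * ω * Λ)) := by gcongr
        _ = _ := by ring
    exact le_of_mul_le_mul_right h4 hΛ
  have hνk : indexWeight r m ν ≤ k * (ε ^ 2 / 128) := by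
    have : indexWeight r m ν = k * indexWeight (fun h => k * r h) m ν := by
      rw [indexWeight_apply, indexWeight_apply, Finset.mul_sum]
      refine Finset.sum_congr rfl fun h _ => ?_
      push_cast
      field_simp
    rw [this]
    gcongr
  have hupper : indexWeight r (m + 1) (ν + Finsupp.single m b) ≤ k * (ε ^ 2 / 64) := by
    have h1 : indexWeight r (m + 1) (ν + Finsupp.single m b) = indexWeight r m ν + b / s := by
      rw [indexWeight_apply, indexWeight_apply, Finset.sum_range_succ]
      congr 1
      · refine Finset.sum_congr rfl fun h hh => ?_
        rw [Finsupp.add_apply, Finsupp.single_eq_of_ne (Finset.mem_range.1 hh).ne, add_zero]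
      · rw [Finsupp.add_apply, Finsupp.single_eq_same, hνm, zero_add]
    rw [h1]
    nlinarith
  have hlower : (k : ℝ) * (ε ^ 2 / 32) ≤ indexWeight r (m + 1) (ν + Finsupp.single m b) := by
    have hPw : WeightGE (indexWeight r (m + 1)) ε (shift β (map (Int.castRingHom ℚ) P)) :=
      fun κ hκ => (hcon κ (mem_support_iff.1 hκ)).le
    have hWw : WeightGE (indexWeight r (m + 1))
        (∑ l, max 0 (ε / 2 - (t l : ℝ) / s)) (shift β (map (Int.castRingHom ℚ) W)) := by
      have h1 : shift β (map (Int.castRingHom ℚ) W) = (Matrix.of fun i l =>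
          shift β (map (Int.castRingHom ℚ) (hasse (μ i + Finsupp.single m (t l)) P))).det := by
        rw [hW, RingHom.map_det, AlgHom.map_det]
        rfl
      rw [h1]
      refine WeightGE.det _ _ fun i l κ hκ => ?_
      refine le_trans ?_ (weightGE_shift_hasse hPw _ κ hκ)
      refine max_le_max le_rfl ?_
      have h2 : indexWeight r (m + 1) (μ i) ≤ ω := by
        rw [indexWeight_apply, Finset.sum_range_succ, hμm i, Nat.cast_zero, zero_div, add_zero]
        exact indexWeight_le_of_degree_le hs0 hω.le (fun h hh => hr h (by omega))
          (fun h hh => hrr h m hh hm) (by have := hμ i; omega)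
      have h3 : indexWeight r (m + 1) (Finsupp.single m (t l)) = (t l : ℝ) / s := by
        rw [indexWeight_apply, Finset.sum_range_succ, Finsupp.single_eq_same,
          Finset.sum_eq_zero, zero_add]
        intro h hh
        rw [Finsupp.single_eq_of_ne (Finset.mem_range.1 hh).ne]
        simp
      rw [map_add, h3]
      linarith
    refine le_trans ?_ (hWw _ hcoeff)
    have h4 := mul_sq_div_eight_le_sum_max hk hs0 (half_pos hε) (by linarith)
    have h5 : ∑ l, max 0 (ε / 2 - (t l : ℝ) / s) =
        ∑ j ∈ Finset.range k, max 0 (ε / 2 - (j : ℝ) / s) := by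
      have himg : Finset.univ.image t = Finset.range k := by
        refine Finset.eq_of_subset_of_card_le ?_ ?_
        · intro j hj
          obtain ⟨l, _, rfl⟩ := Finset.mem_image.1 hj
          exact Finset.mem_range.2 (htk l)
        · rw [Finset.card_image_of_injective _ htinj]
          simp
      rw [← himg, Finset.sum_image fun x _ y _ h => htinj h]
    rw [h5]
    refine le_trans (le_of_eq ?_) h4
    ring
  have : 0 < (k : ℝ) * ε ^ 2 := by positivity
  linarith

/-- **Roth's lemma**: a polynomial of small height has small index at a point whose coordinates
have rapidly increasing denominators. -/
theorem exists_rothIndexBound (m : ℕ) : ∀ ε > 0, ∃ ω > 0, RothIndexBound m ε ω := by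
  induction m with
  | zero => exact fun ε hε => ⟨1, one_pos, RothIndexBound.zero hε⟩
  | succ m ih =>
    intro ε hε
    set δ := min ε 1 with hδ
    have hδ0 : 0 < δ := lt_min hε one_pos
    obtain ⟨ω', hω', hb⟩ := ih (δ ^ 2 / 128) (by positivity)
    have hm : (0 : ℝ) < m + 3 := by positivity
    refine ⟨min (δ / 2) (min (ω' / (m + 3)) (δ ^ 2 / 128 / (m + 3))), by positivity,
      (RothIndexBound.succ hδ0 (min_le_right _ _) hb (by positivity) (min_le_left _ _) ?_ ?_).mono
        (min_le_left _ _)⟩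
    · rw [mul_comm, ← le_div_iff₀ hm]
      exact (min_le_right _ _).trans (min_le_left _ _)
    · rw [mul_comm, ← le_div_iff₀ hm]
      exact (min_le_right _ _).trans (min_le_right _ _)

end MvPolynomial

lemma Int.Matrix.exists_ne_zero_int_vec_abs_le {ι κ : Type*} [Fintype ι] [Fintype κ]
    (A : Matrix ι κ ℤ) (K : ℝ) (hK : 1 ≤ K) (hA : ∀ i j, |(A i j : ℝ)| ≤ K)
    (hn : 2 * Fintype.card ι ≤ Fintype.card κ) (hm : 0 < Fintype.card ι) :
    ∃ t : κ → ℤ, t ≠ 0 ∧ A.mulVec t = 0 ∧ ∀ j, |(t j : ℝ)| ≤ Fintype.card κ * K := by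
  obtain ⟨t, ht, hAt, hle⟩ := Int.Matrix.exists_ne_zero_int_vec_norm_le A (by omega) hm
  refine ⟨t, ht, hAt, fun j => ?_⟩
  have h1 : |(t j : ℝ)| ≤ ‖t‖ := by
    have := norm_le_pi_norm t j
    rwa [Int.norm_eq_abs] at this
  refine h1.trans (hle.trans ?_)
  have hnorm : max 1 (@norm _ Matrix.seminormedAddCommGroup.toNorm A) ≤ K := by
    refine max_le hK ((Matrix.norm_le_iff (by linarith)).2 fun i j => ?_)
    rw [Int.norm_eq_abs]
    exact hA i j
  have hκ : (1 : ℝ) ≤ Fintype.card κ := by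
    have : 1 ≤ Fintype.card κ := by omega
    exact_mod_cast this
  have hle : (Fintype.card κ : ℝ) * max 1 (@norm _ Matrix.seminormedAddCommGroup.toNorm A) ≤
      Fintype.card κ * K := by gcongr
  have h2 : (2 : ℝ) * Fintype.card ι ≤ Fintype.card κ := by exact_mod_cast hn
  have h3 : (0 : ℝ) < Fintype.card ι := by exact_mod_cast hm
  have hexp : (Fintype.card ι : ℝ) / (Fintype.card κ - Fintype.card ι) ≤ 1 := by
    rw [div_le_one (by linarith)]
    linarith
  calc _ ≤ ((Fintype.card κ : ℝ) * max 1 (@norm _ Matrix.seminormedAddCommGroup.toNorm A)) ^ (1 : ℝ) :=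
        Real.rpow_le_rpow_of_exponent_le
          (one_le_mul_of_one_le_of_one_le hκ (le_max_left _ _)) hexp
    _ ≤ _ := by rwa [Real.rpow_one]

/-- The powers of an algebraic integer are integer combinations of finitely many numbers, with
coefficients of at most exponential growth. -/
lemma IsIntegral.exists_pow_eq_sum {α : ℝ} (hα : IsIntegral ℤ α) :
    ∃ (d : ℕ) (e : Fin d → ℝ) (B : ℝ) (c : ℕ → Fin d → ℤ), 0 < d ∧ 1 ≤ B ∧
      (∀ n, α ^ n = ∑ i, c n i * e i) ∧ ∀ n i, |(c n i : ℝ)| ≤ B ^ (n + 1) := by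
  obtain ⟨d, e, he⟩ := Submodule.fg_iff_exists_fin_generating_family.1 hα.fg_adjoin_singleton
  have hmem : ∀ x ∈ Algebra.adjoin ℤ {α}, ∃ y : Fin d → ℤ, x = ∑ i, (y i : ℝ) * e i := by
    intro x hx
    have hx' : x ∈ Submodule.span ℤ (Set.range e) := by rwa [he]
    obtain ⟨y, hy⟩ := (Submodule.mem_span_range_iff_exists_fun ℤ).1 hx'
    exact ⟨y, by simp [← hy]⟩
  have hei : ∀ i, e i ∈ Algebra.adjoin ℤ {α} := fun i => by
    have : e i ∈ Submodule.span ℤ (Set.range e) := Submodule.subset_span ⟨i, rfl⟩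
    rwa [he] at this
  have hαm : α ∈ Algebra.adjoin ℤ {α} := Algebra.self_mem_adjoin_singleton ℤ α
  obtain ⟨u, hu⟩ := hmem 1 (one_mem _)
  choose M hM using fun i => hmem (α * e i) (mul_mem hαm (hei i))
  have hd : 0 < d := by
    rcases Nat.eq_zero_or_pos d with rfl | h
    · simp at hu
    · exact h
  set K : ℝ := ∑ i, |(u i : ℝ)| with hK
  set L : ℝ := ∑ i, ∑ j, |(M i j : ℝ)| with hL
  set c : ℕ → Fin d → ℤ := fun n => Nat.rec u (fun _ y j => ∑ i, y i * M i j) n with hc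
  have hc0 : c 0 = u := rfl
  have hcs : ∀ n, c (n + 1) = fun j => ∑ i, c n i * M i j := fun n => rfl
  have hK0 : 0 ≤ K := Finset.sum_nonneg fun _ _ => abs_nonneg _
  have hL0 : 0 ≤ L := Finset.sum_nonneg fun _ _ => Finset.sum_nonneg fun _ _ => abs_nonneg _
  have hsum : ∀ n, ∑ i, |(c n i : ℝ)| ≤ K * L ^ n := by
    intro n
    induction n with
    | zero => simp [hc0, hK]
    | succ n ih =>
      rw [hcs]
      push_cast
      calc ∑ j, |∑ i, (c n i : ℝ) * M i j| ≤ ∑ j, ∑ i, |(c n i : ℝ)| * |(M i j : ℝ)| := by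
            refine Finset.sum_le_sum fun j _ => (Finset.abs_sum_le_sum_abs _ _).trans ?_
            simp only [abs_mul, le_refl]
        _ = ∑ i, |(c n i : ℝ)| * ∑ j, |(M i j : ℝ)| := by
            rw [Finset.sum_comm]
            simp only [Finset.mul_sum]
        _ ≤ ∑ i, |(c n i : ℝ)| * L := by
            refine Finset.sum_le_sum fun i _ => mul_le_mul_of_nonneg_left ?_ (abs_nonneg _)
            exact Finset.single_le_sum (f := fun i => ∑ j, |(M i j : ℝ)|)
              (fun _ _ => Finset.sum_nonneg fun _ _ => abs_nonneg _) (Finset.mem_univ i)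
        _ ≤ K * L ^ (n + 1) := by
            rw [← Finset.sum_mul, pow_succ, ← mul_assoc]
            gcongr
  refine ⟨d, e, 1 + K + L, c, hd, by linarith, ?_, ?_⟩
  · intro n
    induction n with
    | zero => rw [pow_zero, hc0, ← hu]
    | succ n ih =>
      rw [pow_succ', ih, Finset.mul_sum, hcs]
      push_cast
      simp only [Finset.sum_mul]
      rw [Finset.sum_comm]
      refine Finset.sum_congr rfl fun i _ => ?_
      rw [mul_left_comm, hM i, Finset.mul_sum]
      refine Finset.sum_congr rfl fun j _ => by ring
  · intro n i
    calc |(c n i : ℝ)| ≤ ∑ i, |(c n i : ℝ)| :=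
          Finset.single_le_sum (f := fun i => |(c n i : ℝ)|) (fun _ _ => abs_nonneg _)
            (Finset.mem_univ i)
      _ ≤ K * L ^ n := hsum n
      _ ≤ (1 + K + L) * (1 + K + L) ^ n := by gcongr <;> linarith
      _ = (1 + K + L) ^ (n + 1) := by ring

namespace MvPolynomial

lemma exists_eval_eq_sum {d : ℕ} {α B : ℝ} {e : Fin d → ℝ} {c : ℕ → Fin d → ℤ} (hB : 1 ≤ B)
    (hc : ∀ n, α ^ n = ∑ i, c n i * e i) (hcB : ∀ n i, |(c n i : ℝ)| ≤ B ^ (n + 1))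
    {σ : Type*} (Q : MvPolynomial σ ℤ) (n : ℕ) (hn : ∀ ν ∈ Q.support, ν.degree ≤ n) :
    ∃ y : Fin d → ℤ, eval (fun _ => α) (map (Int.castRingHom ℝ) Q) = ∑ i, y i * e i ∧
      ∀ i, |(y i : ℝ)| ≤ l1 (normRingSeminorm ℤ) Q * B ^ (n + 1) := by
  refine ⟨fun i => ∑ ν ∈ Q.support, coeff ν Q * c ν.degree i, ?_, fun i => ?_⟩
  · rw [eval_map, eval₂_eq]
    have : ∀ ν : σ →₀ ℕ, ∏ i ∈ ν.support, α ^ ν i = α ^ ν.degree := fun ν => by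
      rw [Finset.prod_pow_eq_pow_sum, Finsupp.degree_apply]
    have h2 : ∀ ν : σ →₀ ℕ, ∏ i ∈ ν.support, α ^ ν i = ∑ j, c ν.degree j * e j := fun ν =>
      (this ν).trans (hc _)
    rw [Finset.sum_congr rfl fun ν _ => by rw [h2 ν]]
    push_cast
    simp only [Finset.mul_sum, Finset.sum_mul]
    rw [Finset.sum_comm]
    refine Finset.sum_congr rfl fun i _ => Finset.sum_congr rfl fun ν _ => ?_
    simp [mul_assoc]
  · rw [l1_apply, Finset.sum_mul]
    push_cast
    refine (Finset.abs_sum_le_sum_abs _ _).trans (Finset.sum_le_sum fun ν hν => ?_)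
    rw [abs_mul]
    have h1 : normRingSeminorm ℤ (coeff ν Q) = |((coeff ν Q : ℤ) : ℝ)| := Int.norm_eq_abs _
    rw [h1]
    refine mul_le_mul_of_nonneg_left ((hcB _ i).trans ?_) (abs_nonneg _)
    exact pow_le_pow_right₀ hB (by have := hn ν hν; omega)

end MvPolynomial

/-- The lattice points of the box `∏ [0, r h]`, `h < m`. -/
noncomputable def boxFinset (r : ℕ → ℕ) (m : ℕ) : Finset (ℕ →₀ ℕ) :=
  (Finset.range m).finsupp fun h => Finset.range (r h + 1)

lemma mem_boxFinset {r : ℕ → ℕ} {m : ℕ} {ν : ℕ →₀ ℕ} :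
    ν ∈ boxFinset r m ↔ (∀ h < m, ν h ≤ r h) ∧ ∀ h, m ≤ h → ν h = 0 := by
  rw [boxFinset, Finset.mem_finsupp_iff, and_comm]
  refine and_congr ?_ ?_
  · simp
  · constructor
    · intro h i hi
      by_contra hne
      have := h (Finsupp.mem_support_iff.2 hne)
      rw [Finset.mem_range] at this
      omega
    · intro h i hi
      rw [Finset.mem_range]
      by_contra hne
      exact Finsupp.mem_support_iff.1 hi (h i (by omega))

lemma card_boxFinset (r : ℕ → ℕ) (m : ℕ) :
    (boxFinset r m).card = ∏ h ∈ Finset.range m, (r h + 1) := by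
  rw [boxFinset, Finset.card_finsupp]
  simp

lemma card_boxFinset_le (r : ℕ → ℕ) (m : ℕ) :
    (boxFinset r m).card ≤ 2 ^ ∑ h ∈ Finset.range m, r h := by
  rw [card_boxFinset, ← Finset.prod_pow_eq_pow_sum]
  exact Finset.prod_le_prod' fun h _ => Nat.lt_two_pow_self

lemma sum_boxFinset_mul_eq_zero {r : ℕ → ℕ} {m h g : ℕ} (hh : h < m) (hr : 0 < r h)
    (hhg : h ≠ g) :
    ∑ ν ∈ boxFinset r m, ((ν h : ℝ) / r h - 1 / 2) * ((ν g : ℝ) / r g - 1 / 2) = 0 := by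
  classical
  set F : (ℕ →₀ ℕ) → ℝ := fun ν => ((ν h : ℝ) / r h - 1 / 2) * ((ν g : ℝ) / r g - 1 / 2) with hF
  have hupd : ∀ (ν : ℕ →₀ ℕ) (y : ℕ) {i : ℕ}, i ≠ h → ν.update h y i = ν i := fun ν y i hi => by
    rw [Finsupp.coe_update, Function.update_of_ne hi]
  have hmaps : ∀ ν ∈ boxFinset r m, ν.update h (r h - ν h) ∈ boxFinset r m := by
    intro ν hν
    rw [mem_boxFinset] at hν ⊢
    refine ⟨fun i hi => ?_, fun i hi => ?_⟩
    · rcases eq_or_ne i h with rfl | hne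
      · simp
      · rw [hupd _ _ hne]
        exact hν.1 i hi
    · rw [hupd _ _ (by omega)]
      exact hν.2 i hi
  have hinv : ∀ ν ∈ boxFinset r m,
      (ν.update h (r h - ν h)).update h (r h - ν.update h (r h - ν h) h) = ν := by
    intro ν hν
    have := (mem_boxFinset.1 hν).1 h hh
    ext i
    rcases eq_or_ne i h with rfl | hne
    · simp
      omega
    · rw [hupd _ _ hne, hupd _ _ hne]
  have hneg : ∑ ν ∈ boxFinset r m, F ν = ∑ ν ∈ boxFinset r m, - F ν := by
    refine Finset.sum_nbij' (fun ν => ν.update h (r h - ν h)) (fun ν => ν.update h (r h - ν h))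
      hmaps hmaps hinv hinv fun ν hν => ?_
    have h1 := (mem_boxFinset.1 hν).1 h hh
    have h2 : (r h : ℝ) ≠ 0 := by exact_mod_cast hr.ne'
    rw [hF]
    simp only
    rw [hupd _ _ hhg.symm, Finsupp.coe_update, Function.update_self, Nat.cast_sub h1, sub_div, div_self h2]
    ring
  rw [Finset.sum_neg_distrib] at hneg
  linarith

lemma card_filter_indexWeight_lt_le {r : ℕ → ℕ} {m : ℕ} (hr : ∀ h < m, 0 < r h) {η : ℝ}
    (hη : 0 < η) :
    ((boxFinset r m).filter fun ν => indexWeight r m ν < m * (1 / 2 - η)).card * (η * m) ^ 2 ≤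
      (m : ℝ) * (boxFinset r m).card / 4 := by
  set x : (ℕ →₀ ℕ) → ℕ → ℝ := fun ν h => (ν h : ℝ) / r h - 1 / 2 with hx
  have hw : ∀ ν, indexWeight r m ν - m / 2 = ∑ h ∈ Finset.range m, x ν h := by
    intro ν
    rw [hx, indexWeight_apply, Finset.sum_sub_distrib]
    simp
    ring
  have h1 : ∑ ν ∈ boxFinset r m, (indexWeight r m ν - m / 2) ^ 2 ≤
      (m : ℝ) * (boxFinset r m).card / 4 := by
    simp only [hw, sq, Finset.sum_mul_sum]
    rw [Finset.sum_comm]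
    have h2 : ∀ h ∈ Finset.range m, ∑ ν ∈ boxFinset r m, ∑ g ∈ Finset.range m, x ν h * x ν g ≤
        ((boxFinset r m).card : ℝ) / 4 := by
      intro h hh
      rw [Finset.sum_comm, Finset.sum_eq_single_of_mem h hh]
      · have h3 : ∀ ν ∈ boxFinset r m, x ν h * x ν h ≤ 1 / 4 := by
          intro ν hν
          have h4 := (mem_boxFinset.1 hν).1 h (Finset.mem_range.1 hh)
          have h5 : (0 : ℝ) < r h := by exact_mod_cast hr h (Finset.mem_range.1 hh)
          have h6 : (ν h : ℝ) / r h ≤ 1 := by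
            rw [div_le_one h5]
            exact_mod_cast h4
          have h7 : (0 : ℝ) ≤ (ν h : ℝ) / r h := by positivity
          simp only [hx]
          nlinarith
        refine (Finset.sum_le_card_nsmul _ _ _ h3).trans (le_of_eq ?_)
        rw [nsmul_eq_mul]
        ring
      · intro g _ hg
        exact sum_boxFinset_mul_eq_zero (Finset.mem_range.1 hh) (hr h (Finset.mem_range.1 hh))
          hg.symm
    refine (Finset.sum_le_card_nsmul _ _ _ h2).trans (le_of_eq ?_)
    rw [Finset.card_range, nsmul_eq_mul]
    ring
  refine le_trans ?_ h1
  rw [← nsmul_eq_mul]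
  refine le_trans (Finset.card_nsmul_le_sum _ (fun ν => (indexWeight r m ν - m / 2) ^ 2) _ ?_)
    (Finset.sum_le_sum_of_subset_of_nonneg (Finset.filter_subset _ _) fun _ _ _ => sq_nonneg _)
  intro ν hν
  have h8 := (Finset.mem_filter.1 hν).2
  have hm : (0 : ℝ) ≤ η * m := by positivity
  rw [← sq_abs (_ - _)]
  have : η * m ≤ |indexWeight r m ν - m / 2| := by
    rw [le_abs]
    right
    linarith
  gcongr

namespace MvPolynomial

lemma exists_auxiliary_polynomial {α : ℝ} (hα : IsIntegral ℤ α) {η : ℝ} (hη : 0 < η)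
    (hη1 : η < 1 / 2) :
    ∃ (d : ℕ) (B : ℝ), 1 ≤ B ∧ ∀ m : ℕ, 0 < m → (d : ℝ) ≤ 2 * η ^ 2 * m → ∀ r : ℕ → ℕ,
      (∀ h < m, 0 < r h) → ∃ P : MvPolynomial ℕ ℤ, P ≠ 0 ∧ InBox r m P ∧
        l1 (normRingSeminorm ℤ) P ≤ B ^ ∑ h ∈ Finset.range m, r h ∧
        WeightGE (indexWeight r m) (m * (1 / 2 - η))
          (shift (fun _ => α) (map (Int.castRingHom ℝ) P)) := by
  classical
  obtain ⟨d, e, B, c, hd, hB, hc, hcB⟩ := hα.exists_pow_eq_sum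
  refine ⟨d, 8 * B ^ 2, by nlinarith, fun m hm hdm r hr => ?_⟩
  have h1 : normRingSeminorm ℤ 1 ≤ 1 := by
    change ‖(1 : ℤ)‖ ≤ 1
    simp
  set n := ∑ h ∈ Finset.range m, r h with hn
  have hn1 : 1 ≤ n := by
    have := Finset.single_le_sum (f := r) (fun _ _ => Nat.zero_le _) (Finset.mem_range.2 hm)
    have := hr 0 hm
    omega
  set box := boxFinset r m with hbox
  set bad := box.filter fun ν => indexWeight r m ν < m * (1 / 2 - η) with hbad
  have hmono : ∀ ν ∈ box, InBox r m (monomial ν (1 : ℤ)) := by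
    intro ν hν κ hκ
    rw [support_monomial, if_neg one_ne_zero, Finset.mem_singleton] at hκ
    rw [hκ]
    exact mem_boxFinset.1 hν
  have hy : ∀ (μ : bad) (ν : box), ∃ y : Fin d → ℤ,
      eval (fun _ => α) (map (Int.castRingHom ℝ) (hasse (μ : ℕ →₀ ℕ)
        (monomial (ν : ℕ →₀ ℕ) (1 : ℤ)))) = ∑ i, y i * e i ∧
      ∀ i, |(y i : ℝ)| ≤ 2 ^ n * B ^ (n + 1) := by
    intro μ ν
    have hν := hmono ν ν.2
    obtain ⟨y, hy, hyB⟩ := exists_eval_eq_sum hB hc hcB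
      (hasse (μ : ℕ →₀ ℕ) (monomial (ν : ℕ →₀ ℕ) (1 : ℤ))) n (hν.hasse _).degree_le
    refine ⟨y, hy, fun i => (hyB i).trans ?_⟩
    have h2 := l1_hasse_le (normRingSeminorm ℤ) h1 μ _ n hν.degree_le
    rw [l1_monomial] at h2
    have h3 : (2 : ℝ) ^ n * normRingSeminorm ℤ 1 ≤ 2 ^ n * 1 := by gcongr
    rw [mul_one] at h3
    have := h2.trans h3
    gcongr
  choose y hy hyB using hy
  have hcount : 2 * Fintype.card (bad × Fin d) ≤ Fintype.card box := by
    rw [Fintype.card_prod, Fintype.card_fin, Fintype.card_coe, Fintype.card_coe]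
    have h2 : (bad.card : ℝ) * (η * m) ^ 2 ≤ m * box.card / 4 :=
      card_filter_indexWeight_lt_le hr hη
    have hm' : (0 : ℝ) < m := by exact_mod_cast hm
    have h3 : (bad.card : ℝ) * (η ^ 2 * m) ≤ box.card / 4 := by
      refine le_of_mul_le_mul_left ?_ hm'
      calc (m : ℝ) * ((bad.card : ℝ) * (η ^ 2 * m)) = (bad.card : ℝ) * (η * m) ^ 2 := by ring
        _ ≤ (m : ℝ) * (box.card : ℝ) / 4 := h2
        _ = (m : ℝ) * ((box.card : ℝ) / 4) := by ring
    have h4 : (bad.card : ℝ) * d ≤ bad.card * (2 * η ^ 2 * m) := by gcongr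
    have h5 : (2 : ℝ) * (bad.card * d) ≤ box.card := by linarith
    exact_mod_cast h5
  have hzero : (0 : ℕ →₀ ℕ) ∈ bad := by
    rw [hbad, Finset.mem_filter, hbox, mem_boxFinset, map_zero]
    refine ⟨⟨fun _ _ => Nat.zero_le _, fun _ _ => rfl⟩, ?_⟩
    have hm' : (0 : ℝ) < m := by exact_mod_cast hm
    exact mul_pos hm' (by linarith)
  have hpos : 0 < Fintype.card (bad × Fin d) := by
    rw [Fintype.card_prod, Fintype.card_fin, Fintype.card_coe]
    exact Nat.mul_pos (Finset.card_pos.2 ⟨0, hzero⟩) hd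
  obtain ⟨t, ht0, ht, htB⟩ := Int.Matrix.exists_ne_zero_int_vec_abs_le
    (Matrix.of fun (p : bad × Fin d) (ν : box) => y p.1 ν p.2) (2 ^ n * B ^ (n + 1))
    (one_le_mul_of_one_le_of_one_le (one_le_pow₀ one_le_two) (one_le_pow₀ hB))
    (fun p ν => hyB p.1 ν p.2) hcount hpos
  set P : MvPolynomial ℕ ℤ := ∑ ν : box, monomial (ν : ℕ →₀ ℕ) (t ν) with hP
  have hcoeff : ∀ ν : box, coeff (ν : ℕ →₀ ℕ) P = t ν := by
    intro ν
    rw [hP, coeff_sum]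
    simp only [coeff_monomial]
    rw [Finset.sum_eq_single_of_mem ν (Finset.mem_univ _), if_pos rfl]
    intro κ _ hκ
    rw [if_neg]
    exact fun h => hκ (Subtype.ext h)
  have hPbox : InBox r m P := by
    intro κ hκ
    rw [hP, mem_support_iff, coeff_sum] at hκ
    obtain ⟨ν, _, hν⟩ := Finset.exists_ne_zero_of_sum_ne_zero hκ
    rw [coeff_monomial] at hν
    split_ifs at hν with h
    · rw [← h]
      exact mem_boxFinset.1 ν.2
    · exact absurd rfl hν
  refine ⟨P, ?_, hPbox, ?_, ?_⟩
  · intro h0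
    apply ht0
    funext ν
    rw [← hcoeff, h0]
    simp
  · have hN : (box.card : ℝ) ≤ 2 ^ n := by exact_mod_cast card_boxFinset_le r m
    calc l1 (normRingSeminorm ℤ) P
        ≤ ∑ ν : box, l1 (normRingSeminorm ℤ) (monomial (ν : ℕ →₀ ℕ) (t ν)) :=
          Finset.le_sum_of_subadditive _ (map_zero _).le (map_add_le_add _) _ _
      _ ≤ ∑ _ν : box, (box.card : ℝ) * (2 ^ n * B ^ (n + 1)) := by
          refine Finset.sum_le_sum fun ν _ => ?_
          rw [l1_monomial]
          have : normRingSeminorm ℤ (t ν) = |((t ν : ℤ) : ℝ)| := Int.norm_eq_abs _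
          rw [this]
          simpa using htB ν
      _ = (box.card : ℝ) * (box.card * (2 ^ n * B ^ (n + 1))) := by simp
      _ ≤ (2 : ℝ) ^ n * (2 ^ n * (2 ^ n * B ^ (n + n))) := by
          gcongr
      _ = (8 * B ^ 2) ^ n := by
          rw [mul_pow, show (8 : ℝ) = 2 * 2 * 2 by norm_num, mul_pow, mul_pow]
          ring
  · intro μ hμ
    by_contra hlt
    rw [not_le] at hlt
    have hμbox : μ ∈ box :=
      mem_boxFinset.2 (((hPbox.map (Int.castRingHom ℝ)).shift (fun _ => α)) μ hμ)
    have hμbad : μ ∈ bad := Finset.mem_filter.2 ⟨hμbox, hlt⟩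
    rw [mem_support_iff, ← constantCoeff_hasse_shift, hasse_map] at hμ
    apply hμ
    have hPt : hasse μ P = ∑ ν : box, C (t ν) * hasse μ (monomial (ν : ℕ →₀ ℕ) (1 : ℤ)) := by
      rw [hP, hasse_sum]
      refine Finset.sum_congr rfl fun ν _ => ?_
      rw [← mul_one (t ν), ← smul_eq_mul, ← smul_monomial, hasse_smul, C_mul', smul_eq_mul, mul_one]
    rw [hPt]
    simp only [map_sum, map_mul, map_C, eval_C]
    have h2 : ∀ ν : box, eval (fun _ => α) (map (Int.castRingHom ℝ) (hasse μ
        (monomial (ν : ℕ →₀ ℕ) (1 : ℤ)))) = ∑ i, y ⟨μ, hμbad⟩ ν i * e i :=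
      fun ν => hy ⟨μ, hμbad⟩ ν
    simp only [h2, Finset.mul_sum]
    rw [Finset.sum_comm]
    refine Finset.sum_eq_zero fun i _ => ?_
    have h3 := congrFun ht (⟨μ, hμbad⟩, i)
    have h4 : ∑ ν : box, ((y ⟨μ, hμbad⟩ ν i : ℤ) : ℝ) * t ν = 0 := by
      exact_mod_cast h3
    calc _ = (∑ ν : box, ((y ⟨μ, hμbad⟩ ν i : ℤ) : ℝ) * t ν) * e i := by
          rw [Finset.sum_mul]
          refine Finset.sum_congr rfl fun ν _ => ?_
          rw [eq_intCast]
          ring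
      _ = 0 := by rw [h4, zero_mul]

end MvPolynomial

namespace MvPolynomial

lemma InBox.eval_eq {R : Type*} [CommRing R] {r : ℕ → ℕ} {m : ℕ} {Q : MvPolynomial ℕ R}
    (hQ : InBox r m Q) (x : ℕ → R) :
    eval x Q = ∑ ν ∈ Q.support, coeff ν Q * ∏ h ∈ Finset.range m, x h ^ ν h := by
  rw [MvPolynomial.eval_eq]
  refine Finset.sum_congr rfl fun ν hν => ?_
  congr 1
  refine Finset.prod_subset ?_ fun h _ hh => ?_
  · intro h hh
    by_contra hn
    rw [Finset.mem_range, not_lt] at hn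
    exact Finsupp.mem_support_iff.1 hh ((hQ ν hν).2 h hn)
  · rw [Finsupp.notMem_support_iff.1 hh, pow_zero]

lemma InBox.one_le_abs_eval_mul_prod {r : ℕ → ℕ} {m : ℕ} {Q : MvPolynomial ℕ ℤ}
    (hQ : InBox r m Q) {β : ℕ → ℚ} (h0 : eval β (MvPolynomial.map (Int.castRingHom ℚ) Q) ≠ 0) :
    1 ≤ |eval β (MvPolynomial.map (Int.castRingHom ℚ) Q)| *
      ∏ h ∈ Finset.range m, ((β h).den : ℚ) ^ r h := by
  have hz_int : ∃ z : ℤ, eval β (MvPolynomial.map (Int.castRingHom ℚ) Q) *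
      ∏ h ∈ Finset.range m, ((β h).den : ℚ) ^ r h = z := by
    refine ⟨∑ ν ∈ (MvPolynomial.map (Int.castRingHom ℚ) Q).support, coeff ν Q *
      ∏ h ∈ Finset.range m, ((β h).num ^ ν h * ((β h).den : ℤ) ^ (r h - ν h)), ?_⟩
    rw [(hQ.map _).eval_eq, Finset.sum_mul]
    push_cast
    refine Finset.sum_congr rfl fun ν hν => ?_
    rw [coeff_map, mul_assoc, ← Finset.prod_mul_distrib, eq_intCast]
    congr 1
    refine Finset.prod_congr rfl fun h hh => ?_
    have h1 := ((hQ.map _) ν hν).1 h (Finset.mem_range.1 hh)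
    rw [← Rat.mul_den_eq_num, mul_pow, mul_assoc, ← pow_add, Nat.add_sub_cancel' h1]
  obtain ⟨z, hz⟩ := hz_int
  have hprod : 0 < ∏ h ∈ Finset.range m, ((β h).den : ℚ) ^ r h :=
    Finset.prod_pos fun h _ => pow_pos (by exact_mod_cast (β h).pos) _
  have hz0 : z ≠ 0 := by
    rintro rfl
    rw [Int.cast_zero] at hz
    exact mul_ne_zero h0 hprod.ne' hz
  rw [← abs_of_pos hprod, ← abs_mul, hz]
  exact_mod_cast Int.one_le_abs hz0

lemma InBox.exp_neg_le_abs_eval {r : ℕ → ℕ} {m : ℕ} {Q : MvPolynomial ℕ ℤ} (hQ : InBox r m Q)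
    {β : ℕ → ℚ} (h0 : eval β (MvPolynomial.map (Int.castRingHom ℚ) Q) ≠ 0) :
    Real.exp (-∑ h ∈ Finset.range m, r h * Real.log (β h).den) ≤
      |eval (fun h => (β h : ℝ)) (MvPolynomial.map (Int.castRingHom ℝ) Q)| := by
  have h1 := hQ.one_le_abs_eval_mul_prod h0
  have h2 : eval (fun h => (β h : ℝ)) (MvPolynomial.map (Int.castRingHom ℝ) Q) =
      ((eval β (MvPolynomial.map (Int.castRingHom ℚ) Q) : ℚ) : ℝ) := by
    rw [hQ.map _ |>.eval_eq, hQ.map _ |>.eval_eq,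
      support_map_of_injective _ (RingHom.injective_int _),
      support_map_of_injective _ (RingHom.injective_int _)]
    push_cast
    refine Finset.sum_congr rfl fun ν _ => ?_
    simp [coeff_map]
  have h3 : (1 : ℝ) ≤ |((eval β (MvPolynomial.map (Int.castRingHom ℚ) Q) : ℚ) : ℝ)| *
      ∏ h ∈ Finset.range m, ((β h).den : ℝ) ^ r h := by exact_mod_cast h1
  have h4 : ∏ h ∈ Finset.range m, ((β h).den : ℝ) ^ r h =
      Real.exp (∑ h ∈ Finset.range m, r h * Real.log (β h).den) := by
    rw [Real.exp_sum]
    refine Finset.prod_congr rfl fun h _ => ?_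
    rw [Real.exp_nat_mul, Real.exp_log (by exact_mod_cast (β h).pos)]
  rw [h4] at h3
  rw [h2, Real.exp_neg, inv_le_iff_one_le_mul₀ (Real.exp_pos _)]
  exact h3

lemma abs_eval_le_of_weightGE {r : ℕ → ℕ} {m : ℕ} {Q : MvPolynomial ℕ ℝ} (hQ : InBox r m Q)
    {x : ℕ → ℝ} {θ T : ℝ} (hT : 0 ≤ T)
    (hx : ∀ h < m, |x h| ≤ Real.exp (-(T / r h))) (hw : WeightGE (indexWeight r m) θ Q) :
    |eval x Q| ≤ l1 (normRingSeminorm ℝ) Q * Real.exp (-(T * θ)) := by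
  rw [hQ.eval_eq, l1_apply, Finset.sum_mul]
  refine (Finset.abs_sum_le_sum_abs _ _).trans (Finset.sum_le_sum fun ν hν => ?_)
  rw [abs_mul, Finset.abs_prod]
  refine mul_le_mul_of_nonneg_left ?_ (abs_nonneg _)
  calc ∏ h ∈ Finset.range m, |x h ^ ν h|
      ≤ ∏ h ∈ Finset.range m, Real.exp (-(T / r h)) ^ ν h := by
        refine Finset.prod_le_prod (fun _ _ => abs_nonneg _) fun h hh => ?_
        rw [abs_pow]
        exact pow_le_pow_left₀ (abs_nonneg _) (hx h (Finset.mem_range.1 hh)) _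
    _ = Real.exp (-(T * indexWeight r m ν)) := by
        rw [indexWeight_apply, Finset.mul_sum, ← Finset.sum_neg_distrib, Real.exp_sum]
        refine Finset.prod_congr rfl fun h _ => ?_
        rw [← Real.exp_nat_mul]
        congr 1
        ring
    _ ≤ Real.exp (-(T * θ)) := by
        have := hw ν hν
        gcongr

lemma l1_map_intCast {σ : Type*} (P : MvPolynomial σ ℤ) :
    l1 (normRingSeminorm ℝ) (map (Int.castRingHom ℝ) P) = l1 (normRingSeminorm ℤ) P := by
  rw [l1_apply, l1_apply, support_map_of_injective _ (RingHom.injective_int _)]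
  refine Finset.sum_congr rfl fun ν _ => ?_
  rw [coeff_map]
  change ‖((coeff ν P : ℤ) : ℝ)‖ = ‖coeff ν P‖
  exact Int.norm_cast_real _

/-- Roth's inequality for several approximations with rapidly increasing denominators. -/
lemma roth_inequality {α : ℝ} {r : ℕ → ℕ} {β : ℕ → ℚ} {m : ℕ} {P : MvPolynomial ℕ ℤ} {B θ ε T : ℝ}
    (hT : 0 ≤ T) (hP : InBox r m P)
    (hl1 : l1 (normRingSeminorm ℤ) P ≤ B ^ ∑ h ∈ Finset.range m, r h)
    (hβ : ∀ h < m, |β h - α| ≤ Real.exp (-(T / r h)))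
    (hw : WeightGE (indexWeight r m) θ (shift (fun _ => α) (map (Int.castRingHom ℝ) P)))
    {ν : ℕ →₀ ℕ} (hν : coeff ν (shift β (map (Int.castRingHom ℚ) P)) ≠ 0)
    (hνε : indexWeight r m ν ≤ ε) :
    Real.exp (-∑ h ∈ Finset.range m, r h * Real.log (β h).den) ≤
      (2 * (1 + |α|) * B) ^ (∑ h ∈ Finset.range m, r h) * Real.exp (-(T * (θ - ε))) := by
  have hQ := hP.hasse ν
  rw [← constantCoeff_hasse_shift, hasse_map] at hν
  refine (hQ.exp_neg_le_abs_eval hν).trans ?_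
  set Q := map (Int.castRingHom ℝ) (MvPolynomial.hasse ν P) with hQd
  have hQbox : InBox r m Q := hQ.map _
  have h1 : eval (fun h => (β h : ℝ)) Q = eval (fun h => (β h : ℝ) - α) (MvPolynomial.shift (fun _ => α) Q) := by
    rw [eval_shift]
    simp
  have hwQ : WeightGE (indexWeight r m) (θ - ε) (MvPolynomial.shift (fun _ => α) Q) := by
    intro κ hκ
    rw [hQd, ← hasse_map, ← hasse_shift] at hκ
    have := hw _ (mem_support_iff.2 (coeff_hasse_ne_zero (mem_support_iff.1 hκ)))
    rw [map_add] at this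
    linarith
  rw [h1]
  refine (abs_eval_le_of_weightGE (hQbox.shift _) hT hβ hwQ).trans ?_
  refine mul_le_mul_of_nonneg_right ?_ (Real.exp_pos _).le
  set n := ∑ h ∈ Finset.range m, r h with hn
  have hR : normRingSeminorm ℝ 1 ≤ 1 := by
    change ‖(1 : ℝ)‖ ≤ 1
    simp
  have hZ : normRingSeminorm ℤ 1 ≤ 1 := by
    change ‖(1 : ℤ)‖ ≤ 1
    simp
  calc l1 (normRingSeminorm ℝ) (MvPolynomial.shift (fun _ => α) Q)
      ≤ (1 + |α|) ^ n * l1 (normRingSeminorm ℝ) Q :=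
        l1_shift_le _ hR _ _ (abs_nonneg _) (fun _ => le_rfl) _ _ hQbox.degree_le
    _ ≤ (1 + |α|) ^ n * (2 ^ n * B ^ n) := by
        rw [hQd, l1_map_intCast]
        have := l1_hasse_le (normRingSeminorm ℤ) hZ ν P n hP.degree_le
        have h3 : (2 : ℝ) ^ n * l1 (normRingSeminorm ℤ) P ≤ 2 ^ n * B ^ n := by gcongr
        have h4 := this.trans h3
        gcongr
    _ = (2 * (1 + |α|) * B) ^ n := by
        rw [mul_pow, mul_pow]
        ring

end MvPolynomial

set_option maxHeartbeats 1000000 in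
/-- Roth's theorem for algebraic integers, for rationals of large denominator. -/
lemma IsIntegral.exists_rpow_den_le_abs_sub {α : ℝ} (hα : IsIntegral ℤ α) {δ : ℝ} (hδ : 0 < δ)
    (hδ1 : δ ≤ 1) :
    ∃ N : ℕ, ∀ β : ℚ, N ≤ β.den → Real.exp (-((2 + δ) * Real.log β.den)) ≤ |β - α| := by
  by_contra! hcon
  set η := δ / 32 with hη
  have hη0 : 0 < η := by positivity
  obtain ⟨d, B, hB, haux⟩ := exists_auxiliary_polynomial hα hη0 (by linarith)
  obtain ⟨m, hm⟩ := exists_nat_ge (max 1 (d / (2 * η ^ 2)))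
  have hm1 : (1 : ℝ) ≤ m := (le_max_left _ _).trans hm
  have hm0 : 0 < m := by exact_mod_cast (zero_lt_one.trans_le hm1)
  have hdm : (d : ℝ) ≤ 2 * η ^ 2 * m := by
    have := (le_max_right _ _).trans hm
    rw [div_le_iff₀ (by positivity)] at this
    linarith
  obtain ⟨ω, hω, hroth⟩ := exists_rothIndexBound m η hη0
  set A := 2 * (1 + |α|) * B with hA
  have hA1 : B ≤ A := by
    have := abs_nonneg α
    nlinarith
  have hlogB : 0 ≤ Real.log B := Real.log_nonneg hB
  have hlogA : Real.log B ≤ Real.log A := Real.log_le_log (by linarith) hA1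
  -- a lower bound for the first denominator, and the growth rate
  set L₀ := 1 + 2 / ω + 2 * m * Real.log A / ω + 32 * Real.log A / δ with hL₀
  set C := 1 + 2 / ω with hC
  have hpick : ∀ x : ℝ, ∃ β : ℚ, x ≤ Real.log β.den ∧
      |β - α| < Real.exp (-((2 + δ) * Real.log β.den)) := by
    intro x
    obtain ⟨N, hN⟩ := exists_nat_ge (Real.exp x)
    obtain ⟨β, hβ, hβα⟩ := hcon N
    refine ⟨β, ?_, hβα⟩
    have h1 : (N : ℝ) ≤ β.den := by exact_mod_cast hβ
    rw [← Real.log_exp x]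
    exact Real.log_le_log (Real.exp_pos _) (hN.trans h1)
  choose pick hpick₁ hpick₂ using hpick
  set β : ℕ → ℚ := fun h => Nat.rec (pick L₀) (fun _ b => pick (C * Real.log b.den)) h with hβ
  have hβ0 : β 0 = pick L₀ := rfl
  have hβs : ∀ h, β (h + 1) = pick (C * Real.log (β h).den) := fun h => rfl
  set L : ℕ → ℝ := fun h => Real.log (β h).den with hL
  have hC1 : 1 ≤ C := by
    rw [hC]
    have : 0 < 2 / ω := by positivity
    linarith
  have hL₀1 : 1 ≤ L₀ := by
    have h1 : 0 ≤ 2 / ω := by positivity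
    have h0 : 0 ≤ Real.log A := hlogB.trans hlogA
    have h2 : 0 ≤ 2 * m * Real.log A / ω := by positivity
    have h3 : 0 ≤ 32 * Real.log A / δ := by positivity
    linarith
  have hL0 : L₀ ≤ L 0 := hpick₁ L₀
  have hLs : ∀ h, C * L h ≤ L (h + 1) := fun h => hpick₁ _
  have hLge : ∀ h, L₀ ≤ L h := by
    intro h
    induction h with
    | zero => exact hL0
    | succ h ih =>
      have := hLs h
      nlinarith
  have hLpos : ∀ h, 0 < L h := fun h => by have := hLge h; linarith
  have hLmono : Monotone L := monotone_nat_of_le_succ fun h => by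
    have := hLs h
    have := hLpos h
    nlinarith
  have hLlt : ∀ h h', h < h' → C * L h ≤ L h' := fun h h' hh => (hLs h).trans (hLmono hh)
  have hβα : ∀ h, |β h - α| < Real.exp (-((2 + δ) * L h)) := by
    intro h
    cases h with
    | zero => exact hpick₂ _
    | succ h => exact hpick₂ _
  set T := 16 / δ * L m with hT
  have hLT : ∀ h < m, L h ≤ δ / 16 * T := by
    intro h hh
    have : δ / 16 * T = L m := by rw [hT]; field_simp
    rw [this]
    exact hLmono hh.le
  have hTpos : 0 < T := by have := hLpos m; positivity
  set r : ℕ → ℕ := fun h => ⌈T / L h⌉₊ with hr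
  have hr0 : ∀ h, 0 < r h := fun h => Nat.ceil_pos.2 (div_pos hTpos (hLpos h))
  have hrT : ∀ h, T / L h ≤ r h := fun h => Nat.le_ceil _
  have hrlt : ∀ h, (r h : ℝ) ≤ T / L h + 1 := fun h =>
    (Nat.ceil_lt_add_one (div_pos hTpos (hLpos h)).le).le
  have hrL : ∀ h < m, r h * L h ≤ (1 + δ / 16) * T := by
    intro h hh
    calc r h * L h ≤ (T / L h + 1) * L h := mul_le_mul_of_nonneg_right (hrlt h) (hLpos h).le
      _ = T + L h := by have := (hLpos h).ne'; field_simp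
      _ ≤ _ := by have := hLT h hh; linarith
  have hr2 : ∀ h < m, (r h : ℝ) * L h ≤ 2 * T := by
    intro h hh
    have := hrL h hh
    nlinarith
  set n := ∑ h ∈ Finset.range m, r h with hn
  have hnT : (n : ℝ) * L₀ ≤ 2 * m * T := by
    rw [hn, Nat.cast_sum, Finset.sum_mul]
    refine (Finset.sum_le_card_nsmul _ _ (2 * T) fun h hh => ?_).trans (le_of_eq ?_)
    · refine le_trans ?_ (hr2 h (Finset.mem_range.1 hh))
      have := hLge h
      gcongr
    · rw [Finset.card_range, nsmul_eq_mul]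
      ring
  have hL₀A : 2 * m * Real.log A ≤ ω * L₀ ∧ 32 * Real.log A ≤ δ * L₀ ∧ 2 ≤ ω * L₀ := by
    have h0 : 0 ≤ Real.log A := hlogB.trans hlogA
    have h1 : 0 ≤ 2 / ω := by positivity
    have h2 : 0 ≤ 2 * m * Real.log A / ω := by positivity
    have h3 : 0 ≤ 32 * Real.log A / δ := by positivity
    refine ⟨?_, ?_, ?_⟩
    · rw [← div_le_iff₀' hω]
      linarith
    · rw [← div_le_iff₀' hδ]
      linarith
    · rw [← div_le_iff₀' hω]
      linarith
  obtain ⟨P, hP0, hPbox, hPl1, hPw⟩ := haux m hm0 hdm r fun h _ => hr0 h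
  have hB0 : 0 < B := by linarith
  have hA0 : 0 < A := by linarith
  have hnA : n * Real.log A ≤ ω * T ∧ n * Real.log A ≤ δ / 16 * (m * T) := by
    have h0 : 0 ≤ Real.log A := hlogB.trans hlogA
    have hL₀0 : 0 < L₀ := by linarith
    have h1 := mul_le_mul_of_nonneg_right hnT h0
    constructor
    · refine le_of_mul_le_mul_right ?_ hL₀0
      calc n * Real.log A * L₀ = n * L₀ * Real.log A := by ring
        _ ≤ 2 * m * T * Real.log A := h1
        _ = T * (2 * m * Real.log A) := by ring
        _ ≤ T * (ω * L₀) := mul_le_mul_of_nonneg_left hL₀A.1 hTpos.le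
        _ = _ := by ring
    · refine le_of_mul_le_mul_right ?_ hL₀0
      calc n * Real.log A * L₀ = n * L₀ * Real.log A := by ring
        _ ≤ 2 * m * T * Real.log A := h1
        _ = m * T / 16 * (32 * Real.log A) := by ring
        _ ≤ m * T / 16 * (δ * L₀) := mul_le_mul_of_nonneg_left hL₀A.2.1 (by positivity)
        _ = _ := by ring
  obtain ⟨ν, hν, hνη⟩ := hroth r β T P hTpos (fun h _ => hr0 h)
    (fun h h' hh hh' => by
      have h1 := hr2 h' hh'
      have h2 := hLlt h h' hh
      have h3 : 2 / ω * L h ≤ L h' := by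
        have := hLpos h
        rw [hC] at h2
        nlinarith
      have h4 := hrT h
      rw [div_le_iff₀ (hLpos h)] at h4
      have h5 : (r h' : ℝ) * (2 / ω * L h) ≤ 2 * (r h * L h) :=
        (mul_le_mul_of_nonneg_left h3 (Nat.cast_nonneg _)).trans (h1.trans (by linarith))
      have h6 : (2 / ω * L h) * r h' ≤ (2 / ω * L h) * (ω * r h) := by
        calc (2 / ω * L h) * r h' = r h' * (2 / ω * L h) := by ring
          _ ≤ 2 * (r h * L h) := h5
          _ = _ := by field_simp
      have := hLpos h
      exact le_of_mul_le_mul_left h6 (by positivity))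
    (fun h _ => by
      have := hrT h
      rwa [div_le_iff₀ (hLpos h)] at this)
    (fun h hh => by
      have h1 := hr2 h hh
      have h2 := hLge h
      have h3 : (0 : ℝ) ≤ r h := Nat.cast_nonneg _
      have h4 : (r h : ℝ) * L₀ ≤ 2 * T := (mul_le_mul_of_nonneg_left h2 h3).trans h1
      refine le_of_mul_le_mul_right ?_ (by linarith : 0 < L₀)
      calc (r h : ℝ) * L₀ ≤ 2 * T := h4
        _ ≤ ω * L₀ * T := mul_le_mul_of_nonneg_right hL₀A.2.2 hTpos.le
        _ = _ := by ring)
    hP0 hPbox (hPl1.trans (by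
      rw [← Real.exp_log (pow_pos hB0 _), Real.exp_le_exp, Real.log_pow]
      exact (mul_le_mul_of_nonneg_left hlogA (Nat.cast_nonneg _)).trans hnA.1))
  have hmain := roth_inequality (T := (2 + δ) * T) (by positivity) hPbox hPl1
    (fun h hh => (hβα h).le.trans (Real.exp_le_exp.2 (by
      have h1 := hrT h
      have h2 : (0 : ℝ) < r h := by exact_mod_cast hr0 h
      rw [div_le_iff₀ (hLpos h)] at h1
      rw [neg_le_neg_iff, div_le_iff₀ h2]
      nlinarith))) hPw hν hνη
  rw [← hA, ← Real.exp_log (pow_pos hA0 _), ← Real.exp_add, Real.exp_le_exp, Real.log_pow] at hmain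
  have hsum : ∑ h ∈ Finset.range m, r h * Real.log (β h).den ≤ m * ((1 + δ / 16) * T) := by
    refine (Finset.sum_le_card_nsmul _ _ _ fun h hh => hrL h (Finset.mem_range.1 hh)).trans ?_
    rw [Finset.card_range, nsmul_eq_mul]
  have hmT : 0 < m * T := by positivity
  have hfin : (m : ℝ) * ((1 + 5 * δ / 16) * T) ≤ (2 + δ) * T * (m * (1 / 2 - η) - η) := by
    have h1 : 1 + 5 * δ / 16 ≤ (2 + δ) * (1 / 2 - 2 * η) := by rw [hη]; nlinarith
    have h2 : m * (1 / 2 - 2 * η) ≤ m * (1 / 2 - η) - η := by nlinarith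
    calc (m : ℝ) * ((1 + 5 * δ / 16) * T) ≤ m * ((2 + δ) * (1 / 2 - 2 * η) * T) := by gcongr
      _ = (2 + δ) * T * (m * (1 / 2 - 2 * η)) := by ring
      _ ≤ _ := by gcongr
  have := hnA.2
  nlinarith

/-- Roth's theorem for irrational algebraic integers. -/
lemma IsIntegral.exists_mul_rpow_den_le_abs_sub {α : ℝ} (hα : IsIntegral ℤ α) (hirr : Irrational α)
    {δ : ℝ} (hδ : 0 < δ) (hδ1 : δ ≤ 1) :
    ∃ c > 0, ∀ β : ℚ, c * (β.den : ℝ) ^ (-(2 + δ)) ≤ |β - α| := by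
  obtain ⟨N, hN⟩ := hα.exists_rpow_den_le_abs_sub hδ hδ1
  obtain ⟨d₀, -, hd₀⟩ := Finset.exists_min_image (Finset.range (N + 1))
    (fun d : ℕ => |(d + 1 : ℕ) * α - round ((d + 1 : ℕ) * α)| / (d + 1 : ℕ)) ⟨0, by simp⟩
  set c := |(d₀ + 1 : ℕ) * α - round ((d₀ + 1 : ℕ) * α)| / (d₀ + 1 : ℕ)
  have hc : 0 < c := by
    refine div_pos (abs_pos.2 (sub_ne_zero.2 ?_)) (by positivity)
    exact (hirr.natCast_mul (Nat.succ_ne_zero d₀)).ne_int _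
  refine ⟨min 1 c, lt_min one_pos hc, fun β => ?_⟩
  have hden : (0 : ℝ) < β.den := by exact_mod_cast β.den_pos
  have h1 : (1 : ℝ) ≤ β.den := by exact_mod_cast β.den_pos
  have hpow : 0 < (β.den : ℝ) ^ (-(2 + δ)) := Real.rpow_pos_of_pos hden _
  by_cases hβ : N ≤ β.den
  · have := hN β hβ
    calc min 1 c * (β.den : ℝ) ^ (-(2 + δ)) ≤ 1 * (β.den : ℝ) ^ (-(2 + δ)) := by
          gcongr
          exact min_le_left _ _
      _ = Real.exp (-((2 + δ) * Real.log β.den)) := by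
          rw [one_mul, Real.rpow_def_of_pos hden]
          congr 1
          ring
      _ ≤ _ := this
  · have hle : (β.den : ℝ) ^ (-(2 + δ)) ≤ 1 := Real.rpow_le_one_of_one_le_of_nonpos h1 (by linarith)
    have h2 := hd₀ (β.den - 1) (by simp; lia)
    rw [Nat.sub_add_cancel β.den_pos] at h2
    calc min 1 c * (β.den : ℝ) ^ (-(2 + δ)) ≤ c * 1 := by
          gcongr
          exact min_le_right _ _
      _ = c := mul_one c
      _ ≤ _ := h2
      _ ≤ |β.den * α - β.num| / β.den :=
          div_le_div_of_nonneg_right (round_le (β.den * α) β.num) hden.le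
      _ = |β - α| := by
          conv_rhs => rw [abs_sub_comm, ← Rat.num_div_den β]
          rw [div_eq_iff hden.ne', ← abs_of_pos hden, ← abs_mul, abs_of_pos hden]
          congr 1
          push_cast
          field_simp

/-- **Roth's theorem**: an irrational algebraic real number has irrationality exponent `2`. -/
theorem IsAlgebraic.exists_mul_rpow_le_abs_mul_sub {α : ℝ} (hα : IsAlgebraic ℚ α)
    (hirr : Irrational α) {δ : ℝ} (hδ : 0 < δ) (hδ1 : δ ≤ 1) :
    ∃ c > 0, ∀ q p : ℤ, q ≠ 0 → c * |(q : ℝ)| ^ (-(1 + δ)) ≤ |q * α - p| := by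
  obtain ⟨a, ha, hz_int⟩ := ((IsFractionRing.isAlgebraic_iff ℤ ℚ ℝ).2 hα).exists_integral_multiple
  rw [zsmul_eq_mul] at hz_int
  obtain ⟨c, hc, h⟩ := hz_int.exists_mul_rpow_den_le_abs_sub (hirr.intCast_mul ha) hδ hδ1
  have ha' : (0 : ℝ) < |(a : ℝ)| := abs_pos.2 (by exact_mod_cast ha)
  refine ⟨c / |(a : ℝ)|, by positivity, fun q p hq => ?_⟩
  have hq' : (0 : ℝ) < |(q : ℝ)| := abs_pos.2 (by exact_mod_cast hq)
  have h1 := h ((a * p : ℤ) / q)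
  have hden : ((((a * p : ℤ) : ℚ) / q).den : ℝ) ≤ |(q : ℝ)| := by
    have h2 := Int.le_of_dvd (abs_pos.2 hq) ((dvd_abs _ _).2 (Rat.den_dvd (a * p) q))
    exact_mod_cast h2
  have hden0 : (0 : ℝ) < (((a * p : ℤ) : ℚ) / q).den := by exact_mod_cast Rat.den_pos _
  have h3 : |(q : ℝ)| ^ (-(2 + δ)) ≤ ((((a * p : ℤ) : ℚ) / q).den : ℝ) ^ (-(2 + δ)) :=
    Real.rpow_le_rpow_of_nonpos hden0 hden (by linarith)
  have h4 : |((((a * p : ℤ) : ℚ) / q : ℚ) : ℝ) - a * α| * |(q : ℝ)| = |(a : ℝ)| * |q * α - p| := by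
    rw [← abs_mul, ← abs_mul, ← abs_neg]
    congr 1
    push_cast
    have : (q : ℝ) ≠ 0 := by exact_mod_cast hq
    field_simp
    ring
  have h5 : |(q : ℝ)| ^ (-(1 + δ)) = |(q : ℝ)| ^ (-(2 + δ)) * |(q : ℝ)| := by
    rw [← Real.rpow_add_one hq'.ne']
    congr 1
    ring
  rw [h5, div_mul_eq_mul_div, div_le_iff₀ ha', mul_comm |_ - _|, ← h4, ← mul_assoc]
  gcongr
  exact (mul_le_mul_of_nonneg_left h3 hc.le).trans h1

/-- The norm of `e(x) - 1` is bounded below by the distance of `x` to the nearest integer. -/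
lemma four_mul_abs_sub_round_le_norm_exp_sub_one (x : ℝ) :
    4 * |x - round x| ≤ ‖Complex.exp (2 * Real.pi * Complex.I * x) - 1‖ := by
  have h1 : Complex.exp (2 * Real.pi * Complex.I * x) =
      Complex.exp (Complex.I * ((2 * Real.pi * (x - round x) : ℝ) : ℂ)) := by
    rw [Complex.exp_eq_exp_iff_exists_int]
    refine ⟨round x, ?_⟩
    push_cast
    ring
  have h2 : |Real.pi * (x - round x)| ≤ Real.pi / 2 := by
    rw [abs_mul, abs_of_pos Real.pi_pos]
    have := abs_sub_round x
    have := Real.pi_pos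
    nlinarith
  have h3 := Real.mul_abs_le_abs_sin h2
  rw [abs_mul, abs_of_pos Real.pi_pos, ← mul_assoc, div_mul_cancel₀ _ Real.pi_ne_zero] at h3
  rw [h1, Complex.norm_exp_I_mul_ofReal_sub_one, Real.norm_eq_abs, abs_mul,
    show 2 * Real.pi * (x - round x) / 2 = Real.pi * (x - round x) by ring, abs_two]
  linarith

lemma iteratedDeriv_fourier (k : ℤ) (i : ℕ) :
    iteratedDeriv i (fun x : ℝ => (fourier k (x : UnitAddCircle) : ℂ)) =
      fun x : ℝ => (2 * Real.pi * Complex.I * k) ^ i * (fourier k (x : UnitAddCircle) : ℂ) := by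
  induction i with
  | zero => simp
  | succ i ih =>
    rw [iteratedDeriv_succ, ih]
    ext x
    have := ((hasDerivAt_fourier 1 k x).const_mul ((2 * Real.pi * Complex.I * k : ℂ) ^ i)).deriv
    rw [this]
    push_cast
    ring

lemma contDiff_fourier (k : ℤ) {n : WithTop ℕ∞} :
    ContDiff ℝ n (fun x : ℝ => (fourier k (x : UnitAddCircle) : ℂ)) := by
  simp_rw [fourier_coe_apply]
  have h : ContDiff ℝ n (fun x : ℝ => (x : ℂ)) := Complex.ofRealCLM.contDiff
  exact (((contDiff_const.mul h).div_const _)).cexp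

/-- A Fourier series whose coefficients are summable against `|k| ^ n` is of class `C^n`. -/
lemma contDiff_tsum_fourier {a : ℤ → ℂ} {n : ℕ} (h0 : a 0 = 0)
    (ha : Summable fun k : ℤ => |(k : ℝ)| ^ n * ‖a k‖) :
    ContDiff ℝ n (fun x : ℝ => ∑' k : ℤ, a k * fourier k (x : UnitAddCircle)) := by
  refine contDiff_tsum (N := (n : ℕ∞)) (v := fun (i : ℕ) (k : ℤ) => (2 * Real.pi) ^ i * (|(k : ℝ)| ^ n * ‖a k‖))
    (fun k => contDiff_const.mul (contDiff_fourier k)) (fun i _ => ha.mul_left _) fun i k x hi => ?_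
  rw [norm_iteratedFDeriv_eq_norm_iteratedDeriv, iteratedDeriv_const_mul_field,
    iteratedDeriv_fourier]
  rcases eq_or_ne k 0 with rfl | hk
  · simp [h0]
  · have h1 : (1 : ℝ) ≤ |(k : ℝ)| := by exact_mod_cast Int.one_le_abs hk
    have hi' : i ≤ n := by exact_mod_cast hi
    have h2 : ‖(fourier k (x : UnitAddCircle) : ℂ)‖ = 1 := Circle.norm_coe _
    simp only [norm_mul, norm_pow, h2, Complex.norm_ofNat, Complex.norm_I, Complex.norm_intCast,
      Complex.norm_real, Real.norm_eq_abs, abs_of_pos Real.pi_pos, mul_one, mul_pow]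
    calc ‖a k‖ * (2 ^ i * Real.pi ^ i * 1 ^ i * |(k : ℝ)| ^ i)
        = (2 ^ i * Real.pi ^ i) * (|(k : ℝ)| ^ i * ‖a k‖) := by ring
      _ ≤ (2 ^ i * Real.pi ^ i) * (|(k : ℝ)| ^ n * ‖a k‖) := by gcongr

/-- Integration by parts for the Fourier coefficients of a periodic function. -/
lemma norm_fourierCoeffOn_iteratedDeriv {f : ℝ → ℂ} {r : ℕ} (hf : ContDiff ℝ r f)
    (hper : Function.Periodic f 1) (k : ℤ) (hk : k ≠ 0) :
    |(k : ℝ)| ^ r * ‖fourierCoeffOn one_pos f k‖ ≤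
      ‖fourierCoeffOn one_pos (iteratedDeriv r f) k‖ := by
  induction r generalizing f with
  | zero => simp
  | succ r ih =>
    have hd : Differentiable ℝ f := hf.differentiable (by simp)
    have hf' : ContDiff ℝ r (deriv f) := ContDiff.deriv' (by exact_mod_cast hf)
    have hper' : Function.Periodic (deriv f) 1 := fun x => by
      rw [← deriv_comp_add_const]
      congr 1
      ext y
      exact hper y
    have h1 := fourierCoeffOn_of_hasDerivAt one_pos hk (fun x _ => (hd x).hasDerivAt)
      (hf'.continuous.intervalIntegrable 0 1)
    have h2 : f 1 = f 0 := by simpa using hper 0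
    have h3 : ‖fourierCoeffOn one_pos f k‖ =
        (2 * Real.pi * |(k : ℝ)|)⁻¹ * ‖fourierCoeffOn one_pos (deriv f) k‖ := by
      rw [h1, h2]
      simp [abs_of_pos Real.pi_pos]
    have hk' : 0 < |(k : ℝ)| := abs_pos.2 (by exact_mod_cast hk)
    have h4 : |(k : ℝ)| * ‖fourierCoeffOn one_pos f k‖ ≤ ‖fourierCoeffOn one_pos (deriv f) k‖ := by
      rw [h3, mul_inv, mul_comm (2 * Real.pi)⁻¹, mul_assoc, mul_inv_cancel_left₀ hk'.ne']
      refine mul_le_of_le_one_left (norm_nonneg _) (inv_le_one_of_one_le₀ ?_)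
      linarith [Real.pi_gt_three]
    rw [iteratedDeriv_succ']
    refine le_trans ?_ (ih hf' hper')
    rw [pow_succ, mul_assoc]
    gcongr

lemma Continuous.summable_sq_norm_fourierCoeffOn {g : ℝ → ℂ} (hg : Continuous g) :
    Summable fun k : ℤ => ‖fourierCoeffOn one_pos g k‖ ^ 2 := by
  refine (hasSum_sq_fourierCoeffOn one_pos ?_).summable
  obtain ⟨C, hC⟩ := (isCompact_Icc (a := (0 : ℝ)) (b := 1)).exists_bound_of_continuousOn
    hg.continuousOn
  refine MeasureTheory.MemLp.of_bound hg.aestronglyMeasurable C ?_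
  filter_upwards [MeasureTheory.ae_restrict_mem measurableSet_Ioc] with x hx
  exact hC x (Set.Ioc_subset_Icc_self hx)

/-- The cohomological equation over a Diophantine rotation. -/
theorem exists_contDiff_eq_comp_add_sub {α c : ℝ} (hc : 0 < c)
    (hα : ∀ q p : ℤ, q ≠ 0 → c * |(q : ℝ)| ^ (-(7 / 5) : ℝ) ≤ |q * α - p|) {r : ℕ} (hr : 2 ≤ r)
    {f : ℝ → ℝ} (hf : ContDiff ℝ r f) (hper : Function.Periodic f 1) :
    ∃ w : ℝ → ℝ, ContDiff ℝ (r - 2 : ℕ) w ∧ Function.Periodic w 1 ∧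
      ∀ x, f x = w (x + α) - w x + ∫ t in (0 : ℝ)..1, f t := by
  set F : ℝ → ℂ := fun x => f x with hF
  have hFc : ContDiff ℝ r F := Complex.ofRealCLM.contDiff.comp hf
  have hFper : Function.Periodic F 1 := fun x => by simp [hF, hper x]
  set g : C(UnitAddCircle, ℂ) := ⟨hFper.lift, continuous_coinduced_dom.2 hFc.continuous⟩ with hg
  have hgx : ∀ x : ℝ, g x = F x := fun x => rfl
  have hcoe : ∀ k, fourierCoeff g k = fourierCoeffOn one_pos F k := by
    intro k
    rw [fourierCoeff_eq_intervalIntegral g k 0, fourierCoeffOn_eq_integral]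
    simp_rw [hgx, fourier_coe_apply]
    simp
  have hcoe0 : fourierCoeff g 0 = ((∫ t in (0 : ℝ)..1, f t : ℝ) : ℂ) := by
    rw [fourierCoeff_eq_intervalIntegral g 0 0]
    simp [hgx, hF, intervalIntegral.integral_ofReal]
  set e : ℤ → ℝ → ℂ := fun k x => fourier k (x : UnitAddCircle) with he
  have he1 : ∀ k x, ‖e k x‖ = 1 := fun k x => Circle.norm_coe _
  have headd : ∀ k x y, e k (x + y) = e k x * e k y := by
    intro k x y
    simp_rw [he, fourier_coe_apply, ← Complex.exp_add]
    congr 1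
    push_cast
    ring
  have hlow : ∀ k : ℤ, k ≠ 0 → 4 * c * |(k : ℝ)| ^ (-(7 / 5) : ℝ) ≤ ‖e k α - 1‖ := by
    intro k hk
    have h1 := four_mul_abs_sub_round_le_norm_exp_sub_one (k * α)
    have h2 : e k α = Complex.exp (2 * Real.pi * Complex.I * (k * α : ℝ)) := by
      simp_rw [he, fourier_coe_apply]
      congr 1
      push_cast
      ring
    rw [h2]
    refine le_trans ?_ h1
    rw [mul_assoc]
    exact mul_le_mul_of_nonneg_left (hα k _ hk) (by norm_num)
  set b : ℤ → ℝ := fun k => ‖fourierCoeffOn one_pos (iteratedDeriv r F) k‖ with hb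
  have hb2 : Summable fun k => b k ^ 2 :=
    (hFc.continuous_iteratedDeriv r le_rfl).summable_sq_norm_fourierCoeffOn
  have hFb : ∀ k : ℤ, k ≠ 0 → |(k : ℝ)| ^ r * ‖fourierCoeff g k‖ ≤ b k := fun k hk => by
    rw [hcoe]
    exact norm_fourierCoeffOn_iteratedDeriv hFc hFper k hk
  set a : ℤ → ℂ := fun k => fourierCoeff g k / (e k α - 1) with ha
  have ha0 : a 0 = 0 := by simp [ha, he]
  have hsum : Summable fun k : ℤ => |(k : ℝ)| ^ (r - 2) * ‖a k‖ := by
    have hs := ((Real.summable_abs_int_rpow (b := 6 / 5) (by norm_num)).add hb2).mul_left (1 / (4 * c))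
    refine hs.of_nonneg_of_le (fun k => by positivity) fun k => ?_
    rcases eq_or_ne k 0 with rfl | hk
    · rw [ha0, norm_zero, mul_zero]
      positivity
    · have hk' : 0 < |(k : ℝ)| := abs_pos.2 (by exact_mod_cast hk)
      have hp : 0 < |(k : ℝ)| ^ (-(7 / 5) : ℝ) := Real.rpow_pos_of_pos hk' _
      have h3 : |(k : ℝ)| ^ (-(6 / 5) : ℝ) = (|(k : ℝ)| ^ (-(3 / 5) : ℝ)) ^ 2 := by
        rw [← Real.rpow_mul_natCast hk'.le]
        norm_num
      have h4 : |(k : ℝ)| ^ r = |(k : ℝ)| ^ (r - 2) * |(k : ℝ)| ^ 2 := by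
        rw [← pow_add, Nat.sub_add_cancel hr]
      have h5 : |(k : ℝ)| ^ (-(3 / 5) : ℝ) * |(k : ℝ)| ^ 2 * |(k : ℝ)| ^ (-(7 / 5) : ℝ) = 1 := by
        rw [← Real.rpow_natCast, ← Real.rpow_add hk', ← Real.rpow_add hk']
        norm_num
      have hbk : 0 ≤ b k := norm_nonneg _
      have h6 := hFb k hk
      set u := |(k : ℝ)| ^ (-(3 / 5) : ℝ) with hu
      have hu0 : 0 < u := Real.rpow_pos_of_pos hk' _
      calc |(k : ℝ)| ^ (r - 2) * ‖a k‖
          = |(k : ℝ)| ^ (r - 2) * ‖fourierCoeff g k‖ / ‖e k α - 1‖ := by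
            rw [ha, norm_div, mul_div_assoc]
        _ ≤ |(k : ℝ)| ^ (r - 2) * ‖fourierCoeff g k‖ / (4 * c * |(k : ℝ)| ^ (-(7 / 5) : ℝ)) :=
            div_le_div_of_nonneg_left (by positivity) (by positivity) (hlow k hk)
        _ = 1 / (4 * c) * (u * (|(k : ℝ)| ^ r * ‖fourierCoeff g k‖)) := by
            rw [h4, div_eq_iff (by positivity)]
            have h7 : 1 / (4 * c) * (4 * c) = 1 := one_div_mul_cancel (by positivity)
            linear_combination (-(|(k : ℝ)| ^ (r - 2) * ‖fourierCoeff g k‖)) * h5 -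
              (|(k : ℝ)| ^ (r - 2) * ‖fourierCoeff g k‖) *
                (u * |(k : ℝ)| ^ 2 * |(k : ℝ)| ^ (-(7 / 5) : ℝ)) * h7
        _ ≤ 1 / (4 * c) * (u * b k) := by gcongr
        _ ≤ 1 / (4 * c) * (u ^ 2 + b k ^ 2) := by
            gcongr
            nlinarith [sq_nonneg (u - b k)]
        _ = _ := by rw [h3]
  have hne : ∀ k : ℤ, k ≠ 0 → e k α - 1 ≠ 0 := fun k hk h => by
    have h1 := hlow k hk
    have hk' : 0 < |(k : ℝ)| := abs_pos.2 (by exact_mod_cast hk)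
    rw [h, norm_zero] at h1
    have : 0 < |(k : ℝ)| ^ (-(7 / 5) : ℝ) := Real.rpow_pos_of_pos hk' _
    nlinarith
  have hasum : Summable fun k => ‖a k‖ := by
    refine hsum.of_nonneg_of_le (fun k => norm_nonneg _) fun k => ?_
    rcases eq_or_ne k 0 with rfl | hk
    · rw [ha0, norm_zero, mul_zero]
    · have h1 : (1 : ℝ) ≤ |(k : ℝ)| := by exact_mod_cast Int.one_le_abs hk
      exact le_mul_of_one_le_left (norm_nonneg _) (one_le_pow₀ h1)
  have hfsum : Summable (fourierCoeff g) := by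
    have h1 : Summable fun k => a k * (e k α - 1) := by
      refine Summable.of_norm_bounded (hasum.mul_left 2) fun k => ?_
      rw [norm_mul, mul_comm]
      gcongr
      calc ‖e k α - 1‖ ≤ ‖e k α‖ + ‖(1 : ℂ)‖ := norm_sub_le _ _
        _ = 2 := by rw [he1, norm_one]; norm_num
    refine (h1.add (hasSum_ite_eq (0 : ℤ) (fourierCoeff g 0)).summable).congr fun k => ?_
    rcases eq_or_ne k 0 with rfl | hk
    · simp [ha0]
    · simp [ha, div_mul_cancel₀ _ (hne k hk), hk]
  set W : ℝ → ℂ := fun x => ∑' k, a k * e k x with hW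
  have hWsum : ∀ x, HasSum (fun k => a k * e k x) (W x) := fun x => by
    refine (Summable.of_norm ?_).hasSum
    simpa [he1] using hasum
  have hWc : ContDiff ℝ (r - 2 : ℕ) W := contDiff_tsum_fourier ha0 hsum
  refine ⟨fun x => (W x).re, Complex.reCLM.contDiff.comp hWc, fun x => ?_, fun x => ?_⟩
  · have : ((x + 1 : ℝ) : UnitAddCircle) = x := AddCircle.coe_add_period 1 x
    simp only [hW, he, this]
  · have h1 := has_pointwise_sum_fourier_series_of_summable hfsum (x : UnitAddCircle)
    have h2 := ((hWsum (x + α)).sub (hWsum x)).add (hasSum_ite_eq (0 : ℤ) (fourierCoeff g 0))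
    have h3 : (fun k => a k * e k (x + α) - a k * e k x + if k = 0 then fourierCoeff g 0 else 0) =
        fun k => fourierCoeff g k • fourier k (x : UnitAddCircle) := by
      ext k
      rcases eq_or_ne k 0 with rfl | hk
      · simp [ha0]
      · rw [headd, if_neg hk, add_zero, smul_eq_mul]
        have := div_mul_cancel₀ (fourierCoeff g k) (hne k hk)
        linear_combination (e k x) * this
    rw [h3] at h2
    have h4 := h1.unique h2
    rw [hgx, hcoe0] at h4
    have h5 := congrArg Complex.re h4
    simpa [hF] using h5

/-- A continuous function with periods `1` and an irrational `a` is constant. -/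
lemma Function.Periodic.eq_of_irrational {g : ℝ → ℝ} (hg : Continuous g)
    (h1 : Function.Periodic g 1) {a : ℝ} (ha : Irrational a) (hga : Function.Periodic g a) (x : ℝ) :
    g x = g 0 := by
  have hdense : Dense (AddSubgroup.closure {a, 1} : Set ℝ) :=
    dense_addSubgroupClosure_pair_iff.2 (by simpa using ha)
  have h2 : ∀ y ∈ AddSubgroup.closure {a, (1 : ℝ)}, Function.Periodic g y := by
    intro y hy
    induction hy using AddSubgroup.closure_induction with
    | mem y hy =>
      rcases hy with rfl | hy
      · exact hga
      · rw [Set.mem_singleton_iff.1 hy]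
        exact h1
    | zero => exact fun x => by rw [add_zero]
    | add y z _ _ hy hz => exact hy.add_period hz
    | neg y _ hy => exact hy.neg
  have h3 : g = fun _ => g 0 :=
    Continuous.ext_on hdense hg continuous_const fun y hy => by simpa using h2 y hy 0
  exact congrFun h3 x

theorem stmt6 (α : Fin 3 → ℝ) (hα1 : α 0 = 1)
    (hirr2 : Irrational (α 1)) (halg2 : IsAlgebraic ℚ (α 1))
    (hirr3 : Irrational (α 2)) (halg3 : IsAlgebraic ℚ (α 2))
    (r : ℕ) (hr : 2 ≤ r)
    (Ψ : (Fin 3 → ℤ) → ℝ → ℝ)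
    (hcoc : ∀ m n : Fin 3 → ℤ, ∀ x : ℝ,
      Ψ (n + m) x = Ψ m x + Ψ n (x + ∑ i, (m i : ℝ) * α i))
    (hreg : ∀ n : Fin 3 → ℤ, ContDiff ℝ r (Ψ n))
    (hper : ∀ (n : Fin 3 → ℤ) (x : ℝ), Ψ n (x + 1) = Ψ n x) :
    (∀ m n : Fin 3 → ℤ,
        (∫ x in (0:ℝ)..1, Ψ (m + n) x) = (∫ x in (0:ℝ)..1, Ψ m x) + ∫ x in (0:ℝ)..1, Ψ n x) ∧
    ∃ w : ℝ → ℝ,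
      Continuous w ∧ (∀ x : ℝ, w (x + 1) = w x) ∧ ContDiff ℝ (r - 2 : ℕ) w ∧
      ∀ (n : Fin 3 → ℤ) (x : ℝ),
        Ψ n x = w (x + ∑ i, (n i : ℝ) * α i) - w x + ∫ t in (0:ℝ)..1, Ψ n t := by
  have hshift : ∀ g : ℝ → ℝ, Function.Periodic g 1 → ∀ s,
      ∫ x in (0 : ℝ)..1, g (x + s) = ∫ x in (0 : ℝ)..1, g x := by
    intro g hg s
    have := hg.intervalIntegral_add_eq s 0
    rw [intervalIntegral.integral_comp_add_right]
    simpa [add_comm] using this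
  have hcont : ∀ n, Continuous (Ψ n) := fun n => (hreg n).continuous
  refine ⟨fun m n => ?_, ?_⟩
  · have h : Continuous fun x => Ψ m (x + ∑ i, (n i : ℝ) * α i) :=
      (hcont m).comp (continuous_add_const _)
    simp_rw [hcoc n m]
    rw [intervalIntegral.integral_add ((hcont n).intervalIntegrable _ _)
      (h.intervalIntegrable _ _), hshift _ (hper m), add_comm]
  obtain ⟨c, hc, hdio⟩ := halg2.exists_mul_rpow_le_abs_mul_sub hirr2 (δ := 2 / 5) (by norm_num)
    (by norm_num)
  rw [show (1 : ℝ) + 2 / 5 = 7 / 5 by norm_num] at hdio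
  obtain ⟨w, hw, hw1, hwe⟩ := exists_contDiff_eq_comp_add_sub hc hdio hr (hreg (Pi.single 1 1))
    (hper _)
  refine ⟨w, hw.continuous, hw1, hw, fun n x => ?_⟩
  have hsingle : ∑ i, ((Pi.single 1 1 : Fin 3 → ℤ) i : ℝ) * α i = α 1 := by
    simp [Fin.sum_univ_three]
  set s := ∑ i, (n i : ℝ) * α i with hs
  set g : ℝ → ℝ := fun x => Ψ n x - (w (x + s) - w x) with hg
  have hgc : Continuous g :=
    (hcont n).sub ((hw.continuous.comp (continuous_add_const _)).sub hw.continuous)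
  have hg1 : Function.Periodic g 1 := fun x => by
    simp only [hg, hper n x, hw1 x, add_right_comm x 1 s, hw1 (x + s)]
  have hga : Function.Periodic g (α 1) := fun x => by
    have h1 := hcoc (Pi.single 1 1) n x
    have h2 := hcoc n (Pi.single 1 1) x
    rw [hsingle] at h1
    rw [add_comm, h1, ← hs, hwe x, hwe (x + s)] at h2
    simp only [hg, add_right_comm x (α 1) s]
    linarith
  have hconst := hg1.eq_of_irrational hgc hirr2 hga
  have hgint : ∫ t in (0 : ℝ)..1, g t = ∫ t in (0 : ℝ)..1, Ψ n t := by
    have hi : ∀ v : ℝ → ℝ, Continuous v → IntervalIntegrable v MeasureTheory.volume 0 1 :=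
      fun v hv => hv.intervalIntegrable _ _
    have hws : Continuous fun x => w (x + s) := hw.continuous.comp (continuous_add_const s)
    have hd : Continuous fun x => w (x + s) - w x := hws.sub hw.continuous
    rw [hg, intervalIntegral.integral_sub (hi _ (hcont n)) (hi _ hd),
      intervalIntegral.integral_sub (hi _ hws) (hi _ hw.continuous)]
    simp [hshift w hw1]
  simp_rw [hconst] at hgint
  have h5 := hconst x
  simp only [intervalIntegral.integral_const, sub_zero, one_smul] at hgint
  rw [← hgint, ← h5]
  simp [hg]
end

section
/- Let α = (α₁, α₂, α₃) ∈ ℝ³ with α₁ = 1, let r ≥ 1 be an integer, and let Ψ : ℤ³ × ℝ → ℝ be a cocycle over the translation action T(n, x) = x + n·α such that for each n ∈ ℤ³ the map x ↦ Ψ(n, x) is r-times continuously differentiable. Then there exists an r-times continuously differentiable function v : ℝ → ℝ such that the map Ψ̄ : ℤ³ × ℝ → ℝ defined by Ψ̄(n, x) := Ψ(n, x) + v(x + n·α) − v(x) is again a cocycle over T and is 1-periodic in the second variable: Ψ̄(n, x + 1) = Ψ̄(n, x) for all n ∈ ℤ³ and all x ∈ ℝ. -/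
/-- The equation `v (x + 1) - v x = g x` has a `C^r` solution when the `C^r` function `g` vanishes
near `-∞`. -/
theorem exists_contDiff_add_one_sub_eq_of_eq_zero {r : WithTop ℕ∞} {g : ℝ → ℝ}
    (hg : ContDiff ℝ r g) (a : ℝ) (ha : ∀ x ≤ a, g x = 0) :
    ∃ v : ℝ → ℝ, ContDiff ℝ r v ∧ ∀ x, v (x + 1) - v x = g x := by
  have hz (N : ℕ) (x : ℝ) (hx : x < a + N) (k : ℕ) (hk : k ∉ Finset.range N) :
      g (x - (k + 1)) = 0 := by
    have : (N : ℝ) ≤ k := by exact_mod_cast not_lt.mp (by simpa using hk)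
    exact ha _ (by linarith)
  refine ⟨fun x => ∑' k : ℕ, g (x - (k + 1)), contDiff_iff_contDiffAt.2 fun x => ?_,
    fun x => ?_⟩
  · obtain ⟨N, hN⟩ := exists_nat_gt (x - a)
    have hfin : ContDiff ℝ r fun y => ∑ k ∈ Finset.range N, g (y - (k + 1)) :=
      ContDiff.sum fun k _ => hg.comp (contDiff_id.sub contDiff_const)
    refine hfin.contDiffAt.congr_of_eventuallyEq ?_
    filter_upwards [Iio_mem_nhds (show x < a + N by linarith)] with y hy
    exact tsum_eq_sum (hz N y hy)
  · obtain ⟨N, hN⟩ := exists_nat_gt (x + 1 - a)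
    have hs : Summable fun k : ℕ => g (x + 1 - (k + 1)) :=
      summable_of_ne_finset_zero (hz N (x + 1) (by linarith))
    have h := hs.tsum_eq_zero_add
    have hshift (k : ℕ) : x + 1 - (((k + 1 : ℕ) : ℝ) + 1) = x - (k + 1) := by
      push_cast; ring
    have h0 : x + 1 - (((0 : ℕ) : ℝ) + 1) = x := by simp
    simp only [hshift, h0] at h
    exact sub_eq_of_eq_add h

/-- The equation `v (x + 1) - v x = g x` has a `C^r` solution for every `C^r` function `g`. -/
theorem exists_contDiff_add_one_sub_eq {r : ℕ} {g : ℝ → ℝ} (hg : ContDiff ℝ r g) :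
    ∃ v : ℝ → ℝ, ContDiff ℝ r v ∧ ∀ x, v (x + 1) - v x = g x := by
  have hs : ContDiff ℝ r Real.smoothTransition := Real.smoothTransition.contDiff
  obtain ⟨v, hv, hv'⟩ := exists_contDiff_add_one_sub_eq_of_eq_zero (hs.mul hg) 0 fun x hx => by
    simp [Real.smoothTransition.zero_of_nonpos hx]
  have hrefl : ContDiff ℝ r fun y : ℝ => -y - 1 := contDiff_neg.sub contDiff_const
  obtain ⟨w, hw, hw'⟩ := exists_contDiff_add_one_sub_eq_of_eq_zero
    (((hs.comp hrefl).sub contDiff_const).mul (hg.comp hrefl) :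
      ContDiff ℝ r fun y => (Real.smoothTransition (-y - 1) - 1) * g (-y - 1)) (-2) fun x hx => by
    simp [Real.smoothTransition.one_of_one_le (show 1 ≤ -x - 1 by linarith)]
  refine ⟨fun x => v x + w (-x), hv.add (hw.comp contDiff_neg), fun x => ?_⟩
  have h₁ := hv' x
  have h₂ := hw' (-(x + 1))
  rw [Function.comp_apply, show -(x + 1) + 1 = -x by ring,
    show -(-(x + 1)) - 1 = x by ring] at h₂
  linarith

/-- every `C^r` cocycle over the translation `ℤ³`-action `T(n,x) = x + n·α`
(with `α₁ = 1`) is `C^r`-cohomologous to a cocycle that is `1`-periodic in the second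
variable. -/
theorem stmt7 (α : Fin 3 → ℝ) (hα1 : α 0 = 1)
    (r : ℕ) (hr : 1 ≤ r)
    (Ψ : (Fin 3 → ℤ) → ℝ → ℝ)
    (hcoc : ∀ m n : Fin 3 → ℤ, ∀ x : ℝ,
      Ψ (n + m) x = Ψ m x + Ψ n (x + ∑ i, (m i : ℝ) * α i))
    (hreg : ∀ n : Fin 3 → ℤ, ContDiff ℝ r (Ψ n)) :
    ∃ v : ℝ → ℝ, ContDiff ℝ r v ∧
      (∀ m n : Fin 3 → ℤ, ∀ x : ℝ,
        (fun (n : Fin 3 → ℤ) (x : ℝ) => Ψ n x + v (x + ∑ i, (n i : ℝ) * α i) - v x) (n + m) x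
          = (fun (n : Fin 3 → ℤ) (x : ℝ) => Ψ n x + v (x + ∑ i, (n i : ℝ) * α i) - v x) m x
            + (fun (n : Fin 3 → ℤ) (x : ℝ) => Ψ n x + v (x + ∑ i, (n i : ℝ) * α i) - v x) n
                (x + ∑ i, (m i : ℝ) * α i)) ∧
      (∀ (n : Fin 3 → ℤ) (x : ℝ),
        Ψ n (x + 1) + v (x + 1 + ∑ i, (n i : ℝ) * α i) - v (x + 1)
          = Ψ n x + v (x + ∑ i, (n i : ℝ) * α i) - v x) := by
  obtain ⟨v, hv, hv'⟩ := exists_contDiff_add_one_sub_eq (hreg (Pi.single 0 1)).neg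
  refine ⟨v, hv, fun m n x => ?_, fun n x => ?_⟩
  · have hadd : x + ∑ i, ((n + m) i : ℝ) * α i
        = x + ∑ i, (m i : ℝ) * α i + ∑ i, (n i : ℝ) * α i := by
      simp only [Pi.add_apply, Int.cast_add, add_mul, Finset.sum_add_distrib]
      ring
    simp only [hadd, hcoc m n x]
    ring
  · have he : ∑ i, ((Pi.single 0 1 : Fin 3 → ℤ) i : ℝ) * α i = 1 := by
      simp [Fin.sum_univ_three, hα1]
    have h₁ := hcoc (Pi.single 0 1) n x
    have h₂ := hcoc n (Pi.single 0 1) x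
    rw [he] at h₁
    rw [add_comm] at h₂
    have h₃ := hv' x
    have h₄ := hv' (x + ∑ i, (n i : ℝ) * α i)
    rw [add_right_comm] at h₄
    linarith
end

section
/- Let A be a 3×3 matrix with integer entries whose characteristic polynomial is irreducible over ℚ. Let λ ∈ ℝ be a real eigenvalue of A and let w ∈ ℝ³ be a nonzero vector with Aᵀw = λw. Then every coordinate of w is nonzero, and for all indices i ≠ j the ratio wᵢ/wⱼ is an irrational real number that is algebraic over ℚ. -/
open Polynomial Matrix in
/-- If the characteristic polynomial of `M` is irreducible, every nonzero vector is cyclic. -/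
theorem exists_aeval_mulVec_eq_of_irreducible_charpoly {K n : Type*} [Field K] [Fintype n]
    [DecidableEq n] (M : Matrix n n K) (hM : Irreducible M.charpoly) {q : n → K} (hq : q ≠ 0)
    (v : n → K) : ∃ p : K[X], aeval M p *ᵥ q = v := by
  let f : K[X] →ₗ[K] (n → K) :=
    (LinearMap.flip (Matrix.mulVecBilin K K) q).comp (aeval M).toLinearMap
  let g : degreeLT K (Fintype.card n) →ₗ[K] (n → K) := f.comp (degreeLT K (Fintype.card n)).subtype
  have hg : Function.Injective g := by
    rw [← LinearMap.ker_eq_bot, LinearMap.ker_eq_bot']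
    rintro ⟨p, hp⟩ h
    have h0 : aeval M p *ᵥ q = 0 := h
    by_contra hne
    have hp0 : p ≠ 0 := fun h' => hne (Subtype.ext h')
    have hnd : ¬ M.charpoly ∣ p := by
      intro hd
      have hle := degree_le_of_dvd hd hp0
      rw [M.charpoly_degree_eq_dim] at hle
      exact absurd (mem_degreeLT.1 hp) (not_lt.2 hle)
    obtain ⟨a, b, hab⟩ := (hM.coprime_iff_not_dvd).2 hnd
    have h1 := congrArg (fun r => aeval M r *ᵥ q) hab
    simp only [map_add, map_mul, aeval_self_charpoly, mul_zero, zero_add, map_one, one_mulVec,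
      ← mulVec_mulVec, h0, mulVec_zero] at h1
    exact hq h1.symm
  have hrank : Module.finrank K (degreeLT K (Fintype.card n)) = Module.finrank K (n → K) := by
    rw [(degreeLTEquiv K (Fintype.card n)).finrank_eq]
    simp
  have : FiniteDimensional K (degreeLT K (Fintype.card n)) :=
    Module.Finite.equiv (degreeLTEquiv K (Fintype.card n)).symm
  obtain ⟨p, hp⟩ := (LinearMap.injective_iff_surjective_of_finrank_eq_finrank hrank).1 hg v
  exact ⟨p, hp⟩

open Polynomial Matrix in
/-- Pairing with an eigenvector of the transpose turns `p(M)` into the scalar `p(l)`. -/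
theorem algebraMap_aeval_mulVec_dotProduct {K L n : Type*} [Field K] [Field L] [Algebra K L]
    [Fintype n] [DecidableEq n] (M : Matrix n n K) {l : L} {w : n → L}
    (h : (M.map (algebraMap K L))ᵀ *ᵥ w = l • w) (p : K[X]) (q : n → K) :
    (algebraMap K L ∘ (aeval M p *ᵥ q)) ⬝ᵥ w = aeval l p * ((algebraMap K L ∘ q) ⬝ᵥ w) := by
  have key (q : n → K) :
      (algebraMap K L ∘ (M *ᵥ q)) ⬝ᵥ w = l * ((algebraMap K L ∘ q) ⬝ᵥ w) := by
    have : algebraMap K L ∘ (M *ᵥ q) = M.map (algebraMap K L) *ᵥ (algebraMap K L ∘ q) :=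
      funext fun i => RingHom.map_mulVec (algebraMap K L) M q i
    rw [this, ← vecMul_transpose, ← dotProduct_mulVec, h, dotProduct_smul, smul_eq_mul]
  induction p using Polynomial.induction_on generalizing q with
  | C a =>
    have : aeval M (C a) *ᵥ q = a • q := by
      simp [Algebra.algebraMap_eq_smul_one, smul_mulVec]
    rw [this, aeval_C]
    simp [dotProduct, Finset.mul_sum, mul_assoc]
  | add p r hp hr =>
    have : algebraMap K L ∘ (aeval M p *ᵥ q + aeval M r *ᵥ q) =
      algebraMap K L ∘ (aeval M p *ᵥ q) + algebraMap K L ∘ (aeval M r *ᵥ q) := by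
      ext i; simp
    rw [map_add, add_mulVec, this, add_dotProduct, hp, hr, map_add, add_mul]
  | monomial k a ih =>
    rw [pow_succ, ← mul_assoc, map_mul, aeval_X, ← mulVec_mulVec, ih, key,
      map_mul (aeval l) _ X, aeval_X, mul_assoc]

/-- if `A` is an integer `3×3` matrix whose characteristic polynomial is
irreducible over `ℚ`, `λ` is a real eigenvalue and `w ≠ 0` satisfies `Aᵀ w = λ w`, then
all coordinates of `w` are nonzero and all ratios `wᵢ/wⱼ` (`i ≠ j`) are irrational
algebraic numbers. -/
theorem stmt8 (A : Matrix (Fin 3) (Fin 3) ℤ)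
    (hirred : Irreducible (Matrix.charpoly (A.map (Int.cast : ℤ → ℚ))))
    (l : ℝ) (w : Fin 3 → ℝ) (hw : w ≠ 0)
    (heig : (A.map (Int.cast : ℤ → ℝ)).transpose.mulVec w = l • w) :
    (∀ i : Fin 3, w i ≠ 0) ∧
    ∀ i j : Fin 3, i ≠ j → Irrational (w i / w j) ∧ IsAlgebraic ℚ (w i / w j) := by
  set M : Matrix (Fin 3) (Fin 3) ℚ := A.map (Int.cast : ℤ → ℚ) with hM
  have hMR : M.map (algebraMap ℚ ℝ) = A.map (Int.cast : ℤ → ℝ) := by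
    ext i j
    simp [hM]
  have hMw : (M.map (algebraMap ℚ ℝ)).transpose.mulVec w = l • w := by rw [hMR, heig]
  have hsingle (i : Fin 3) :
      dotProduct (algebraMap ℚ ℝ ∘ (Pi.single i 1 : Fin 3 → ℚ)) w = w i := by
    simp [dotProduct, Pi.single_apply]
  have hcyc {q : Fin 3 → ℚ} (hq : q ≠ 0) (i : Fin 3) :
      ∃ p : Polynomial ℚ, w i = Polynomial.aeval l p * dotProduct (algebraMap ℚ ℝ ∘ q) w := by
    obtain ⟨p, hp⟩ :=
      exists_aeval_mulVec_eq_of_irreducible_charpoly M hirred hq (Pi.single i 1)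
    exact ⟨p, by rw [← algebraMap_aeval_mulVec_dotProduct M hMw, hp, hsingle]⟩
  have hindep {q : Fin 3 → ℚ} (hq : q ≠ 0) : dotProduct (algebraMap ℚ ℝ ∘ q) w ≠ 0 := by
    intro h0
    refine hw (funext fun i => ?_)
    obtain ⟨p, hp⟩ := hcyc hq i
    rw [hp, h0, mul_zero, Pi.zero_apply]
  have hsingle_ne (i : Fin 3) : (Pi.single i 1 : Fin 3 → ℚ) ≠ 0 := by simp
  have hne (i : Fin 3) : w i ≠ 0 := hsingle i ▸ hindep (hsingle_ne i)
  have hl : IsAlgebraic ℚ l := by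
    refine ⟨M.charpoly, hirred.ne_zero, ?_⟩
    have h := algebraMap_aeval_mulVec_dotProduct M hMw M.charpoly (Pi.single 0 1)
    rw [Matrix.aeval_self_charpoly, Matrix.zero_mulVec, hsingle] at h
    have h' : Polynomial.aeval l M.charpoly * w 0 = 0 := by
      rw [← h]
      simp [dotProduct]
    exact (mul_eq_zero.1 h').resolve_right (hne 0)
  refine ⟨hne, fun i j hij => ⟨?_, ?_⟩⟩
  · rintro ⟨r, hr⟩
    have hq : (Pi.single i 1 - r • Pi.single j 1 : Fin 3 → ℚ) ≠ 0 := by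
      intro h
      simpa [hij] using congrFun h i
    apply hindep hq
    have hcomp : algebraMap ℚ ℝ ∘ (Pi.single i 1 - r • Pi.single j 1 : Fin 3 → ℚ) =
        algebraMap ℚ ℝ ∘ (Pi.single i 1 : Fin 3 → ℚ) -
          (r : ℝ) • (algebraMap ℚ ℝ ∘ (Pi.single j 1 : Fin 3 → ℚ)) := by
      ext k
      simp
    rw [hcomp, sub_dotProduct, smul_dotProduct, hsingle, hsingle, hr, smul_eq_mul,
      div_mul_cancel₀ _ (hne j), sub_self]
  · obtain ⟨p, hp⟩ := hcyc (hsingle_ne j) i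
    rw [hsingle] at hp
    rw [hp, mul_div_cancel_right₀ _ (hne j)]
    exact (adjoin_le_integralClosure hl.isIntegral
      (Polynomial.aeval_mem_adjoin_singleton ℚ l)).isAlgebraic
end

section
/- Let C > 0 and τ > 1, let α ∈ ℝ be (C, τ)-Diophantine, and let s be an integer with s > τ. Let ψ : ℝ → ℝ be an s-times continuously differentiable function with ψ(t + 1) = ψ(t) for all t. Then there exists a continuous function w : ℝ → ℝ with w(t + 1) = w(t) for all t, such that w(t + α) − w(t) = ψ(t) − ∫₀¹ ψ(x) dx for all t ∈ ℝ. Moreover, w is m-times continuously differentiable for every integer m with 0 ≤ m < s − τ. -/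
/-- An integer part is at most twice the number in absolute value, away from `[-1, 1]`. -/
lemma abs_floor_le_two_mul_abs {y : ℝ} (hy : 1 < |y|) : |(⌊y⌋ : ℝ)| ≤ 2 * |y| := by
  have h1 := Int.floor_le y
  have h2 := Int.lt_floor_add_one y
  rw [abs_le]
  rcases abs_cases y with ⟨h, _⟩ | ⟨h, _⟩ <;> rw [h] at hy ⊢ <;> constructor <;> linarith

lemma floor_ne_zero_of_one_lt_abs {y : ℝ} (hy : 1 < |y|) : ⌊y⌋ ≠ 0 := by
  intro h
  rw [Int.floor_eq_zero_iff] at h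
  rw [abs_of_nonneg h.1] at hy
  exact absurd h.2 (by linarith)

/-- The fractional parts of the multiples of a Diophantine number with index below `2 ^ (L + 1)`
in absolute value are separated. -/
lemma lt_abs_sub_round_sub {C τ α : ℝ} (hC : 0 < C) (hτ : 0 < τ)
    (hdio : ∀ q : ℤ, q ≠ 0 → ∀ p : ℤ, |(q : ℝ) * α - p| > C * (|(q : ℝ)|) ^ (-τ))
    {L : ℕ} {n n' : ℤ} (hn : n.natAbs < 2 ^ (L + 1)) (hn' : n'.natAbs < 2 ^ (L + 1))
    (hne : n ≠ n') :
    C * ((2 : ℝ) ^ (L + 2)) ^ (-τ) <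
      |((n : ℝ) * α - round ((n : ℝ) * α)) - ((n' : ℝ) * α - round ((n' : ℝ) * α))| := by
  have hq : n - n' ≠ 0 := sub_ne_zero.2 hne
  have h := hdio (n - n') hq (round ((n : ℝ) * α) - round ((n' : ℝ) * α))
  have hle : |((n - n' : ℤ) : ℝ)| ≤ 2 ^ (L + 2) := by
    have h3 : (n - n').natAbs ≤ 2 ^ (L + 2) := by
      have := Int.natAbs_sub_le n n'
      rw [pow_succ]
      omega
    rw [← Int.cast_abs, Int.abs_eq_natAbs]
    exact_mod_cast h3
  have hpos : 0 < |((n - n' : ℤ) : ℝ)| := abs_pos.2 (by exact_mod_cast hq)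
  have h4 := mul_le_mul_of_nonneg_left
    (Real.rpow_le_rpow_of_nonpos hpos hle (neg_nonpos.2 hτ.le)) hC.le
  refine (h4.trans_lt h).trans_eq ?_
  congr 1
  push_cast
  ring

/-- Square summability of the small divisors of a Diophantine number. -/
lemma summable_small_divisors_sq {C τ α : ℝ} (hC : 0 < C) (hτ : 0 < τ)
    (hdio : ∀ q : ℤ, q ≠ 0 → ∀ p : ℤ, |(q : ℝ) * α - p| > C * (|(q : ℝ)|) ^ (-τ))
    {σ : ℝ} (hσ : τ < σ) :
    Summable fun n : ℤ =>
      ((|(n : ℝ)| ^ σ * |(n : ℝ) * α - round ((n : ℝ) * α)|)⁻¹) ^ 2 := by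
  set x : ℤ → ℝ := fun n => (n : ℝ) * α - round ((n : ℝ) * α) with hx
  set δ : ℕ → ℝ := fun L => C * ((2 : ℝ) ^ (L + 2)) ^ (-τ) with hδ
  have hδ0 : ∀ L, 0 < δ L := fun L => by positivity
  set e : ℤ → ℕ × ℤ := fun n => (Nat.log 2 n.natAbs, ⌊x n / δ (Nat.log 2 n.natAbs)⌋) with he
  have hlog : ∀ n : ℤ, n.natAbs < 2 ^ (Nat.log 2 n.natAbs + 1) := fun n =>
    Nat.lt_pow_succ_log_self (by norm_num) _
  have hinj : Function.Injective e := by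
    intro n n' h
    by_contra hne
    simp only [he, Prod.mk.injEq] at h
    obtain ⟨h1, h2⟩ := h
    rw [← h1] at h2
    have h3 := lt_abs_sub_round_sub hC hτ hdio (hlog n) (h1 ▸ hlog n') hne
    have h4 := Int.abs_sub_lt_one_of_floor_eq_floor h2
    rw [← sub_div, abs_div, abs_of_pos (hδ0 _), div_lt_one (hδ0 _)] at h4
    exact lt_asymm h3 h4
  set ρ : ℝ := (((2 : ℝ) ^ (σ - τ))⁻¹) ^ 2 with hρ
  have hρ1 : ρ < 1 := by
    have : 1 < (2 : ℝ) ^ (σ - τ) := Real.one_lt_rpow (by norm_num) (by linarith)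
    exact pow_lt_one₀ (by positivity) (inv_lt_one_of_one_lt₀ this) (by norm_num)
  have hsum : Summable fun k : ℤ => ((|(k : ℝ)|)⁻¹) ^ 2 := by
    refine (Real.summable_one_div_int_pow.2 one_lt_two).congr fun k => ?_
    rw [inv_pow, sq_abs, one_div]
  have hprod : Summable fun p : ℕ × ℤ => ρ ^ p.1 * ((|(p.2 : ℝ)|)⁻¹) ^ 2 :=
    (summable_geometric_of_lt_one (by positivity) hρ1).mul_of_nonneg hsum
      (fun _ => by positivity) (fun _ => by positivity)
  have hcomp := (hprod.comp_injective hinj).mul_left (((C * (4 : ℝ) ^ (-τ) / 2)⁻¹) ^ 2)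
  refine Summable.of_nonneg_of_le (fun _ => by positivity) (fun n => ?_) hcomp
  rcases eq_or_ne n 0 with rfl | hn
  · have : 0 ≤ ((C * (4 : ℝ) ^ (-τ) / 2)⁻¹) ^ 2 *
      ((fun p : ℕ × ℤ => ρ ^ p.1 * ((|(p.2 : ℝ)|)⁻¹) ^ 2) ∘ e) 0 := by
      simp only [Function.comp_apply]
      positivity
    simpa using this
  set L := Nat.log 2 n.natAbs with hL
  have hxn : δ L < |x n| := by
    have := lt_abs_sub_round_sub hC hτ hdio (n' := 0) (hlog n) (by simp) hn
    simpa using this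
  have hy : 1 < |x n / δ L| := by
    rwa [abs_div, abs_of_pos (hδ0 L), one_lt_div (hδ0 L)]
  set k := ⌊x n / δ L⌋ with hk
  have hk0 : 0 < |(k : ℝ)| := abs_pos.2 (by exact_mod_cast floor_ne_zero_of_one_lt_abs hy)
  have hkx : |(k : ℝ)| * δ L / 2 ≤ |x n| := by
    have := abs_floor_le_two_mul_abs hy
    rw [abs_div, abs_of_pos (hδ0 L), ← mul_div_assoc, le_div_iff₀ (hδ0 L)] at this
    linarith
  have hnL : (2 : ℝ) ^ L ≤ |(n : ℝ)| := by
    rw [← Int.cast_abs, Int.abs_eq_natAbs]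
    exact_mod_cast Nat.pow_log_le_self 2 (Int.natAbs_ne_zero.2 hn)
  have hlow : ((2 : ℝ) ^ L) ^ σ * (|(k : ℝ)| * δ L / 2) ≤ |(n : ℝ)| ^ σ * |x n| := by
    have hσ0 : 0 ≤ σ := (hτ.trans hσ).le
    have := hδ0 L
    gcongr
  have hpos : 0 < ((2 : ℝ) ^ L) ^ σ * (|(k : ℝ)| * δ L / 2) := by
    have := hδ0 L
    positivity
  have hid : ((2 : ℝ) ^ L) ^ σ * (|(k : ℝ)| * δ L / 2) =
      (C * (4 : ℝ) ^ (-τ) / 2) * (((2 : ℝ) ^ (σ - τ)) ^ L * |(k : ℝ)|) := by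
    have h1 : ((2 : ℝ) ^ (σ - τ)) ^ L = ((2 : ℝ) ^ L) ^ σ * ((2 : ℝ) ^ L) ^ (-τ) := by
      rw [← Real.rpow_natCast, ← Real.rpow_natCast, ← Real.rpow_mul (by norm_num),
        ← Real.rpow_mul (by norm_num), ← Real.rpow_mul (by norm_num),
        ← Real.rpow_add (by norm_num)]
      congr 1
      ring
    have h2 : ((2 : ℝ) ^ (L + 2)) ^ (-τ) = ((2 : ℝ) ^ L) ^ (-τ) * (4 : ℝ) ^ (-τ) := by
      rw [pow_add, Real.mul_rpow (by positivity) (by positivity)]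
      norm_num
    simp only [hδ]
    rw [h1, h2]
    ring
  calc ((|(n : ℝ)| ^ σ * |x n|)⁻¹) ^ 2
      ≤ ((((2 : ℝ) ^ L) ^ σ * (|(k : ℝ)| * δ L / 2))⁻¹) ^ 2 := by gcongr
    _ = ((C * (4 : ℝ) ^ (-τ) / 2)⁻¹) ^ 2 * (ρ ^ L * ((|(k : ℝ)|)⁻¹) ^ 2) := by
      rw [hid, hρ]
      simp only [mul_inv, mul_pow, inv_pow]
      ring

/-- The distance of `exp (2πiθ)` to `1` is at least the distance of `θ` to the integers. -/
lemma abs_sub_round_le_norm_exp_sub_one (θ : ℝ) :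
    |θ - round θ| ≤ ‖Complex.exp (2 * Real.pi * Complex.I * θ) - 1‖ := by
  have h1 : Complex.exp (2 * Real.pi * Complex.I * θ) =
      Complex.exp (Complex.I * ((2 * Real.pi * (θ - round θ) : ℝ) : ℂ)) := by
    rw [Complex.exp_eq_exp_iff_exists_int]
    refine ⟨round θ, ?_⟩
    push_cast
    ring
  rw [h1, Complex.norm_exp_I_mul_ofReal_sub_one, norm_mul, Real.norm_eq_abs, Real.norm_eq_abs,
    show 2 * Real.pi * (θ - round θ) / 2 = Real.pi * (θ - round θ) by ring]
  have h2 : |Real.pi * (θ - round θ)| ≤ Real.pi / 2 := by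
    rw [abs_mul, abs_of_pos Real.pi_pos]
    nlinarith [abs_sub_round θ, Real.pi_pos]
  have h3 := Real.mul_abs_le_abs_sin h2
  rw [abs_mul, abs_of_pos Real.pi_pos, ← mul_assoc, div_mul_cancel₀ _ Real.pi_ne_zero] at h3
  rw [abs_of_pos (zero_lt_two' ℝ)]
  linarith [abs_nonneg (θ - round θ)]

lemma iteratedDeriv_const_mul_cexp_mul_ofReal (k : ℕ) (d c : ℂ) :
    iteratedDeriv k (fun t : ℝ => d * Complex.exp (c * t)) =
      fun t : ℝ => d * c ^ k * Complex.exp (c * t) := by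
  induction k with
  | zero => simp
  | succ k ih =>
    rw [iteratedDeriv_succ, ih]
    funext t
    have h1 : HasDerivAt (fun t : ℝ => c * (t : ℂ)) (c * 1) t :=
      (Complex.ofRealCLM.hasDerivAt (x := t)).const_mul c
    rw [(h1.cexp.const_mul (d * c ^ k)).deriv]
    ring

/-- Fourier coefficients of the `k`-th derivative of a periodic function. -/
lemma fourierCoeffOn_iteratedDeriv {s : ℕ} {f : ℝ → ℂ} (hf : ContDiff ℝ s f)
    (hper : Function.Periodic f 1) {n : ℤ} (hn : n ≠ 0) {k : ℕ} (hk : k ≤ s) :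
    fourierCoeffOn zero_lt_one (iteratedDeriv k f) n =
      (2 * Real.pi * Complex.I * n) ^ k * fourierCoeffOn zero_lt_one f n := by
  induction k with
  | zero => simp
  | succ k ih =>
    have hd : ∀ x, HasDerivAt (iteratedDeriv k f) (iteratedDeriv (k + 1) f x) x := by
      intro x
      rw [iteratedDeriv_succ]
      exact (hf.differentiable_iteratedDeriv k (by exact_mod_cast hk) x).hasDerivAt
    have hc : Continuous (iteratedDeriv (k + 1) f) :=
      hf.continuous_iteratedDeriv _ (by exact_mod_cast hk)
    have h := fourierCoeffOn_of_hasDerivAt zero_lt_one hn (fun x _ => hd x)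
      (hc.intervalIntegrable 0 1)
    have hp : iteratedDeriv k f 1 = iteratedDeriv k f 0 := by
      have : (fun x => f (x + 1)) = f := funext hper
      have h2 := congrFun (iteratedDeriv_comp_add_const k f 1) 0
      rw [this] at h2
      simpa using h2.symm
    rw [ih (by omega), hp] at h
    have hne : (2 * Real.pi * Complex.I * n : ℂ) ≠ 0 := by
      simp [hn, Real.pi_ne_zero]
    rw [pow_succ', mul_assoc, h]
    have hne2 : (n : ℂ) ≠ 0 := by exact_mod_cast hn
    have hpi : (Real.pi : ℂ) ≠ 0 := by exact_mod_cast Real.pi_ne_zero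
    field_simp
    simp

lemma summable_sq_norm_fourierCoeffOn {f : ℝ → ℂ} (hf : Continuous f) :
    Summable fun n => ‖fourierCoeffOn zero_lt_one f n‖ ^ 2 := by
  refine (hasSum_sq_fourierCoeffOn zero_lt_one ?_).summable
  obtain ⟨M, hM⟩ := isCompact_Icc.exists_bound_of_continuousOn (hf.continuousOn (s := Set.Icc 0 1))
  refine MeasureTheory.MemLp.of_bound hf.aestronglyMeasurable M ?_
  filter_upwards [MeasureTheory.ae_restrict_mem measurableSet_Ioc] with x hx
  exact hM x (Set.Ioc_subset_Icc_self hx)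

/-- Pointwise convergence of an absolutely convergent Fourier series on the real line. -/
lemma hasSum_fourierCoeffOn_mul_cexp {f : ℝ → ℂ} (hf : Continuous f)
    (hper : Function.Periodic f 1) (h : Summable (fourierCoeffOn zero_lt_one f)) (t : ℝ) :
    HasSum (fun n : ℤ => fourierCoeffOn zero_lt_one f n *
      Complex.exp (2 * Real.pi * Complex.I * n * t)) (f t) := by
  have : Fact ((0 : ℝ) < 1) := ⟨one_pos⟩
  let g : C(AddCircle (1 : ℝ), ℂ) := ⟨hper.lift, hf.quotient_liftOn' _⟩
  have hg : fourierCoeff g = fourierCoeffOn zero_lt_one f := by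
    funext n
    rw [fourierCoeff_eq_intervalIntegral _ n 0, fourierCoeffOn_eq_integral]
    simp only [fourier_coe_apply, zero_add, sub_zero]
    rfl
  have h2 := has_pointwise_sum_fourier_series_of_summable (f := g) (hg ▸ h) t
  rw [hg] at h2
  simp only [fourier_coe_apply, Complex.ofReal_one, div_one, smul_eq_mul] at h2
  exact h2


/-- the cohomological equation over the circle rotation by a
`(C, τ)`-Diophantine number: for a `1`-periodic `C^s` function `ψ` with `s > τ`, there is
a `1`-periodic continuous solution `w` of `w(t+α) − w(t) = ψ(t) − ∫₀¹ ψ`, which is `C^m`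
for every integer `m < s − τ`. -/
theorem stmt11 (C τ : ℝ) (hC : 0 < C) (hτ : 1 < τ) (α : ℝ)
    (hdio : ∀ q : ℤ, q ≠ 0 → ∀ p : ℤ, |(q : ℝ) * α - p| > C * (|(q : ℝ)|) ^ (-τ))
    (s : ℕ) (hs : τ < s)
    (ψ : ℝ → ℝ) (hψ : ContDiff ℝ s ψ) (hper : ∀ t : ℝ, ψ (t + 1) = ψ t) :
    ∃ w : ℝ → ℝ, Continuous w ∧ (∀ t : ℝ, w (t + 1) = w t) ∧
      (∀ t : ℝ, w (t + α) - w t = ψ t - ∫ x in (0:ℝ)..1, ψ x) ∧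
      ∀ m : ℕ, (m : ℝ) < s - τ → ContDiff ℝ m w := by
  have hτ0 : 0 < τ := by linarith
  set f : ℝ → ℂ := fun t => (ψ t : ℂ) with hf_def
  have hf : ContDiff ℝ s f := Complex.ofRealCLM.contDiff.comp hψ
  have hfper : Function.Periodic f 1 := fun t => by simp [hf_def, hper t]
  set c : ℤ → ℂ := fourierCoeffOn zero_lt_one f with hc
  set a : ℤ → ℂ := fourierCoeffOn zero_lt_one (iteratedDeriv s f)
  have hac : ∀ n : ℤ, n ≠ 0 → a n = (2 * Real.pi * Complex.I * n) ^ s * c n := fun n hn =>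
    fourierCoeffOn_iteratedDeriv hf hfper hn le_rfl
  have ha2 : Summable fun n => ‖a n‖ ^ 2 :=
    summable_sq_norm_fourierCoeffOn (hf.continuous_iteratedDeriv s le_rfl)
  set D : ℤ → ℂ := fun n => Complex.exp (2 * Real.pi * Complex.I * ((n * α : ℝ) : ℂ)) - 1 with hD
  have hDlow : ∀ n : ℤ, |(n : ℝ) * α - round ((n : ℝ) * α)| ≤ ‖D n‖ := fun n =>
    abs_sub_round_le_norm_exp_sub_one _
  have hround : ∀ n : ℤ, n ≠ 0 → 0 < |(n : ℝ) * α - round ((n : ℝ) * α)| := fun n hn =>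
    lt_of_le_of_lt (by positivity) (hdio n hn _)
  have hD0 : ∀ n : ℤ, n ≠ 0 → D n ≠ 0 := fun n hn =>
    norm_pos_iff.1 ((hround n hn).trans_le (hDlow n))
  set d : ℤ → ℂ := fun n => c n / D n with hd
  have hd0 : d 0 = 0 := by simp [hd, hD]
  have hnorm : ∀ n : ℤ, ‖(2 * Real.pi * Complex.I * n : ℂ)‖ = 2 * Real.pi * |(n : ℝ)| := by
    intro n
    simp [abs_of_pos Real.pi_pos]
  set v : ℕ → ℤ → ℝ := fun k n => ‖d n‖ * (2 * Real.pi * |(n : ℝ)|) ^ k with hv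
  have hvsum : ∀ k : ℕ, (k : ℝ) < s - τ → Summable (v k) := by
    intro k hk
    have hks : k ≤ s := by
      have : (k : ℝ) ≤ s := by linarith
      exact_mod_cast this
    have hb2 := summable_small_divisors_sq hC hτ0 hdio (σ := ((s - k : ℕ) : ℝ))
      (by rw [Nat.cast_sub hks]; linarith)
    refine Summable.of_nonneg_of_le (fun _ => by positivity) (fun n => ?_) (ha2.add hb2)
    rcases eq_or_ne n 0 with rfl | hn
    · simp only [hv, hd0, norm_zero, zero_mul]
      positivity
    have hn0 : 0 < |(n : ℝ)| := abs_pos.2 (by exact_mod_cast hn)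
    have hx0 := hround n hn
    rw [Real.rpow_natCast]
    set y := (|(n : ℝ)| ^ (s - k) * |(n : ℝ) * α - round ((n : ℝ) * α)|)⁻¹ with hy
    have hy0 : 0 < y := by positivity
    have hle : v k n ≤ ‖a n‖ * y := by
      have hD1 : 0 < ‖D n‖ := norm_pos_iff.2 (hD0 n hn)
      have hp : |(n : ℝ)| ≤ 2 * Real.pi * |(n : ℝ)| := by
        nlinarith [Real.pi_gt_three]
      rw [hac n hn, norm_mul, norm_pow, hnorm]
      simp only [hv, hd]
      rw [norm_div, ← Nat.add_sub_of_le hks, pow_add, hy,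
        div_mul_eq_mul_div, ← div_eq_mul_inv, div_le_div_iff₀ hD1 (by positivity)]
      calc ‖c n‖ * (2 * Real.pi * |(n : ℝ)|) ^ k *
            (|(n : ℝ)| ^ (s - k) * |(n : ℝ) * α - round ((n : ℝ) * α)|)
          ≤ ‖c n‖ * (2 * Real.pi * |(n : ℝ)|) ^ k *
            ((2 * Real.pi * |(n : ℝ)|) ^ (s - k) * ‖D n‖) := by
            gcongr
            exact hDlow n
        _ = _ := by ring
    nlinarith [sq_nonneg (‖a n‖ - y), sq_nonneg (‖a n‖), sq_nonneg y]
  set F : ℤ → ℝ → ℂ := fun n t => d n * Complex.exp (2 * Real.pi * Complex.I * n * t) with hF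
  have hexp : ∀ (n : ℤ) (t : ℝ), ‖Complex.exp (2 * Real.pi * Complex.I * n * t)‖ = 1 := by
    intro n t
    rw [show (2 * Real.pi * Complex.I * n * t : ℂ) = ((2 * Real.pi * n * t : ℝ) : ℂ) * Complex.I by
      push_cast; ring]
    exact Complex.norm_exp_ofReal_mul_I _
  set W : ℝ → ℂ := fun t => ∑' n, F n t
  have hWdiff : ∀ m : ℕ, (m : ℝ) < s - τ → ContDiff ℝ m W := by
    intro m hm
    have := contDiff_tsum (𝕜 := ℝ) (N := (m : ℕ∞)) (f := F) (v := v) (fun n => ?_)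
      (fun k hk => hvsum k ?_) (fun k n t _ => ?_)
    · exact_mod_cast this
    · exact contDiff_const.mul
        (Complex.contDiff_exp.comp (contDiff_const.mul Complex.ofRealCLM.contDiff))
    · have : (k : ℝ) ≤ m := by exact_mod_cast hk
      linarith
    · rw [norm_iteratedFDeriv_eq_norm_iteratedDeriv, hF, iteratedDeriv_const_mul_cexp_mul_ofReal,
        norm_mul, norm_mul, norm_pow, hnorm, hexp, mul_one]
  have hs0 : ((0 : ℕ) : ℝ) < s - τ := by
    rw [Nat.cast_zero]
    linarith
  have hd1 : Summable fun n => ‖d n‖ := (hvsum 0 hs0).congr fun n => by simp [hv]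
  have hFsum : ∀ t, Summable fun n => F n t := fun t =>
    Summable.of_norm (hd1.congr fun n => by rw [hF, norm_mul, hexp, mul_one])
  have hdD : ∀ n, d n * D n = c n - if n = 0 then c 0 else 0 := by
    intro n
    rcases eq_or_ne n 0 with rfl | hn
    · simp [hd0]
    · simp [hn, hd, div_mul_cancel₀ _ (hD0 n hn)]
  have hDle : ∀ n, ‖D n‖ ≤ 2 := by
    intro n
    refine (norm_sub_le _ _).trans ?_
    have := hexp n α
    rw [norm_one, show (2 * Real.pi * Complex.I * ((n * α : ℝ) : ℂ)) =
      2 * Real.pi * Complex.I * n * α by push_cast; ring, this]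
    norm_num
  have hcsum : Summable c := by
    have h1 : Summable fun n => d n * D n := by
      refine Summable.of_norm_bounded (hd1.mul_right 2) fun n => ?_
      rw [norm_mul]
      exact mul_le_mul_of_nonneg_left (hDle n) (norm_nonneg _)
    refine (h1.add (hasSum_ite_eq 0 (c 0)).summable).congr fun n => ?_
    rw [hdD]
    ring
  have hc0 : c 0 = ((∫ x in (0 : ℝ)..1, ψ x : ℝ) : ℂ) := by
    rw [hc, fourierCoeffOn_eq_integral]
    simp [hf_def, intervalIntegral.integral_ofReal]
  have hWeq : ∀ t, W (t + α) - W t = ((ψ t - ∫ x in (0 : ℝ)..1, ψ x : ℝ) : ℂ) := by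
    intro t
    have h1 := (hFsum (t + α)).hasSum.sub (hFsum t).hasSum
    have h2 := (hasSum_fourierCoeffOn_mul_cexp hf.continuous hfper hcsum t).sub
      (hasSum_ite_eq (0 : ℤ) (c 0))
    rw [Complex.ofReal_sub, ← hc0]
    refine h1.unique (h2.congr_fun fun n => ?_)
    have h3 : Complex.exp (2 * Real.pi * Complex.I * n * ((t + α : ℝ) : ℂ)) =
        Complex.exp (2 * Real.pi * Complex.I * n * t) * (D n + 1) := by
      rw [hD, sub_add_cancel, ← Complex.exp_add]
      congr 1
      push_cast
      ring
    have h4 : F n (t + α) - F n t =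
        (d n * D n) * Complex.exp (2 * Real.pi * Complex.I * n * t) := by
      simp only [hF]
      rw [h3]
      ring
    rw [h4, hdD]
    rcases eq_or_ne n 0 with rfl | hn
    · simp [hc]
    · simp [hn, hc]
  have hWper : ∀ t, W (t + 1) = W t := by
    intro t
    refine tsum_congr fun n => ?_
    simp only [hF]
    congr 1
    rw [Complex.exp_eq_exp_iff_exists_int]
    refine ⟨n, ?_⟩
    push_cast
    ring
  have hwdiff : ∀ m : ℕ, (m : ℝ) < s - τ → ContDiff ℝ m fun t => (W t).re := fun m hm =>
    Complex.reCLM.contDiff.comp (hWdiff m hm)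
  refine ⟨fun t => (W t).re, (hwdiff 0 hs0).continuous, fun t => ?_, fun t => ?_, hwdiff⟩
  · simp only [hWper]
  · simp only
    rw [← Complex.sub_re, hWeq, Complex.ofReal_re]
end
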